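/- Let $k$ be a field of characteristic $0$, $X$ a topological space and $\mathrm{Sh}_k(X)$ the category of sheaves of $k$-vector spaces on $X$. Let $\Psi$ be a (not necessarily full) pseudo-tensor subcategory of $\mathrm{Sh}_k(X)$: its objects have underlying sheaves, and for every finite set $I$ and objects $L_i$ ($i\in I$), $L$ there is a subsheaf $P_I(\{L_i\},L)\subseteq\underline{\mathrm{Hom}}_k(\bigotimes_{i\in I}L_i,L)$ of $k$-vector spaces of "operations", these being closed under composition and containing the identities, with $P_\emptyset(L)=L$. Assume that $L\otimes_kV$ is in $\Psi$ for every object $L$ and finite-dimensional vector space $V$, that $\mathrm{Id}\otimes f$ is an operation for every linear map $f\colon V\to W$ of finite-dimensional spaces, and that $L\otimes_kk=L$ in $\Psi$. Let $A$ be a unital associative algebra in $\Psi$, with product $m\in\Gamma(X;P_2(A^2,A))$ and unit $1\in\Gamma(X;A)$, and let $R$ be a commutative Artin $k$-algebra, i.e. a finite-dimensional local commutative unital $k$-algebra, with (nilpotent) maximal ideal $\mathfrak m_R$. Let $\mathrm{Def}(A)(R)$ be the following 2-groupoid. Objects are the $R$-star products, i.e. the $m'\in\Gamma(X;P_2(A^2,A\otimes_kR))$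 which reduce to $m$ modulo $\mathfrak m_R$ and whose $R$-bilinear extension to $A\otimes_kR$ is associative. 1-morphisms $m_1\to m_2$ are the $\varphi\in\Gamma(X;P_1(A,A\otimes_kR))$ which reduce to the identity modulo $\mathfrak m_R$ and whose $R$-linear extension is a morphism of algebras $(A\otimes_k R,m_1)\to(A\otimes_k R,m_2)$; they are composed as such morphisms. 2-morphisms $\varphi\Rightarrow\psi$ between 1-morphisms $m_1\to m_2$ are the $b\in1\otimes1+\Gamma(X;A\otimes_k\mathfrak m_R)$ with $m_2(\varphi(a),b)=m_2(b,\psi(a))$ for all local sections $a$ of $A\otimes_kR$. The vertical composition of $b\colon\varphi\Rightarrow\psi$ and $b'\colon\psi\Rightarrow\chi$ is $m_2(b,b')$; the horizontal composition of $b\colon\varphi\Rightarrow\varphi'$ (between 1-morphisms $m_1\to m_2$) and $b'\colon\psi\Rightarrow\psi'$ (between 1-morphisms $m_2\to m_3$) is $m_3(\psi(b),b')$. Let $C^n(A)=P_n(A^n,A)$, $C^0(A)=A$, and let $\mathfrak g=\Gamma(X;C^\bullet(A)[1])\otimes_k\mathfrak m_R$, a nilpotent DGLA in degrees $\ge-1$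 with the $\mathfrak m_R$-bilinear Gerstenhaber bracket ($[f,g]=f\circ g-(-1)^{(p-1)(q-1)}g\circ f$ for $f\in C^p$, $g\in C^q$, where $(f\circ g)(a_1,\dots,a_{p+q-1})=\sum_{i=0}^{p-1}(-1)^{i(q-1)}f(a_1,\dots,a_i,g(a_{i+1},\dots,a_{i+q}),\dots)$) and the differential $d=[m,-]$. Let $\mathrm{MC}^2(\mathfrak g)$ be its Deligne 2-groupoid. Objects are the $\gamma\in\mathfrak g^1$ with $d\gamma+\frac12[\gamma,\gamma]=0$. 1-morphisms $\gamma_1\to\gamma_2$ are the elements $\exp x$ of the unipotent group $\exp\mathfrak g^0$ with $\gamma_2=\gamma_1-\sum_{i\ge0}\frac{(\mathrm{ad}\,x)^i}{(i+1)!}(dx+[\gamma_1,x])$, composed in $\exp\mathfrak g^0$. 2-morphisms $\exp x\Rightarrow\exp y$ between 1-morphisms $\gamma_1\to\gamma_2$ are the elements $\exp_{\gamma_2}t$ of the unipotent group of the Lie algebra $\mathfrak g^{-1}$ with bracket $[s,t]_{\gamma_2}=[s,dt+[\gamma_2,t]]$ such that $\exp(dt+[\gamma_2,t])\exp x=\exp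 y$; vertical composition is the product of that group (the first 2-morphism on the right), and horizontal composition is $\exp_{\gamma_3}t_{23}\otimes\exp_{\gamma_2}t_{12}=\exp_{\gamma_3}t_{23}\cdot\exp_{\gamma_3}(e^{\mathrm{ad}\,x_{23}}t_{12})$, where $\exp x_{23}$ is the source of $\exp_{\gamma_3}t_{23}$. Then $\mathrm{Def}(A)(R)$ and $\mathrm{MC}^2(\mathfrak g)$ are (strict) 2-groupoids, and the assignment $m'\mapsto\mu(m'):=m'-m$ extends to an isomorphism of 2-groupoids $\mathrm{Def}(A)(R)\to\mathrm{MC}^2(\mathfrak g)$. On 1-morphisms it sends $\varphi$ to $\exp x$, where the $R$-linear extension of $\varphi$ is the exponential of the $R$-linear extension of $x$; a 2-morphism $b$ between 1-morphisms to $m_2$ is sent to $\exp_{\mu(m_2)}t$, where $b$ is the exponential of $-t$ with respect to the product $m_2$. -/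

import Mathlib

universe u v

open CategoryTheory TopologicalSpace Opposite
open scoped TensorProduct

namespace StarDef

noncomputable section

/-! ### Sheaves of `k`-modules and multilinear operations between them -/

section Sheaves

variable {k : Type u} [Field k] {X : TopCat.{u}}

/-- The category `Sh_k(X)` of sheaves of `k`-vector spaces on `X`. -/
abbrev Sh (k : Type u) [Field k] (X : TopCat.{u}) := TopCat.Sheaf (ModuleCat.{u} k) X

/-- The `k`-vector space `Γ(V; L)` of sections over `V`. -/
abbrev sec (L : Sh k X) (V : Opens X) : Type u := L.presheaf.obj (op V)

/-- Restriction of sections. -/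
def res (L : Sh k X) {V W : Opens X} (h : W ≤ V) : sec L V →ₗ[k] sec L W :=
  (L.presheaf.map (homOfLE h).op).hom

/-- The map on sections over `V` induced by a morphism of sheaves. -/
def onSec {L M : Sh k X} (φ : L ⟶ M) (V : Opens X) : sec L V →ₗ[k] sec M V :=
  (φ.hom.app (op V)).hom

theorem res_onSec {L M : Sh k X} (φ : L ⟶ M) {V W : Opens X} (h : W ≤ V) (x : sec L V) :
    res M h (onSec φ V x) = onSec φ W (res L h x) := by
  have := φ.hom.naturality (homOfLE h).op
  exact (congrArg (fun t => t.hom x) this).symm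

/-- `Γ(U; P_I({L_i}, M))` for the pseudo-tensor structure of `Sh_k(X)`: the morphisms of sheaves
`⊗_{i ∈ I} L_i|_U → M|_U`, that is, the families of `k`-multilinear maps
`∏ L_i(V) → M(V)`, `V ⊆ U` open, which commute with restrictions. -/
def multiOp {I : Type} (L : I → Sh k X) (M : Sh k X) (U : Opens X) :
    Submodule k (∀ V : {V : Opens X // V ≤ U},
      MultilinearMap k (fun i => sec (L i) V.1) (sec M V.1)) where
  carrier := {f | ∀ (V W : {V : Opens X // V ≤ U}) (h : W.1 ≤ V.1) (a : ∀ i, sec (L i) V.1),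
    res M h (f V a) = f W (fun i => res (L i) h (a i))}
  zero_mem' := by intro V W h a; simp
  add_mem' := by
    intro f g hf hg V W h a
    simp [hf V W h a, hg V W h a]
  smul_mem' := by
    intro c f hf V W h a
    simp [hf V W h a]

/-- Operations over `U`; see `multiOp`. -/
abbrev MultiOp {I : Type} (L : I → Sh k X) (M : Sh k X) (U : Opens X) : Type u :=
  ↥(multiOp L M U)

instance {I : Type} (L : I → Sh k X) (M : Sh k X) (U : Opens X) : AddCommGroup (MultiOp L M U) :=
  (multiOp L M U).addCommGroup

instance {I : Type} (L : I → Sh k X) (M : Sh k X) (U : Opens X) : Module k (MultiOp L M U) :=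
  (multiOp L M U).module

namespace MultiOp

variable {I J : Type} {L : I → Sh k X} {M N : Sh k X} {U : Opens X}

/-- Restriction of operations to a smaller open set. -/
def restrict {U' : Opens X} (h : U' ≤ U) (f : MultiOp L M U) : MultiOp L M U' :=
  ⟨fun V => f.1 ⟨V.1, V.2.trans h⟩, fun V W hVW a => f.2 ⟨V.1, _⟩ ⟨W.1, _⟩ hVW a⟩

/-- Composition of an operation with a morphism of sheaves. -/
def postcomp (φ : M ⟶ N) : MultiOp L M U →ₗ[k] MultiOp L N U where
  toFun f := ⟨fun V => (onSec φ V.1).compMultilinearMap (f.1 V), fun V W h a => by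
    simp [res_onSec, f.2 V W h a]⟩
  map_add' f g := by
    ext V a
    simp
  map_smul' c f := by
    ext V a
    simp

/-- A morphism of sheaves as an operation indexed by a one-element set. -/
def unary (I : Type) [Unique I] (φ : M ⟶ N) (U : Opens X) : MultiOp (fun _ : I => M) N U :=
  ⟨fun V => MultilinearMap.ofSubsingleton k _ _ default (onSec φ V.1), fun V W h a => by
    simp [res_onSec]⟩

theorem update_fiber {I J : Type} (π : J → I) {S : J → Type u} {T : I → Type u} [DecidableEq I]
    [DecidableEq J] (g : ∀ i, (∀ j : {j // π j = i}, S j.1) → T i) (a : ∀ j, S j) (j : J)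
    (z : S j) :
    (fun i => g i (fun l => Function.update a j z l.1)) =
      Function.update (fun i => g i (fun l => a l.1)) (π j)
        (g (π j) (Function.update (fun l => a l.1) ⟨j, rfl⟩ z)) := by
  funext i
  by_cases hi : i = π j
  · subst hi
    simp only [Function.update_self]
    congr 1
    funext l
    by_cases hl : l = ⟨j, rfl⟩
    · subst hl; simp
    · rw [Function.update_of_ne hl, Function.update_of_ne]
      exact fun h => hl (Subtype.ext h)
  · rw [Function.update_of_ne hi]
    congr 1
    funext l
    rw [Function.update_of_ne]
    rintro rfl
    exact hi l.2.symm

/-- Composition of operations along a map of finite sets `π : J → I`: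
`(f ∘ (g_i))((a_j)_{j ∈ J}) = f((g_i((a_j)_{π j = i}))_{i ∈ I})`. -/
def comp (π : J → I) {K : J → Sh k X} (f : MultiOp L M U)
    (g : ∀ i, MultiOp (fun j : {j // π j = i} => K j.1) (L i) U) : MultiOp K M U :=
  ⟨fun V =>
    { toFun := fun a => f.1 V (fun i => (g i).1 V (fun j => a j.1))
      map_update_add' := by
        classical
        intro _ a j x y
        have key := fun z => update_fiber π (fun i => ((g i).1 V : _ → sec (L i) V.1)) a j z
        simp only [key, MultilinearMap.map_update_add]
      map_update_smul' := by
        classical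
        intro _ a j c x
        have key := fun z => update_fiber π (fun i => ((g i).1 V : _ → sec (L i) V.1)) a j z
        simp only [key, MultilinearMap.map_update_smul] },
   fun V W h a => by
    show res M h (f.1 V _) = f.1 W _
    rw [f.2 V W h]
    congr 1
    funext i
    exact (g i).2 V W h _⟩

end MultiOp

/-! ### The sheaf `L ⊗_k V` for a finite-dimensional vector space `V` -/

/-- The functor `M ↦ V ⊗_k M`. -/
def tensorFunctor (k : Type u) [Field k] (V : Type u) [AddCommGroup V] [Module k V] :
    ModuleCat.{u} k ⥤ ModuleCat.{u} k where
  obj M := ModuleCat.of k (V ⊗[k] M)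
  map f := ModuleCat.ofHom (LinearMap.lTensor V f.hom)
  map_id M := by ext : 1; exact LinearMap.lTensor_id _ _
  map_comp f g := by ext : 1; exact LinearMap.lTensor_comp _ _ _

/-- For finite-dimensional `V` the functor `V ⊗ -` is isomorphic to `Hom(V^*, -)`. -/
def tensorFunctorIso (k : Type u) [Field k] (V : Type u) [AddCommGroup V] [Module k V]
    [Module.Finite k V] : tensorFunctor k V ≅
      (linearCoyoneda k (ModuleCat.{u} k)).obj (op (ModuleCat.of k (Module.Dual k V))) :=
  NatIso.ofComponents (fun M => LinearEquiv.toModuleIso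
      ((TensorProduct.congr (Module.evalEquiv k V) (LinearEquiv.refl k M)).trans
        ((dualTensorHomEquiv k (Module.Dual k V) M).trans
          (ModuleCat.homLinearEquiv (S := k)
            (M := ModuleCat.of k (Module.Dual k V)) (N := M)).symm)))
    (by
      intro M N f
      ext : 1
      apply TensorProduct.ext'
      intro x y
      apply ModuleCat.hom_ext
      apply LinearMap.ext
      intro l
      exact (f.hom.map_smul (l x) y).symm)

instance (k : Type u) [Field k] (V : Type u) [AddCommGroup V] [Module k V]
    [Module.Finite k V] : Limits.PreservesLimits (tensorFunctor k V) :=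
  haveI : Functor.IsRightAdjoint
      ((linearCoyoneda k (ModuleCat.{u} k)).obj (op (ModuleCat.of k (Module.Dual k V)))) :=
    (ihom.adjunction (ModuleCat.of k (Module.Dual k V))).isRightAdjoint
  Limits.preservesLimits_of_natIso (tensorFunctorIso k V).symm

/-- The sheaf `L ⊗_k V`, with sections `Γ(U; L ⊗_k V) = V ⊗_k Γ(U; L)`. The factor `V` is
written on the left, so that for `V = R` an algebra these are visibly `R`-modules. -/
def tensorSheaf (V : Type u) [AddCommGroup V] [Module k V] [Module.Finite k V] (L : Sh k X) :
    Sh k X :=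
  ⟨L.presheaf ⋙ tensorFunctor k V,
    GrothendieckTopology.HasSheafCompose.isSheaf L.presheaf L.property⟩

/-- `f ⊗ Id : V ⊗ L → W ⊗ L` for a linear map `f : V → W`. -/
def tensorSheafMap {V W : Type u} [AddCommGroup V] [Module k V] [Module.Finite k V]
    [AddCommGroup W] [Module k W] [Module.Finite k W] (f : V →ₗ[k] W) (L : Sh k X) :
    tensorSheaf V L ⟶ tensorSheaf W L :=
  ⟨{ app := fun U => ModuleCat.ofHom (LinearMap.rTensor (L.presheaf.obj U) f)
     naturality := fun U U' g => by
      ext : 1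
      apply TensorProduct.ext'
      intro x y
      rfl }⟩

/-- `L → V ⊗ L`, `x ↦ v ⊗ x`, for `v ∈ V`. -/
def tensorSheafMk {V : Type u} [AddCommGroup V] [Module k V] [Module.Finite k V] (v : V)
    (L : Sh k X) : L ⟶ tensorSheaf V L :=
  ⟨{ app := fun U => ModuleCat.ofHom (TensorProduct.mk k V (L.presheaf.obj U) v)
     naturality := fun U U' g => by
      ext x
      rfl }⟩

/-- The canonical map `k ⊗ L → L`. -/
def tensorSheafUnit (L : Sh k X) : tensorSheaf k L ⟶ L :=
  ⟨{ app := fun U => ModuleCat.ofHom (TensorProduct.lid k (L.presheaf.obj U)).toLinearMap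
     naturality := fun U U' g => by
      ext : 1
      apply TensorProduct.ext'
      intro x y
      simp [tensorSheaf, tensorFunctor] }⟩

end Sheaves

/-! ### Pseudo-tensor categories of sheaves -/

/-- A (not necessarily full) pseudo-tensor `Sh_k(X)`-subcategory `Ψ` of `Sh_k(X)` which is closed
under tensoring with finite-dimensional vector spaces. Objects are sheaves, possibly with extra
structure (for instance `O_X`-modules), and the `I`-operations of `Ψ` form a subsheaf of the sheaf
of all multilinear operations between the underlying sheaves, for every finite set `I`. -/
structure PseudoTensorCat (k : Type u) [Field k] (X : TopCat.{u}) where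
  /-- the objects of `Ψ` -/
  Obj : Type v
  /-- the underlying sheaf of an object -/
  sh : Obj → Sh k X
  /-- `Γ(U; P_I({L_i}, M))` -/
  ops : ∀ {I : Type} [Finite I] (L : I → Obj) (M : Obj) (U : Opens X),
    Submodule k (MultiOp (fun i => sh (L i)) (sh M) U)
  /-- operations restrict to smaller open sets -/
  restrict_mem : ∀ {I : Type} [Finite I] (L : I → Obj) (M : Obj) {U V : Opens X} (h : V ≤ U),
    ∀ f ∈ ops L M U, f.restrict h ∈ ops L M V
  /-- being an operation of `Ψ` is a local property -/
  local_mem : ∀ {I : Type} [Finite I] (L : I → Obj) (M : Obj) (U : Opens X)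
    (f : MultiOp (fun i => sh (L i)) (sh M) U),
    (∀ x ∈ U, ∃ (V : Opens X) (h : V ≤ U), x ∈ V ∧ f.restrict h ∈ ops L M V) → f ∈ ops L M U
  /-- identities -/
  id_mem : ∀ {I : Type} [Unique I] (L : Obj) (U : Opens X),
    MultiOp.unary I (𝟙 (sh L)) U ∈ ops (fun _ : I => L) L U
  /-- composition -/
  comp_mem : ∀ {I J : Type} [Finite I] [Finite J] (π : J → I) (K : J → Obj) (L : I → Obj) (M : Obj)
    (U : Opens X) (f : MultiOp (fun i => sh (L i)) (sh M) U)
    (g : ∀ i, MultiOp (fun j : {j // π j = i} => sh (K j.1)) (sh (L i)) U),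
    f ∈ ops L M U → (∀ i, g i ∈ ops (fun j : {j // π j = i} => K j.1) (L i) U) →
    MultiOp.comp π (K := fun j => sh (K j)) f g ∈ ops K M U
  /-- `P_∅(L) = L`: every section of `L` is a nullary operation. (This is what makes sections,
  as Hochschild cochains of degree zero, composable with the other cochains.) -/
  nullary_mem : ∀ {I : Type} [Finite I] [IsEmpty I] (L : I → Obj) (M : Obj) (U : Opens X)
    (f : MultiOp (fun i => sh (L i)) (sh M) U), f ∈ ops L M U
  /-- for a finite-dimensional vector space `V` the sheaf `L ⊗_k V` is in `Ψ` -/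
  tens : Obj → ∀ (V : Type u) [AddCommGroup V] [Module k V] [Module.Finite k V], Obj
  /-- the underlying sheaf of `tens L V` is `L ⊗_k V` -/
  tensIso : ∀ (L : Obj) (V : Type u) [AddCommGroup V] [Module k V] [Module.Finite k V],
    sh (tens L V) ≅ tensorSheaf V (sh L)
  /-- `Id ⊗ f` is an operation of `Ψ` for every linear map `f : V → W` -/
  tensMap_mem : ∀ (L : Obj) (V W : Type u) [AddCommGroup V] [Module k V] [Module.Finite k V]
    [AddCommGroup W] [Module k W] [Module.Finite k W] (f : V →ₗ[k] W),
    MultiOp.unary (Fin 1) ((tensIso L V).hom ≫ tensorSheafMap f (sh L) ≫ (tensIso L W).inv) ⊤ ∈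
      ops (fun _ : Fin 1 => tens L V) (tens L W) ⊤
  /-- the canonical identification `L = L ⊗_k k` holds in `Ψ` -/
  tensUnit_mem : ∀ L : Obj,
    MultiOp.unary (Fin 1) ((tensIso L k).hom ≫ tensorSheafUnit (sh L)) ⊤ ∈
      ops (fun _ : Fin 1 => tens L k) L ⊤
  tensUnitInv_mem : ∀ L : Obj,
    MultiOp.unary (Fin 1) (tensorSheafMk (1 : k) (sh L) ≫ (tensIso L k).inv) ⊤ ∈
      ops (fun _ : Fin 1 => L) (tens L k) ⊤

namespace PseudoTensorCat

variable {k : Type u} [Field k] {X : TopCat.{u}} (Ψ : PseudoTensorCat.{u, v} k X)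

/-- `Γ(X; P_I({L_i}, M ⊗_k V))`, as a space of operations with values in the sheaf `M ⊗_k V`. -/
def tensorOps {I : Type} [Finite I] (L : I → Ψ.Obj) (M : Ψ.Obj) (V : Type u) [AddCommGroup V]
    [Module k V] [Module.Finite k V] :
    Submodule k (MultiOp (fun i => Ψ.sh (L i)) (tensorSheaf V (Ψ.sh M)) ⊤) :=
  (Ψ.ops L (Ψ.tens M V) ⊤).comap (MultiOp.postcomp (Ψ.tensIso M V).inv)

end PseudoTensorCat

/-- The multilinear map on sections over `V` given by an operation over `X`. -/
def MultiOp.at {k : Type u} [Field k] {X : TopCat.{u}} {I : Type} {L : I → Sh k X} {M : Sh k X}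
    (f : MultiOp L M ⊤) (V : Opens X) : MultilinearMap k (fun i => sec (L i) V) (sec M V) :=
  f.1 ⟨V, le_top⟩

/-- A unital associative algebra in `Ψ`. -/
structure AlgebraIn {k : Type u} [Field k] {X : TopCat.{u}} (Ψ : PseudoTensorCat.{u, v} k X) where
  obj : Ψ.Obj
  /-- the product `m ∈ Γ(X; P_2(A², A))` -/
  mul : Ψ.ops (fun _ : Fin 2 => obj) obj ⊤
  /-- the unit `1 ∈ Γ(X; A)` -/
  one : sec (Ψ.sh obj) ⊤
  mul_assoc : ∀ (V : Opens X) (a b c : sec (Ψ.sh obj) V),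
    mul.1.at V ![mul.1.at V ![a, b], c] = mul.1.at V ![a, mul.1.at V ![b, c]]
  one_mul : ∀ (V : Opens X) (a : sec (Ψ.sh obj) V), mul.1.at V ![res _ le_top one, a] = a
  mul_one : ∀ (V : Opens X) (a : sec (Ψ.sh obj) V), mul.1.at V ![a, res _ le_top one] = a

/-! ### Hochschild cochains and the Gerstenhaber bracket -/

section Insertion

/-- Bookkeeping for the insertion of an operation with `q` arguments into the `i`-th argument
(counted from `0`) of an operation with `p` arguments: the `l`-th argument of the result goes to
the `insIdx l`-th argument of the outer operation. -/
def insIdx {p q n : ℕ} (h : p + q = n + 1) (i : Fin p) (l : Fin n) : Fin p :=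
  if _ : l.1 < i.1 then ⟨l.1, by omega⟩
  else if _ : l.1 < i.1 + q then i else ⟨l.1 + 1 - q, by omega⟩

theorem insIdx_val {p q n : ℕ} (h : p + q = n + 1) (i : Fin p) (l : Fin n) :
    (insIdx h i l).1 = if l.1 < i.1 then l.1 else if l.1 < i.1 + q then i.1 else l.1 + 1 - q := by
  unfold insIdx
  split_ifs <;> rfl

theorem insIdx_eq_iff {p q n : ℕ} (h : p + q = n + 1) (i : Fin p) (l : Fin n) :
    insIdx h i l = i ↔ i.1 ≤ l.1 ∧ l.1 < i.1 + q := by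
  rw [Fin.ext_iff, insIdx_val]
  split_ifs <;> omega

/-- The arguments that go into the inserted operation are the `i`-th to the `(i+q-1)`-st. -/
def insEquiv {p q n : ℕ} (h : p + q = n + 1) (i : Fin p) :
    Fin q ≃ {l : Fin n // insIdx h i l = i} where
  toFun l := ⟨⟨i.1 + l.1, by omega⟩, (insIdx_eq_iff h i _).2 ⟨Nat.le_add_right _ _, by simp⟩⟩
  invFun l := ⟨l.1.1 - i.1, by have := (insIdx_eq_iff h i _).1 l.2; omega⟩
  left_inv l := by ext; simp
  right_inv l := by
    have := (insIdx_eq_iff h i _).1 l.2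
    apply Subtype.ext
    apply Fin.ext
    show i.1 + (l.1.1 - i.1) = l.1.1
    omega

/-- The position in the result of the `j`-th argument of the outer operation, `j ≠ i`. -/
def insPos {p q n : ℕ} (h : p + q = n + 1) (i j : Fin p) (hj : j ≠ i) : Fin n :=
  if hlt : j.1 < i.1 then ⟨j.1, by omega⟩
  else ⟨j.1 + q - 1, by have := Fin.val_ne_of_ne hj; omega⟩

theorem insPos_val {p q n : ℕ} (h : p + q = n + 1) (i j : Fin p) (hj : j ≠ i) :
    (insPos h i j hj).1 = if j.1 < i.1 then j.1 else j.1 + q - 1 := by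
  unfold insPos
  split_ifs <;> rfl

/-- Every other argument of the outer operation receives exactly one argument. -/
@[reducible]
def insUnique {p q n : ℕ} (h : p + q = n + 1) (i j : Fin p) (hj : j ≠ i) :
    Unique {l : Fin n // insIdx h i l = j} where
  default := ⟨insPos h i j hj, by
    have := Fin.val_ne_of_ne hj
    rw [Fin.ext_iff, insIdx_val, insPos_val]
    split_ifs <;> omega⟩
  uniq l := by
    have := Fin.val_ne_of_ne hj
    have hl := l.2
    rw [Fin.ext_iff, insIdx_val] at hl
    apply Subtype.ext
    apply Fin.ext
    show l.1.1 = (insPos h i j hj).1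
    rw [insPos_val]
    split_ifs at hl ⊢ <;> omega

end Insertion

namespace AlgebraIn

variable {k : Type u} [Field k] {X : TopCat.{u}} {Ψ : PseudoTensorCat.{u, v} k X}
variable (A : AlgebraIn Ψ)

/-- The underlying sheaf. -/
abbrev sheaf : Sh k X := Ψ.sh A.obj

/-- `Γ(X; C^n(A)) = Γ(X; P_n(A^n, A))`. For `n = 0` this is the space of nullary operations,
that is, of global sections of `A`. -/
abbrev Cochain (n : ℕ) : Type u := ↥(Ψ.ops (fun _ : Fin n => A.obj) A.obj ⊤)

instance (n : ℕ) : AddCommGroup (A.Cochain n) :=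
  (Ψ.ops (fun _ : Fin n => A.obj) A.obj ⊤).addCommGroup

instance (n : ℕ) : Module k (A.Cochain n) :=
  (Ψ.ops (fun _ : Fin n => A.obj) A.obj ⊤).module

variable {A}

/-- Renaming the arguments of an operation along a bijection. -/
def relabel {I J : Type} (e : I ≃ J) (g : MultiOp (fun _ : I => A.sheaf) A.sheaf ⊤) :
    MultiOp (fun _ : J => A.sheaf) A.sheaf ⊤ :=
  ⟨fun V => (g.1 V).domDomCongr e, fun V W h a => g.2 V W h (fun i => a (e i))⟩

theorem relabel_mem {I J : Type} [Finite I] [Finite J] (e : I ≃ J)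
    (g : MultiOp (fun _ : I => A.sheaf) A.sheaf ⊤)
    (hg : g ∈ Ψ.ops (fun _ : I => A.obj) A.obj ⊤) :
    relabel e g ∈ Ψ.ops (fun _ : J => A.obj) A.obj ⊤ := by
  let un : ∀ i, Unique {j : J // e.symm j = i} := fun i =>
    { default := ⟨e i, by simp⟩
      uniq := fun l => Subtype.ext (e.symm_apply_eq.1 l.2) }
  exact Ψ.comp_mem e.symm (fun _ => A.obj) (fun _ => A.obj) A.obj ⊤ g
    (fun i => letI := un i; MultiOp.unary _ (𝟙 A.sheaf) ⊤) hg
    (fun i => letI := un i; Ψ.id_mem A.obj ⊤)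

/-- The operations to be inserted into the arguments of an operation with `p` arguments: `g` into
the `i`-th one, the identity into all others. -/
def insFamily {p q n : ℕ} (h : p + q = n + 1) (i : Fin p) (g : A.Cochain q) (j : Fin p) :
    MultiOp (fun _ : {l : Fin n // insIdx h i l = j} => A.sheaf) A.sheaf ⊤ :=
  if hj : j = i then
    relabel ((insEquiv h i).trans (Equiv.subtypeEquivRight (fun l => by rw [hj]))) g.1
  else
    letI := insUnique h i j hj
    MultiOp.unary _ (𝟙 A.sheaf) ⊤

/-- The insertion `f ∘_i g`:
`(f ∘_i g)(a_0, …, a_{n-1}) = f(a_0, …, a_{i-1}, g(a_i, …, a_{i+q-1}), a_{i+q}, …, a_{n-1})`. -/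
def insert {p q n : ℕ} (h : p + q = n + 1) (i : Fin p) (f : A.Cochain p) (g : A.Cochain q) :
    A.Cochain n :=
  ⟨MultiOp.comp (insIdx h i) f.1 (insFamily h i g),
    Ψ.comp_mem (insIdx h i) (fun _ => A.obj) (fun _ => A.obj) A.obj ⊤ f.1 (insFamily h i g) f.2
      (fun j => by
        unfold insFamily
        split_ifs with hj
        · exact relabel_mem _ _ g.2
        · let _ := insUnique h i j hj
          exact Ψ.id_mem A.obj ⊤)⟩

theorem insert_apply {p q n : ℕ} (h : p + q = n + 1) (i : Fin p) (f : A.Cochain p)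
    (g : A.Cochain q) (V : Opens X) (a : Fin n → sec A.sheaf V) :
    (insert h i f g).1.at V a = f.1.at V (fun j =>
      if hlt : j.1 < i.1 then a ⟨j.1, by omega⟩
      else if heq : j = i then g.1.at V (fun l => a ⟨i.1 + l.1, by omega⟩)
      else a ⟨j.1 + q - 1, by have := Fin.val_ne_of_ne heq; omega⟩) := by
  show f.1.1 ⟨V, le_top⟩ _ = f.1.1 ⟨V, le_top⟩ _
  congr 1
  funext j
  unfold insFamily
  by_cases hj : j = i
  · subst hj
    simp only [dif_pos, lt_irrefl, dif_neg, not_false_eq_true]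
    rfl
  · rw [dif_neg hj]
    let _ := insUnique h i j hj
    have hu : ((MultiOp.unary {l : Fin n // insIdx h i l = j} (𝟙 A.sheaf) ⊤).1 ⟨V, le_top⟩
        fun l => a l.1) = a (insPos h i j hj) := rfl
    refine hu.trans ?_
    unfold insPos
    split_ifs <;> rfl

theorem Cochain.ext {n : ℕ} {f g : A.Cochain n} (h : ∀ V a, f.1.at V a = g.1.at V a) : f = g := by
  apply Subtype.ext
  apply Subtype.ext
  funext V
  exact MultilinearMap.ext (h V.1)

theorem at_add {n : ℕ} (f g : A.Cochain n) (V : Opens X) (a : Fin n → sec A.sheaf V) :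
    (f + g).1.at V a = f.1.at V a + g.1.at V a := rfl

theorem at_smul {n : ℕ} (c : k) (f : A.Cochain n) (V : Opens X) (a : Fin n → sec A.sheaf V) :
    (c • f).1.at V a = c • f.1.at V a := rfl

theorem insert_apply_update {p q n : ℕ} (h : p + q = n + 1) (i : Fin p) (f : A.Cochain p)
    (g : A.Cochain q) (V : Opens X) (a : Fin n → sec A.sheaf V) :
    (insert h i f g).1.at V a = f.1.at V (Function.update (fun j =>
      if hlt : j.1 < i.1 then a ⟨j.1, by omega⟩
      else if heq : j = i then 0
      else a ⟨j.1 + q - 1, by have := Fin.val_ne_of_ne heq; omega⟩) i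
        (g.1.at V (fun l => a ⟨i.1 + l.1, by omega⟩))) := by
  rw [insert_apply]
  congr 1
  funext j
  by_cases hj : j = i
  · subst hj
    simp
  · rw [Function.update_of_ne hj]
    simp [hj]

/-- The insertion `f ∘_i g` is bilinear in `f` and `g`. -/
def insertₗ {p q n : ℕ} (h : p + q = n + 1) (i : Fin p) :
    A.Cochain p →ₗ[k] A.Cochain q →ₗ[k] A.Cochain n :=
  LinearMap.mk₂ k (insert h i)
    (fun f f' g => Cochain.ext fun V a => by simp only [insert_apply, at_add])
    (fun c f g => Cochain.ext fun V a => by simp only [insert_apply, at_smul])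
    (fun f g g' => Cochain.ext fun V a => by
      simp only [insert_apply_update, at_add, MultilinearMap.map_update_add])
    (fun c f g => Cochain.ext fun V a => by
      simp only [insert_apply_update, at_smul, MultilinearMap.map_update_smul])

/-- The insertion product
`f ∘ g = Σ_i (-1)^{i (q - 1)} f ∘_i g` of cochains with `p` and `q` arguments
(the exponent is written with `q + 1` in place of `q - 1`). -/
def preLie (p q n : ℕ) (h : p + q = n + 1) : A.Cochain p →ₗ[k] A.Cochain q →ₗ[k] A.Cochain n :=
  ∑ i : Fin p, (-1 : k) ^ (i.1 * (q + 1)) • insertₗ (A := A) h i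

/-- The Gerstenhaber bracket `[f, g] = f ∘ g - (-1)^{(p - 1)(q - 1)} g ∘ f`. -/
def gerst (p q n : ℕ) (h : p + q = n + 1) : A.Cochain p →ₗ[k] A.Cochain q →ₗ[k] A.Cochain n :=
  preLie (A := A) p q n h - (-1 : k) ^ ((p + 1) * (q + 1)) • (preLie (A := A) q p n (by omega)).flip

end AlgebraIn

/-! ### Differential graded Lie algebras concentrated in degrees `≥ -1` -/

/-- The graded vector space, differential and bracket of a differential graded Lie algebra `g`
concentrated in degrees `≥ -1`. Here `C n` is the component `g^{n-1}`, so that the bracket maps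
`C p × C q` to `C n` with `p + q = n + 1` (and vanishes on `C 0 × C 0`, for degree reasons). -/
structure DGLAData (k : Type u) [Field k] where
  C : ℕ → Type u
  [acg : ∀ n, AddCommGroup (C n)]
  [mod : ∀ n, Module k (C n)]
  d : ∀ n, C n →ₗ[k] C (n + 1)
  br : ∀ p q n, p + q = n + 1 → C p →ₗ[k] C q →ₗ[k] C n

attribute [instance] DGLAData.acg DGLAData.mod

/-- The multiplication of an ideal. -/
def idealMul (k : Type u) [Field k] {R : Type u} [CommRing R] [Algebra k R] (I : Ideal R) :
    I →ₗ[k] I →ₗ[k] I :=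
  LinearMap.mk₂ k (fun a b => ⟨a.1 * b.1, I.mul_mem_left a.1 b.2⟩)
    (fun _ _ _ => Subtype.ext (add_mul _ _ _))
    (fun _ _ _ => Subtype.ext (smul_mul_assoc _ _ _))
    (fun _ _ _ => Subtype.ext (mul_add _ _ _))
    (fun _ _ _ => Subtype.ext (mul_smul_comm _ _ _))

/-- The DGLA `g ⊗_k I` for an ideal `I` of a commutative algebra: `d(x ⊗ a) = dx ⊗ a` and
`[x ⊗ a, y ⊗ b] = [x, y] ⊗ ab`. -/
def DGLAData.tensor {k : Type u} [Field k] (g : DGLAData k) {R : Type u} [CommRing R] [Algebra k R]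
    (I : Ideal R) : DGLAData k where
  C n := g.C n ⊗[k] I
  d n := LinearMap.rTensor I (g.d n)
  br p q n h := TensorProduct.lift (LinearMap.mk₂ k
    (fun x a => TensorProduct.map (g.br p q n h x) (idealMul k I a))
    (fun x x' a => by simp only [map_add, TensorProduct.map_add_left])
    (fun c x a => by simp only [map_smul, TensorProduct.map_smul_left])
    (fun x a a' => by simp only [map_add, TensorProduct.map_add_right])
    (fun c x a => by simp only [map_smul, TensorProduct.map_smul_right]))

/-- The DGLA `Γ(X; C^•(A)[1])` of Hochschild cochains, with the Gerstenhaber bracket and the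
Hochschild differential `δ = [m, -]`. -/
def AlgebraIn.hochschild {k : Type u} [Field k] {X : TopCat.{u}} {Ψ : PseudoTensorCat.{u, v} k X}
    (A : AlgebraIn Ψ) : DGLAData k where
  C n := A.Cochain n
  d n := AlgebraIn.gerst 2 n (n + 1) (by omega) A.mul
  br p q n h := AlgebraIn.gerst p q n h

/-! ### Exponentials and the Baker–Campbell–Hausdorff product -/

/-- `exp(D) x = Σ_n D^n x / n!` for a locally nilpotent operator `D`. -/
def expNil (k : Type u) [Field k] {E : Type u} [AddCommGroup E] [Module k E] (D : E → E) (x : E) :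
    E :=
  ∑ᶠ n : ℕ, ((n.factorial : k)⁻¹) • D^[n] x

/-- The right-nested iterated bracket `[u₁,[u₂,…,[u_{m-1},u_m]…]]` of a word in the letters
`x` (`true`) and `y` (`false`). -/
def nested {E : Type u} [Zero E] (br : E → E → E) (x y : E) : List Bool → E
  | [] => 0
  | [b] => if b then x else y
  | b :: c :: rest => br (if b then x else y) (nested br x y (c :: rest))

/-- The word `x^{r₁} y^{s₁} ⋯ x^{r_n} y^{s_n}` of a list of pairs `(r_i, s_i)`. -/
def bchWord (l : List (ℕ × ℕ)) : List Bool :=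
  (l.map fun p => List.replicate p.1 true ++ List.replicate p.2 false).flatten

/-- Dynkin's coefficient `(-1)^{n-1} / (n · Σ(r_i + s_i) · Π r_i! s_i!)`. -/
def bchCoeff (k : Type u) [Field k] (l : List (ℕ × ℕ)) : k :=
  (-1 : k) ^ (l.length + 1) *
    ((l.length : k) * ((bchWord l).length : k) *
      ((l.map fun p => ((p.1.factorial * p.2.factorial : ℕ) : k)).prod))⁻¹

open Classical in
/-- The Baker–Campbell–Hausdorff product of a nilpotent Lie algebra `E` with bracket `br`, in
Dynkin's form; it is the product of the unipotent group `exp E`: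
`exp x · exp y = exp (bch x y)`. -/
def bch (k : Type u) [Field k] {E : Type u} [AddCommGroup E] [Module k E] (br : E → E → E)
    (x y : E) : E :=
  ∑ᶠ l : List (ℕ × ℕ),
    if l ≠ [] ∧ ∀ p ∈ l, 0 < p.1 + p.2 then bchCoeff k l • nested br x y (bchWord l) else 0

/-! ### 2-groupoids -/

/-- Objects, 1-morphisms and 2-morphisms, together with the graphs of the identity and composition
operations of a strict 2-category; the laws are in `IsTwoGroupoid`. -/
structure TwoCatData where
  Obj : Type u
  Hom : Obj → Obj → Type u
  Hom2 : ∀ {a b : Obj}, Hom a b → Hom a b → Type u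
  /-- `f` is the identity of `a` -/
  IsId : ∀ {a : Obj}, Hom a a → Prop
  /-- `h = g ∘ f` for `f : a → b`, `g : b → c` -/
  IsComp : ∀ {a b c : Obj}, Hom a b → Hom b c → Hom a c → Prop
  /-- `s` is the identity of `f` -/
  IsId2 : ∀ {a b : Obj} {f : Hom a b}, Hom2 f f → Prop
  /-- `w` is the vertical composition of `s : f ⇒ g` and `t : g ⇒ h` -/
  IsVComp : ∀ {a b : Obj} {f g h : Hom a b}, Hom2 f g → Hom2 g h → Hom2 f h → Prop
  /-- `w : p ⇒ p'` is the horizontal composition of `s : f ⇒ f'` and `t : g ⇒ g'`; this is only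
  considered for `p = g ∘ f` and `p' = g' ∘ f'` -/
  IsHComp : ∀ {a b c : Obj} {f f' : Hom a b} {g g' : Hom b c} {p p' : Hom a c},
    Hom2 f f' → Hom2 g g' → Hom2 p p' → Prop

/-- `G` is a (strict) 2-groupoid: identities and compositions exist and are unique, satisfy the
laws of a strict 2-category, and all 1- and 2-morphisms are invertible. -/
structure TwoCatData.IsTwoGroupoid (G : TwoCatData.{u}) : Prop where
  id_exists : ∀ a : G.Obj, ∃! e : G.Hom a a, G.IsId e
  comp_exists : ∀ {a b c : G.Obj} (f : G.Hom a b) (g : G.Hom b c), ∃! h, G.IsComp f g h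
  id_comp : ∀ {a b : G.Obj} (e : G.Hom a a) (f : G.Hom a b), G.IsId e → G.IsComp e f f
  comp_id : ∀ {a b : G.Obj} (f : G.Hom a b) (e : G.Hom b b), G.IsId e → G.IsComp f e f
  assoc : ∀ {a b c d : G.Obj} (f : G.Hom a b) (g : G.Hom b c) (h : G.Hom c d)
    (fg : G.Hom a c) (gh : G.Hom b d) (p : G.Hom a d),
    G.IsComp f g fg → G.IsComp g h gh → (G.IsComp fg h p ↔ G.IsComp f gh p)
  inv_exists : ∀ {a b : G.Obj} (f : G.Hom a b), ∃ (g : G.Hom b a) (e : G.Hom a a) (e' : G.Hom b b),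
    G.IsId e ∧ G.IsId e' ∧ G.IsComp f g e ∧ G.IsComp g f e'
  id2_exists : ∀ {a b : G.Obj} (f : G.Hom a b), ∃! i : G.Hom2 f f, G.IsId2 i
  vcomp_exists : ∀ {a b : G.Obj} {f g h : G.Hom a b} (s : G.Hom2 f g) (t : G.Hom2 g h),
    ∃! w, G.IsVComp s t w
  id2_vcomp : ∀ {a b : G.Obj} {f g : G.Hom a b} (i : G.Hom2 f f) (s : G.Hom2 f g),
    G.IsId2 i → G.IsVComp i s s
  vcomp_id2 : ∀ {a b : G.Obj} {f g : G.Hom a b} (s : G.Hom2 f g) (i : G.Hom2 g g),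
    G.IsId2 i → G.IsVComp s i s
  vcomp_assoc : ∀ {a b : G.Obj} {f g h j : G.Hom a b} (s : G.Hom2 f g) (t : G.Hom2 g h)
    (r : G.Hom2 h j) (st : G.Hom2 f h) (tr : G.Hom2 g j) (w : G.Hom2 f j),
    G.IsVComp s t st → G.IsVComp t r tr → (G.IsVComp st r w ↔ G.IsVComp s tr w)
  inv2_exists : ∀ {a b : G.Obj} {f g : G.Hom a b} (s : G.Hom2 f g),
    ∃ (t : G.Hom2 g f) (i : G.Hom2 f f) (i' : G.Hom2 g g),
      G.IsId2 i ∧ G.IsId2 i' ∧ G.IsVComp s t i ∧ G.IsVComp t s i'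
  hcomp_exists : ∀ {a b c : G.Obj} {f f' : G.Hom a b} {g g' : G.Hom b c} {p p' : G.Hom a c}
    (s : G.Hom2 f f') (t : G.Hom2 g g'), G.IsComp f g p → G.IsComp f' g' p' →
    ∃! w : G.Hom2 p p', G.IsHComp s t w
  hcomp_id2 : ∀ {a b c : G.Obj} {f : G.Hom a b} {g : G.Hom b c} {p : G.Hom a c}
    (i : G.Hom2 f f) (j : G.Hom2 g g) (w : G.Hom2 p p), G.IsComp f g p →
    G.IsId2 i → G.IsId2 j → G.IsHComp i j w → G.IsId2 w
  id_hcomp : ∀ {a b : G.Obj} {e : G.Hom a a} {f f' : G.Hom a b} (i : G.Hom2 e e)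
    (s : G.Hom2 f f'), G.IsId e → G.IsId2 i → G.IsHComp i s s
  hcomp_id : ∀ {a b : G.Obj} {f f' : G.Hom a b} {e : G.Hom b b} (s : G.Hom2 f f')
    (i : G.Hom2 e e), G.IsId e → G.IsId2 i → G.IsHComp s i s
  hcomp_assoc : ∀ {a b c d : G.Obj} {f f' : G.Hom a b} {g g' : G.Hom b c} {h h' : G.Hom c d}
    {fg fg' : G.Hom a c} {gh gh' : G.Hom b d} {p p' : G.Hom a d}
    (s : G.Hom2 f f') (t : G.Hom2 g g') (r : G.Hom2 h h')
    (st : G.Hom2 fg fg') (tr : G.Hom2 gh gh') (w : G.Hom2 p p'),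
    G.IsComp f g fg → G.IsComp f' g' fg' → G.IsComp g h gh → G.IsComp g' h' gh' →
    G.IsComp fg h p → G.IsComp fg' h' p' → G.IsHComp s t st → G.IsHComp t r tr →
    (G.IsHComp st r w ↔ G.IsHComp s tr w)
  interchange : ∀ {a b c : G.Obj} {f f' f'' : G.Hom a b} {g g' g'' : G.Hom b c}
    {p p' p'' : G.Hom a c} (s : G.Hom2 f f') (s' : G.Hom2 f' f'') (t : G.Hom2 g g')
    (t' : G.Hom2 g' g'') (ss : G.Hom2 f f'') (tt : G.Hom2 g g'')
    (w : G.Hom2 p p') (w' : G.Hom2 p' p'') (x : G.Hom2 p p''),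
    G.IsComp f g p → G.IsComp f' g' p' → G.IsComp f'' g'' p'' →
    G.IsVComp s s' ss → G.IsVComp t t' tt → G.IsHComp s t w → G.IsHComp s' t' w' →
    (G.IsHComp ss tt x ↔ G.IsVComp w w' x)

/-- A (strict) functor of 2-groupoids. -/
structure TwoFunctor (G H : TwoCatData.{u}) where
  obj : G.Obj → H.Obj
  map : ∀ {a b : G.Obj}, G.Hom a b → H.Hom (obj a) (obj b)
  map₂ : ∀ {a b : G.Obj} {f g : G.Hom a b}, G.Hom2 f g → H.Hom2 (map f) (map g)
  map_id : ∀ {a : G.Obj} (e : G.Hom a a), G.IsId e → H.IsId (map e)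
  map_comp : ∀ {a b c : G.Obj} (f : G.Hom a b) (g : G.Hom b c) (h : G.Hom a c),
    G.IsComp f g h → H.IsComp (map f) (map g) (map h)
  map₂_id : ∀ {a b : G.Obj} {f : G.Hom a b} (i : G.Hom2 f f), G.IsId2 i → H.IsId2 (map₂ i)
  map₂_vcomp : ∀ {a b : G.Obj} {f g h : G.Hom a b} (s : G.Hom2 f g) (t : G.Hom2 g h)
    (w : G.Hom2 f h), G.IsVComp s t w → H.IsVComp (map₂ s) (map₂ t) (map₂ w)
  map₂_hcomp : ∀ {a b c : G.Obj} {f f' : G.Hom a b} {g g' : G.Hom b c} {p p' : G.Hom a c}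
    (s : G.Hom2 f f') (t : G.Hom2 g g') (w : G.Hom2 p p'), G.IsComp f g p → G.IsComp f' g' p' →
    G.IsHComp s t w → H.IsHComp (map₂ s) (map₂ t) (map₂ w)

/-- An isomorphism of 2-groupoids is a functor which is bijective on objects, 1-morphisms and
2-morphisms. -/
structure TwoFunctor.IsIso {G H : TwoCatData.{u}} (F : TwoFunctor G H) : Prop where
  obj_bijective : Function.Bijective F.obj
  map_bijective : ∀ a b : G.Obj, Function.Bijective (F.map : G.Hom a b → _)
  map₂_bijective : ∀ {a b : G.Obj} (f g : G.Hom a b), Function.Bijective (F.map₂ : G.Hom2 f g → _)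

/-! ### The Deligne 2-groupoid -/

namespace DGLAData

variable {k : Type u} [Field k] (g : DGLAData k)

/-- The Lie bracket of `g⁰`. -/
def br₀ (x y : g.C 1) : g.C 1 := g.br 1 1 1 rfl x y

/-- The Maurer–Cartan equation `dγ + ½[γ, γ] = 0` for `γ ∈ g¹`. -/
def IsMC (γ : g.C 2) : Prop := g.d 2 γ + (2⁻¹ : k) • g.br 2 2 3 rfl γ γ = 0

/-- The gauge action
`(exp x) · γ = γ - Σ_{i ≥ 0} (ad x)^i / (i+1)! (dx + [γ, x])` of `x ∈ g⁰` on `γ ∈ g¹`. -/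
def gauge (x : g.C 1) (γ : g.C 2) : g.C 2 :=
  γ - ∑ᶠ i : ℕ, (((i + 1).factorial : k)⁻¹) •
    (g.br 1 2 2 rfl x)^[i] (g.d 1 x + g.br 2 1 2 rfl γ x)

/-- The twisted differential `t ↦ dt + [γ, t]` from `g⁻¹` to `g⁰`. -/
def dTwist (γ : g.C 2) (t : g.C 0) : g.C 1 := g.d 0 t + g.br 2 0 1 rfl γ t

/-- The Lie bracket `[s, t]_γ = [s, dt + [γ, t]]` on `g⁻¹`. -/
def brTwist (γ : g.C 2) (s t : g.C 0) : g.C 0 := g.br 0 1 0 rfl s (g.dTwist γ t)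

/-- The Deligne 2-groupoid `MC²(g)` of a nilpotent DGLA `g` concentrated in degrees `≥ -1`.
* Objects are the Maurer–Cartan elements.
* 1-morphisms `γ₁ → γ₂` are the `exp x`, `x ∈ g⁰`, with `(exp x) · γ₁ = γ₂`; they are composed in
  the unipotent group `exp g⁰`.
* 2-morphisms `exp x ⇒ exp y` between 1-morphisms `γ₁ → γ₂` are the `exp_{γ₂} t`, `t ∈ g⁻¹`, with
  `exp(dt + [γ₂, t]) exp x = exp y`. They are composed vertically in the unipotent group
  `exp_{γ₂} g⁻¹` of the Lie algebra `(g⁻¹, [ , ]_{γ₂})`, and horizontally by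
  `exp_{γ₃} t₂₃ ⊗ exp_{γ₂} t₁₂ = exp_{γ₃} t₂₃ · exp_{γ₃} (e^{ad x₂₃} t₁₂)`, where `exp x₂₃` is the
  source of `exp_{γ₃} t₂₃`. -/
def MC2 : TwoCatData.{u} where
  Obj := {γ : g.C 2 // g.IsMC γ}
  Hom γ₁ γ₂ := {x : g.C 1 // g.gauge x γ₁.1 = γ₂.1}
  Hom2 := fun {_ γ₂} x y => {t : g.C 0 // bch k g.br₀ (g.dTwist γ₂.1 t) x.1 = y.1}
  IsId x := x.1 = 0
  IsComp x y z := z.1 = bch k g.br₀ y.1 x.1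
  IsId2 t := t.1 = 0
  IsVComp := fun {_ γ₂ _ _ _} s t w => w.1 = bch k (g.brTwist γ₂.1) t.1 s.1
  IsHComp := fun {_ _ γ₃ _ _ x₂₃ _ _ _} t₁₂ t₂₃ w =>
    w.1 = bch k (g.brTwist γ₃.1) t₂₃.1 (expNil k (g.br 1 0 0 rfl x₂₃.1) t₁₂.1)

end DGLAData

/-! ### Star products -/

section Extension

theorem update_one {E : Type u} (a b c : E) : Function.update ![a, b] 1 c = ![a, c] := by
  funext i
  fin_cases i <;> rfl

theorem update_zero {E : Type u} (a b c : E) : Function.update ![a, b] 0 c = ![c, b] := by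
  funext i
  fin_cases i <;> rfl

variable {k : Type u} [Field k] (R : Type u) [CommRing R] [Algebra k R]
variable {E : Type u} [AddCommGroup E] [Module k E]

/-- The `R`-linear extension `R ⊗ E → R ⊗ E` of a linear map `E → R ⊗ E`. -/
def extLin (f : MultilinearMap k (fun _ : Fin 1 => E) (R ⊗[k] E)) : R ⊗[k] E →ₗ[R] R ⊗[k] E :=
  ((MultilinearMap.ofSubsingleton k E (R ⊗[k] E) (0 : Fin 1)).symm f).liftBaseChange R

/-- A multilinear map in two arguments as a bilinear map. -/
def toBilin {F : Type u} [AddCommGroup F] [Module k F]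
    (f : MultilinearMap k (fun _ : Fin 2 => E) F) : E →ₗ[k] E →ₗ[k] F :=
  LinearMap.mk₂ k (fun a b => f ![a, b])
    (fun a a' b => by
      have h := f.map_update_add ![a, b] 0 a a'
      simp only [update_zero] at h
      exact h)
    (fun c a b => by
      have h := f.map_update_smul ![a, b] 0 c a
      simp only [update_zero] at h
      exact h)
    (fun a b b' => by
      have h := f.map_update_add ![a, b] 1 b b'
      simp only [update_one] at h
      exact h)
    (fun c a b => by
      have h := f.map_update_smul ![a, b] 1 c b
      simp only [update_one] at h
      exact h)

/-- The `R`-bilinear extension to `R ⊗ E` of a bilinear map `E × E → R ⊗ E`. -/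
def extBilin (f : MultilinearMap k (fun _ : Fin 2 => E) (R ⊗[k] E)) :
    R ⊗[k] E →ₗ[R] R ⊗[k] E →ₗ[R] R ⊗[k] E :=
  LinearMap.liftBaseChange R
    (((LinearMap.liftBaseChangeEquiv (R := k) (M := E) (N := R ⊗[k] E) R).toLinearMap.restrictScalars k)
      ∘ₗ toBilin f)

variable (k E) in
/-- Reduction modulo the maximal ideal, `R ⊗ E → (R/m_R) ⊗ E`. -/
def reduce [IsLocalRing R] : R ⊗[k] E →ₗ[k] (R ⧸ IsLocalRing.maximalIdeal R) ⊗[k] E :=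
  LinearMap.rTensor E (Ideal.Quotient.mkₐ k (IsLocalRing.maximalIdeal R)).toLinearMap

end Extension

section Star

variable {k : Type u} [Field k] {X : TopCat.{u}} {Ψ : PseudoTensorCat.{u, v} k X}
variable (A : AlgebraIn Ψ) (R : Type u) [CommRing R] [Algebra k R] [IsLocalRing R]
  [Module.Finite k R]

/-- An operation on `A` with values in `A ⊗_k R`, evaluated on sections over `V`. -/
def evalR {n : ℕ} (f : MultiOp (fun _ : Fin n => A.sheaf) (tensorSheaf R A.sheaf) ⊤)
    (V : Opens X) : MultilinearMap k (fun _ : Fin n => sec A.sheaf V) (R ⊗[k] sec A.sheaf V) :=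
  f.at V

/-- An `R`-star product on `A`. -/
@[ext]
structure StarProduct where
  /-- the operation `m' ∈ Γ(X; P_2(A², A ⊗_k R))` -/
  op : MultiOp (fun _ : Fin 2 => A.sheaf) (tensorSheaf R A.sheaf) ⊤
  mem : op ∈ Ψ.tensorOps (fun _ : Fin 2 => A.obj) A.obj R
  /-- the reduction of `m'` modulo `m_R` is the product `m` of `A` -/
  reduces : ∀ (V : Opens X) (a b : sec A.sheaf V),
    reduce k R _ (evalR A R op V ![a, b]) = 1 ⊗ₜ A.mul.1.at V ![a, b]
  /-- the `R`-bilinear extension of `m'` is associative -/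
  assoc : ∀ (V : Opens X) (x y z : R ⊗[k] sec A.sheaf V),
    extBilin R (evalR A R op V) (extBilin R (evalR A R op V) x y) z =
      extBilin R (evalR A R op V) x (extBilin R (evalR A R op V) y z)

variable {A R}

/-- The `R`-bilinear product on `Γ(V; A ⊗_k R)` given by a star product. -/
def StarProduct.prod (m : StarProduct A R) (V : Opens X) :
    R ⊗[k] sec A.sheaf V →ₗ[R] R ⊗[k] sec A.sheaf V →ₗ[R] R ⊗[k] sec A.sheaf V :=
  extBilin R (evalR A R m.op V)

/-- A 1-morphism of star products. -/
@[ext]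
structure StarHom (m₁ m₂ : StarProduct A R) where
  /-- the operation `φ ∈ Γ(X; P_1(A, A ⊗_k R))` -/
  op : MultiOp (fun _ : Fin 1 => A.sheaf) (tensorSheaf R A.sheaf) ⊤
  mem : op ∈ Ψ.tensorOps (fun _ : Fin 1 => A.obj) A.obj R
  /-- the reduction of `φ` modulo `m_R` is the identity -/
  reduces : ∀ (V : Opens X) (a : sec A.sheaf V), reduce k R _ (evalR A R op V ![a]) = 1 ⊗ₜ a
  /-- the `R`-linear extension of `φ` is a morphism of algebras -/
  map_mul : ∀ (V : Opens X) (x y : R ⊗[k] sec A.sheaf V),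
    extLin R (evalR A R op V) (m₁.prod V x y) =
      m₂.prod V (extLin R (evalR A R op V) x) (extLin R (evalR A R op V) y)

/-- The `R`-linear map on `Γ(V; A ⊗_k R)` given by a 1-morphism. -/
def StarHom.lin {m₁ m₂ : StarProduct A R} (φ : StarHom m₁ m₂) (V : Opens X) :
    R ⊗[k] sec A.sheaf V →ₗ[R] R ⊗[k] sec A.sheaf V :=
  extLin R (evalR A R φ.op V)

/-- A 2-morphism `φ ⇒ ψ`: an element `b ∈ 1 ⊗ 1 + Γ(X; A ⊗_k m_R)` with
`m₂(φ(a), b) = m₂(b, ψ(a))` for all local sections `a` of `A ⊗_k R`. -/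
@[ext]
structure StarHom2 {m₁ m₂ : StarProduct A R} (φ ψ : StarHom m₁ m₂) where
  elt : R ⊗[k] sec A.sheaf ⊤
  mem : elt - 1 ⊗ₜ A.one ∈ LinearMap.range (LinearMap.rTensor (sec A.sheaf ⊤)
    ((IsLocalRing.maximalIdeal R).subtype.restrictScalars k))
  comm : ∀ (V : Opens X) (x : R ⊗[k] sec A.sheaf V),
    m₂.prod V (φ.lin V x) (LinearMap.lTensor R (res A.sheaf le_top) elt) =
      m₂.prod V (LinearMap.lTensor R (res A.sheaf le_top) elt) (ψ.lin V x)

variable (A R)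

/-- The 2-groupoid `Def(A)(R)` of `R`-star products on `A`. The composition of 1-morphisms is the
composition of their `R`-linear extensions, the identity of a 1-morphism to `m₂` is the unit of
`m₂`, the vertical composition of `b : φ ⇒ ψ` and `b' : ψ ⇒ χ` is `m₂(b, b')`, and the horizontal
composition of `b : φ ⇒ φ'` (between 1-morphisms to `m₂`) and `b' : ψ ⇒ ψ'` (between 1-morphisms
from `m₂` to `m₃`) is `m₃(ψ(b), b')`. -/
def Def : TwoCatData.{u} where
  Obj := StarProduct A R
  Hom m₁ m₂ := StarHom m₁ m₂
  Hom2 φ ψ := StarHom2 φ ψ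
  IsId φ := ∀ V x, φ.lin V x = x
  IsComp φ ψ χ := ∀ V x, χ.lin V x = ψ.lin V (φ.lin V x)
  IsId2 := fun {_ m₂ _} b => ∀ x, m₂.prod ⊤ b.elt x = x ∧ m₂.prod ⊤ x b.elt = x
  IsVComp := fun {_ m₂ _ _ _} b b' c => c.elt = m₂.prod ⊤ b.elt b'.elt
  IsHComp := fun {_ _ m₃ _ _ ψ _ _ _} b b' c => c.elt = m₃.prod ⊤ (ψ.lin ⊤ b.elt) b'.elt

/-- The DGLA `Γ(X; C^•(A)[1]) ⊗_k m_R`. -/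
abbrev hochschildR : DGLAData k := A.hochschild.tensor (IsLocalRing.maximalIdeal R)

/-- The operation `a ↦ c(a) ⊗ r` in `Γ(X; P_n(A^n, A ⊗_k R))`, for `c ∈ Γ(X; C^n(A))`. -/
def cochainTmul (n : ℕ) : A.Cochain n →ₗ[k] IsLocalRing.maximalIdeal R →ₗ[k]
    MultiOp (fun _ : Fin n => A.sheaf) (tensorSheaf R A.sheaf) ⊤ :=
  LinearMap.mk₂ k (fun c r => MultiOp.postcomp (tensorSheafMk (r : R) A.sheaf) c.1)
    (fun c c' r => map_add (MultiOp.postcomp _) c.1 c'.1)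
    (fun t c r => map_smul (MultiOp.postcomp _) t c.1)
    (fun c r r' => by
      apply Subtype.ext
      funext V
      apply MultilinearMap.ext
      intro a
      exact TensorProduct.add_tmul _ _ _)
    (fun t c r => by
      apply Subtype.ext
      funext V
      apply MultilinearMap.ext
      intro a
      exact TensorProduct.smul_tmul' _ _ _)

/-- The canonical map `Γ(X; C^n(A)) ⊗_k m_R → Γ(X; P_n(A^n, A ⊗_k R))`, which sends `c ⊗ r` to
the operation `a ↦ c(a) ⊗ r`. -/
def toOp (n : ℕ) : (hochschildR A R).C n →ₗ[k]
    MultiOp (fun _ : Fin n => A.sheaf) (tensorSheaf R A.sheaf) ⊤ :=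
  TensorProduct.lift (cochainTmul A R n)

/-- The functor `F` is given on objects by `m' ↦ m' - m`, and on 1- and 2-morphisms by passing to
logarithms: `F(φ) = exp x` where `φ = exp(x)` as an endomorphism of `A ⊗_k R`, and
`F(b) = exp_{μ(m₂)} t` where `b = exp(-t)` with respect to the product `m₂` (so that `φ = Ad(b) ψ`
becomes `exp(dt + [μ(m₂), t]) exp x = exp y`). -/
structure ExtendsMu (F : TwoFunctor (Def A R) (hochschildR A R).MC2) : Prop where
  obj : ∀ m' : StarProduct A R,
    toOp A R 2 (F.obj m').1 = m'.op - MultiOp.postcomp (tensorSheafMk (1 : R) A.sheaf) A.mul.1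
  map : ∀ {m₁ m₂ : StarProduct A R} (φ : StarHom m₁ m₂) (V : Opens X) (x : R ⊗[k] sec A.sheaf V),
    φ.lin V x = expNil k (extLin R (evalR A R (toOp A R 1 (F.map (a := m₁) (b := m₂) φ).1) V)) x
  map₂ : ∀ {m₁ m₂ : StarProduct A R} {φ ψ : StarHom m₁ m₂} (b : StarHom2 φ ψ)
    (x : R ⊗[k] sec A.sheaf ⊤),
    m₂.prod ⊤ b.elt x = expNil k (m₂.prod ⊤ (-(evalR A R (toOp A R 0
      (F.map₂ (a := m₁) (b := m₂) (f := φ) (g := ψ) b).1) ⊤ ![]))) x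

end Star

end

end StarDef

namespace StarDef

noncomputable section

section NilpotentExp

variable (k : Type u) [Field k] {B : Type u} [Ring B] [Algebra k B]

/-- The exponential `Σ aⁿ / n!` of a nilpotent element of a `k`-algebra. -/
def nexp (a : B) : B := ∑ᶠ n : ℕ, ((n.factorial : k)⁻¹) • a ^ n

/-- The logarithm `Σ_{n < N} (-1)ⁿ uⁿ⁺¹ / (n + 1)` of `1 + u`, for `u ^ N = 0`. -/
def nlog (N : ℕ) (u : B) : B :=
  ∑ n ∈ Finset.range N, ((-1 : k) ^ n * ((n + 1 : ℕ) : k)⁻¹) • u ^ (n + 1)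

variable {k}

theorem nexp_eq_sum {a : B} {N : ℕ} (h : a ^ N = 0) :
    nexp k a = ∑ n ∈ Finset.range N, ((n.factorial : k)⁻¹) • a ^ n := by
  refine finsum_eq_sum_of_support_subset _ fun n hn => ?_
  by_contra hc
  simp only [Finset.coe_range, Set.mem_Iio, not_lt] at hc
  exact hn (by simp [pow_eq_zero_of_le hc h])

theorem expNil_eq_sum {E : Type u} [AddCommGroup E] [Module k E] {D : E → E} {x : E} {N : ℕ}
    (h : ∀ n, N ≤ n → D^[n] x = 0) :
    expNil k D x = ∑ n ∈ Finset.range N, ((n.factorial : k)⁻¹) • D^[n] x := by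
  refine finsum_eq_sum_of_support_subset _ fun n hn => ?_
  by_contra hc
  simp only [Finset.coe_range, Set.mem_Iio, not_lt] at hc
  exact hn (by simp [h n hc])

theorem expNil_eq_nexp {E : Type u} [AddCommGroup E] [Module k E] {D : Module.End k E}
    (hD : IsNilpotent D) (x : E) : expNil k D x = nexp k D x := by
  obtain ⟨N, hN⟩ := hD
  rw [nexp_eq_sum hN, expNil_eq_sum (N := N)]
  · simp [LinearMap.sum_apply, Module.End.pow_apply]
  · intro n hn
    rw [← Module.End.pow_apply, pow_eq_zero_of_le hn hN]
    rfl

@[simp]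
theorem nexp_zero : nexp k (0 : B) = 1 := by
  simp [nexp_eq_sum (k := k) (pow_one (0 : B))]

theorem map_nexp {B' : Type u} [Ring B'] [Algebra k B'] (f : B →ₐ[k] B') {a : B}
    (ha : IsNilpotent a) : f (nexp k a) = nexp k (f a) := by
  obtain ⟨N, hN⟩ := ha
  have hN' : f a ^ N = 0 := by rw [← map_pow, hN, map_zero]
  simp [nexp_eq_sum hN, nexp_eq_sum hN']

theorem nexp_sub_one_eq {a : B} {N : ℕ} (h : a ^ (N + 1) = 0) :
    nexp k a = 1 + a * ∑ n ∈ Finset.range N, (((n + 1).factorial : k)⁻¹) • a ^ n := by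
  rw [nexp_eq_sum h, Finset.sum_range_succ', add_comm, Finset.mul_sum]
  simp [pow_succ']

theorem commute_nexp {a b : B} (h : Commute b a) (ha : IsNilpotent a) : Commute b (nexp k a) := by
  obtain ⟨N, hN⟩ := ha
  rw [nexp_eq_sum hN]
  exact Commute.sum_right _ _ _ fun n _ => (h.pow_right n).smul_right _

theorem isNilpotent_nexp_sub_one {a : B} (ha : IsNilpotent a) : IsNilpotent (nexp k a - 1) := by
  obtain ⟨N, hN⟩ := ha
  rw [nexp_sub_one_eq (k := k) (pow_eq_zero_of_le N.le_succ hN), add_sub_cancel_left]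
  refine Commute.isNilpotent_mul_right (Commute.sum_right _ _ _ fun _ _ => ?_) ⟨N, hN⟩
  exact ((Commute.refl a).pow_right _).smul_right _

theorem commute_nlog {a b : B} (h : Commute b a) (N : ℕ) : Commute b (nlog k N a) :=
  Commute.sum_right _ _ _ fun _ _ => (h.pow_right _).smul_right _

theorem isNilpotent_nlog {a : B} (ha : IsNilpotent a) (N : ℕ) : IsNilpotent (nlog k N a) := by
  have : nlog k N a =
      a * ∑ n ∈ Finset.range N, ((-1 : k) ^ n * ((n + 1 : ℕ) : k)⁻¹) • a ^ n := by
    simp [nlog, Finset.mul_sum, pow_succ']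
  rw [this]
  refine Commute.isNilpotent_mul_right (Commute.sum_right _ _ _ fun n _ => ?_) ha
  exact ((Commute.refl a).pow_right n).smul_right _

theorem eq_zero_of_nexp_eq_one {a : B} (ha : IsNilpotent a) (h : nexp k a = 1) : a = 0 := by
  obtain ⟨N, hN⟩ := ha
  have h1 := nexp_sub_one_eq (k := k) (N := N + 1)
    (pow_eq_zero_of_le (show N ≤ N + 1 + 1 by omega) hN)
  rw [h, left_eq_add, Finset.sum_range_succ'] at h1
  have hu : IsUnit ((∑ n ∈ Finset.range N, (((n + 1 + 1).factorial : k)⁻¹) • a ^ (n + 1)) +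
      (((0 + 1).factorial : k)⁻¹) • a ^ 0) := by
    have e : (((0 + 1).factorial : k)⁻¹) • a ^ 0 = 1 := by simp
    rw [e]
    refine IsNilpotent.isUnit_add_one ?_
    have : ∑ n ∈ Finset.range N, (((n + 1 + 1).factorial : k)⁻¹) • a ^ (n + 1) =
        a * ∑ n ∈ Finset.range N, (((n + 1 + 1).factorial : k)⁻¹) • a ^ n := by
      simp [Finset.mul_sum, pow_succ']
    rw [this]
    refine Commute.isNilpotent_mul_right (Commute.sum_right _ _ _ fun n _ => ?_) ⟨N, hN⟩
    exact ((Commute.refl a).pow_right n).smul_right _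
  exact (hu.mul_left_eq_zero).1 h1

open Polynomial in
theorem derivative_pow_of_commute {p : B[X]} (h : Commute p (derivative p)) (n : ℕ) :
    derivative (p ^ (n + 1)) = ((n + 1 : ℕ) : k) • (derivative p * p ^ n) := by
  induction n with
  | zero => simp
  | succ n ih =>
    rw [pow_succ, derivative_mul, ih]
    have e : p ^ (n + 1) * derivative p = derivative p * p ^ (n + 1) := (h.pow_left (n + 1)).eq
    rw [e, smul_mul_assoc, mul_assoc, ← pow_succ]
    push_cast
    module

variable [CharZero k]

theorem nexp_eq_exp [Module ℚ B] {a : B} (ha : IsNilpotent a) :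
    nexp k a = IsNilpotent.exp a := by
  obtain ⟨N, hN⟩ := ha
  rw [nexp_eq_sum hN, IsNilpotent.exp_eq_sum hN]
  refine Finset.sum_congr rfl fun n _ => ?_
  rw [← Rat.cast_smul_eq_qsmul k]
  simp

theorem nexp_add_of_commute {a b : B} (h : Commute a b) (ha : IsNilpotent a)
    (hb : IsNilpotent b) : nexp k (a + b) = nexp k a * nexp k b := by
  let _ : Module ℚ B := Module.compHom B (algebraMap ℚ k)
  rw [nexp_eq_exp ha, nexp_eq_exp hb, nexp_eq_exp (h.isNilpotent_add ha hb),
    IsNilpotent.exp_add_of_commute h ha hb]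

theorem nexp_mul_nexp_neg {a : B} (ha : IsNilpotent a) : nexp k a * nexp k (-a) = 1 := by
  rw [← nexp_add_of_commute (Commute.refl a).neg_right ha ha.neg, add_neg_cancel, nexp_zero]

theorem nexp_neg_mul_nexp {a : B} (ha : IsNilpotent a) : nexp k (-a) * nexp k a = 1 := by
  simpa using nexp_mul_nexp_neg (k := k) ha.neg

open Polynomial in
theorem derivative_nexp {p : B[X]} (h : Commute p (derivative p)) (hp : IsNilpotent p) :
    derivative (nexp k p) = derivative p * nexp k p := by
  obtain ⟨N, hN⟩ := hp
  conv_lhs => rw [nexp_eq_sum (pow_eq_zero_of_le N.le_succ hN), Finset.sum_range_succ', map_add,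
    map_sum]
  rw [nexp_eq_sum hN, Finset.mul_sum]
  simp only [pow_zero, derivative_smul, derivative_one, smul_zero, add_zero]
  refine Finset.sum_congr rfl fun n _ => ?_
  rw [derivative_pow_of_commute (k := k) h, smul_smul, mul_smul_comm]
  congr 1
  have : ((n + 1 : ℕ) : k) ≠ 0 := Nat.cast_ne_zero.2 n.succ_ne_zero
  rw [Nat.factorial_succ, Nat.cast_mul, mul_inv_rev, mul_assoc, inv_mul_cancel₀ this, mul_one]

open Polynomial in
theorem nexp_nlog {u : B} {N : ℕ} (hu : u ^ N = 0) : nexp k (nlog k N u) = 1 + u := by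
  set U : B[X] := C u * X with hU
  have hUpow : ∀ n, U ^ n = C (u ^ n) * X ^ n := fun n => by
    rw [hU, ((commute_X (C u)).symm.mul_pow n), C_pow]
  have hUN : U ^ N = 0 := by rw [hUpow, hu]; simp
  set p := nlog k N U with hp
  have hpn : IsNilpotent p := isNilpotent_nlog ⟨N, hUN⟩ N
  have hCU : Commute (C u) U := by
    rw [hU]
    exact (Commute.refl _).mul_right (commute_X _).symm
  have hdp : derivative p = ∑ n ∈ Finset.range N, (-1 : k) ^ n • (C u * U ^ n) := by
    rw [hp, nlog, map_sum]
    refine Finset.sum_congr rfl fun n _ => ?_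
    have hd : derivative U = C u := by simp [hU]
    have hcd : Commute U (derivative U) := by rw [hd]; exact hCU.symm
    rw [derivative_smul, derivative_pow_of_commute (k := k) hcd, hd, smul_smul, mul_assoc,
      inv_mul_cancel₀ (Nat.cast_ne_zero.2 n.succ_ne_zero), mul_one]
  have hUdp : Commute U (derivative p) := by
    rw [hdp]
    exact Commute.sum_right _ _ _ fun n _ =>
      ((hCU.symm).mul_right ((Commute.refl U).pow_right n)).smul_right _
  have hpp : Commute p (derivative p) := (commute_nlog hUdp.symm N).symm
  have hgeom : derivative p * (1 + U) = C u := by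
    have hg := geom_sum_mul_neg (-U) N
    rw [sub_neg_eq_add, neg_pow U N, hUN, mul_zero, sub_zero] at hg
    rw [hdp]
    have : ∑ n ∈ Finset.range N, (-1 : k) ^ n • (C u * U ^ n) =
        C u * ∑ n ∈ Finset.range N, (-U) ^ n := by
      rw [Finset.mul_sum]
      refine Finset.sum_congr rfl fun n _ => ?_
      rw [neg_pow U n, ← mul_smul_comm]
      rcases Nat.even_or_odd n with h' | h' <;> simp [h'.neg_one_pow]
    rw [this, mul_assoc, hg, mul_one]
  set q := nexp k (-p) * (1 + U) with hq
  have hdq : derivative q = 0 := by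
    have hc : Commute (-p) (derivative (-p)) := by
      rw [derivative_neg]
      exact hpp.neg_left.neg_right
    rw [hq, derivative_mul, derivative_nexp (k := k) hc hpn.neg, derivative_neg]
    have : derivative (1 + U) = C u := by simp [hU]
    rw [this, ← hgeom, ← mul_assoc, neg_mul]
    have hc' : Commute (derivative p) (nexp k (-p)) :=
      commute_nexp hpp.symm.neg_right hpn.neg
    rw [← hc'.eq]
    simp
  have hB : ∀ n : ℕ, n ≠ 0 → ∀ b : B, (n : B) * b = 0 → b = 0 := by
    intro n hn b hb
    have : (n : k) • b = 0 := by rw [Algebra.smul_def, map_natCast]; exact hb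
    exact (smul_eq_zero_iff_right (Nat.cast_ne_zero.2 hn)).1 this
  have hqc : q = C (q.coeff 0) := by
    ext n
    rcases n with _ | n
    · simp
    · rw [coeff_C_succ]
      have h1 := congrArg (fun r => coeff r n) hdq
      simp only [coeff_derivative, coeff_zero] at h1
      apply hB (n + 1) n.succ_ne_zero
      rw [← h1]
      exact_mod_cast (Nat.cast_commute (n + 1) (q.coeff (n + 1))).eq
  have hU0 : constantCoeff U = 0 := by simp [hU]
  have hp0 : p.coeff 0 = 0 := by
    rw [← constantCoeff_apply, hp, nlog, map_sum]
    refine Finset.sum_eq_zero fun n _ => ?_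
    rw [constantCoeff_apply, coeff_smul, ← constantCoeff_apply, map_pow, hU0]
    simp
  have hq0 : q.coeff 0 = 1 := by
    rw [← constantCoeff_apply, hq, map_mul, map_add, hU0, map_one, add_zero, mul_one]
    obtain ⟨K, hK⟩ := hpn.neg
    rw [nexp_eq_sum (pow_eq_zero_of_le K.le_succ hK), Finset.sum_range_succ', map_add, map_sum,
      Finset.sum_eq_zero]
    · simp
    · intro n _
      rw [constantCoeff_apply, coeff_smul, ← constantCoeff_apply, map_pow, map_neg,
        constantCoeff_apply p, hp0]
      simp
  have hexp : nexp k p = 1 + U := by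
    have h1 : nexp k (-p) * (1 + U) = 1 := by rw [← hq, hqc, hq0, C_1]
    calc nexp k p = nexp k p * (nexp k (-p) * (1 + U)) := by rw [h1, mul_one]
      _ = 1 + U := by rw [← mul_assoc, nexp_mul_nexp_neg hpn, one_mul]
  let ev : B[X] →ₐ[k] B :=
    { eval₂RingHom' (RingHom.id B) 1 (fun a => Commute.one_right a) with
      commutes' := fun c => by
        show eval₂ _ _ (algebraMap k B[X] c) = _
        rw [Polynomial.algebraMap_apply, eval₂_C]
        rfl }
  have hevU : ev U = u := by
    show eval₂ _ _ (C u * X) = u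
    rw [eval₂_mul_X, eval₂_C]
    simp
  have := congrArg ev hexp
  rw [map_nexp ev hpn, map_add, map_one, hevU, hp, nlog, map_sum] at this
  simp only [map_smul, map_pow, hevU] at this
  exact this

theorem nlog_nexp {a : B} (ha : IsNilpotent a) {N : ℕ} (hN : (nexp k a - 1) ^ N = 0) :
    nlog k N (nexp k a - 1) = a := by
  set L := nlog k N (nexp k a - 1) with hL
  have hLn : IsNilpotent L := isNilpotent_nlog (isNilpotent_nexp_sub_one ha) N
  have hc : Commute a L := commute_nlog
    ((commute_nexp (Commute.refl a) ha).sub_right (Commute.one_right a)) N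
  have he : nexp k L = nexp k a := by rw [hL, nexp_nlog hN]; abel
  have h1 : nexp k (a + -L) = 1 := by
    rw [nexp_add_of_commute hc.neg_right ha hLn.neg, ← he, nexp_mul_nexp_neg hLn]
  have h2 := eq_zero_of_nexp_eq_one (hc.neg_right.isNilpotent_add ha hLn.neg) h1
  rw [← sub_eq_add_neg, sub_eq_zero] at h2
  exact h2.symm

theorem nexp_injective {a b : B} (ha : IsNilpotent a) (hb : IsNilpotent b)
    (h : nexp k a = nexp k b) : a = b := by
  obtain ⟨N, hN⟩ := isNilpotent_nexp_sub_one (k := k) ha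
  rw [← nlog_nexp ha hN, ← nlog_nexp hb (h ▸ hN), h]

end NilpotentExp

end

end StarDef

namespace StarDef

noncomputable section

section Dynkin

variable {k : Type u} [Field k] {B : Type u} [Ring B] [Algebra k B]

/-- The exponents `(r, s) ≠ (0, 0)` with `r, s < N`. -/
def expPairs (N : ℕ) : Finset (ℕ × ℕ) :=
  (Finset.range N ×ˢ Finset.range N).filter fun p => 0 < p.1 + p.2

/-- Concatenation of an element and a list, as an embedding. -/
def consEmb : (ℕ × ℕ) × List (ℕ × ℕ) ↪ List (ℕ × ℕ) where
  toFun q := q.1 :: q.2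
  inj' := fun _ _ h => Prod.ext (List.cons.inj h).1 (List.cons.inj h).2

/-- The lists of length `n` of elements of `expPairs N`. -/
def expLists (N : ℕ) : ℕ → Finset (List (ℕ × ℕ))
  | 0 => {[]}
  | n + 1 => (expPairs N ×ˢ expLists N n).map consEmb

theorem mem_expLists {N n : ℕ} {l : List (ℕ × ℕ)} :
    l ∈ expLists N n ↔ l.length = n ∧ ∀ p ∈ l, p ∈ expPairs N := by
  induction n generalizing l with
  | zero =>
    rw [expLists, Finset.mem_singleton, List.length_eq_zero_iff]
    constructor
    · rintro rfl
      simp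
    · exact fun h => h.1
  | succ n ih =>
    rw [expLists, Finset.mem_map]
    constructor
    · rintro ⟨⟨p, l'⟩, h, rfl⟩
      rw [Finset.mem_product, ih] at h
      refine ⟨congrArg (· + 1) h.2.1, fun q hq => ?_⟩
      rcases List.mem_cons.1 hq with rfl | hq
      · exact h.1
      · exact h.2.2 q hq
    · rintro ⟨hl, hp⟩
      match l, hl with
      | p :: l', hl =>
        refine ⟨(p, l'), ?_, rfl⟩
        rw [Finset.mem_product, ih]
        exact ⟨hp p (by simp), by simpa using hl, fun q hq => hp q (by simp [hq])⟩

theorem sum_expLists (N n : ℕ) (f : ℕ × ℕ → B) :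
    ∑ l ∈ expLists N n, (l.map f).prod = (∑ p ∈ expPairs N, f p) ^ n := by
  induction n with
  | zero => simp [expLists]
  | succ n ih =>
    rw [expLists, Finset.sum_map, Finset.sum_product, pow_succ', ← ih, Finset.sum_mul_sum]
    rfl

/-- The index set of Dynkin's formula, in a Lie algebra in which brackets of length `N` vanish. -/
def dynkinIndex (N : ℕ) : Finset (List (ℕ × ℕ)) :=
  (Finset.range N).biUnion fun n => expLists N (n + 1)

theorem mem_dynkinIndex {N : ℕ} {l : List (ℕ × ℕ)} :
    l ∈ dynkinIndex N ↔ l ≠ [] ∧ l.length ≤ N ∧ ∀ p ∈ l, p ∈ expPairs N := by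
  simp only [dynkinIndex, Finset.mem_biUnion, Finset.mem_range, mem_expLists]
  rw [← List.length_pos_iff]
  constructor
  · rintro ⟨n, hn, hl, hp⟩
    exact ⟨by omega, by omega, hp⟩
  · rintro ⟨h0, hl, hp⟩
    exact ⟨l.length - 1, by omega, by omega, hp⟩

theorem sum_dynkinIndex (N : ℕ) (f : List (ℕ × ℕ) → B) :
    ∑ l ∈ dynkinIndex N, f l = ∑ n ∈ Finset.range N, ∑ l ∈ expLists N (n + 1), f l := by
  refine Finset.sum_biUnion fun i _ j _ hij => ?_
  rw [Function.onFun, Finset.disjoint_left]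
  intro l hi hj
  have h1 := (mem_expLists.1 hi).1
  have h2 := (mem_expLists.1 hj).1
  omega

theorem length_bchWord (l : List (ℕ × ℕ)) :
    (bchWord l).length = (l.map fun p => p.1 + p.2).sum := by
  induction l with
  | nil => rfl
  | cons p l ih =>
    have : bchWord (p :: l) =
      (List.replicate p.1 true ++ List.replicate p.2 false) ++ bchWord l := rfl
    simp [this, ih, add_assoc]

theorem length_le_length_bchWord {l : List (ℕ × ℕ)} (h : ∀ p ∈ l, 0 < p.1 + p.2) :
    l.length ≤ (bchWord l).length := by
  rw [length_bchWord]
  have := List.length_le_sum_of_one_le (l.map fun p => p.1 + p.2) (by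
    intro i hi
    obtain ⟨p, hp, rfl⟩ := List.mem_map.1 hi
    exact h p hp)
  simpa using this

theorem le_length_bchWord {l : List (ℕ × ℕ)} {p : ℕ × ℕ} (h : p ∈ l) :
    p.1 + p.2 ≤ (bchWord l).length := by
  rw [length_bchWord]
  exact List.single_le_sum (fun _ _ => Nat.zero_le _) _
    (List.mem_map_of_mem (f := fun p : ℕ × ℕ => p.1 + p.2) h)

theorem bchWord_ne_nil {l : List (ℕ × ℕ)} (hl : l ≠ []) (h : ∀ p ∈ l, 0 < p.1 + p.2) :
    bchWord l ≠ [] := by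
  have h1 := length_le_length_bchWord h
  have h2 := List.length_pos_iff.2 hl
  exact List.length_pos_iff.1 (by omega)

/-- The value of a word in the letters `x` (`true`) and `y` (`false`). -/
def wordEval (x y : B) (w : List Bool) : B := (w.map fun b => if b then x else y).prod

theorem wordEval_cons (x y : B) (b : Bool) (w : List Bool) :
    wordEval x y (b :: w) = (if b then x else y) * wordEval x y w := by
  simp [wordEval]

theorem wordEval_bchWord (x y : B) (l : List (ℕ × ℕ)) :
    wordEval x y (bchWord l) = (l.map fun p => x ^ p.1 * y ^ p.2).prod := by
  induction l with
  | nil => rfl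
  | cons p l ih =>
    have : bchWord (p :: l) =
      (List.replicate p.1 true ++ List.replicate p.2 false) ++ bchWord l := rfl
    rw [this, List.map_cons, List.prod_cons, ← ih]
    simp [wordEval, mul_assoc]

variable (k) in
/-- The coefficient `(-1)^{n-1} / (n · Π r_i! s_i!)` of a word in `log (exp x exp y)`. -/
def logCoeff (l : List (ℕ × ℕ)) : k :=
  (-1 : k) ^ (l.length + 1) *
    ((l.length : k) * ((l.map fun p => ((p.1.factorial * p.2.factorial : ℕ) : k)).prod))⁻¹

theorem bchCoeff_eq (l : List (ℕ × ℕ)) :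
    bchCoeff k l = ((bchWord l).length : k)⁻¹ * logCoeff k l := by
  simp only [bchCoeff, logCoeff, mul_inv_rev]
  ring

variable (k) in
/-- The expansion of `log (exp x exp y)` in words. -/
def logSum (N : ℕ) (x y : B) : B :=
  ∑ l ∈ dynkinIndex N, logCoeff k l • wordEval x y (bchWord l)

theorem prod_map_smul {ι : Type} (l : List ι) (c : ι → k) (f : ι → B) :
    (l.map fun p => (c p)⁻¹ • f p).prod = ((l.map c).prod)⁻¹ • (l.map f).prod := by
  induction l with
  | nil => simp
  | cons p l ih => simp [ih, mul_comm, smul_smul]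

theorem nexp_mul_nexp_sub_one {x y : B} {N : ℕ} (hx : x ^ N = 0) (hy : y ^ N = 0) :
    nexp k x * nexp k y - 1 = ∑ p ∈ expPairs N,
      ((p.1.factorial * p.2.factorial : ℕ) : k)⁻¹ • (x ^ p.1 * y ^ p.2) := by
  rw [nexp_eq_sum hx, nexp_eq_sum hy, Finset.sum_mul_sum, ← Finset.sum_product', expPairs,
    Finset.sum_filter]
  rcases Nat.eq_zero_or_pos N with rfl | hN
  · have h1 : (1 : B) = 0 := by simpa using hx
    simp [h1]
  · rw [sub_eq_iff_eq_add, ← Finset.sum_erase_add (a := ((0, 0) : ℕ × ℕ)) _ _ (by simp [hN]),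
      ← Finset.sum_erase_add (a := ((0, 0) : ℕ × ℕ)) (Finset.range N ×ˢ Finset.range N)
        (fun p => if 0 < p.1 + p.2 then _ else _) (by simp [hN])]
    simp only [lt_self_iff_false, if_false, add_zero]
    congr 1
    · refine Finset.sum_congr rfl fun p hp => ?_
      have hp0 : p ≠ (0, 0) := (Finset.mem_erase.1 hp).1
      have : 0 < p.1 + p.2 := by
        by_contra hc
        exact hp0 (Prod.ext (show p.1 = 0 by omega) (show p.2 = 0 by omega))
      rw [if_pos this, smul_mul_smul_comm, Nat.cast_mul, mul_inv]
    · simp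

theorem logSum_eq_nlog {x y : B} {N : ℕ} (hx : x ^ N = 0) (hy : y ^ N = 0) :
    logSum k N x y = nlog k N (nexp k x * nexp k y - 1) := by
  rw [logSum, sum_dynkinIndex, nlog]
  refine Finset.sum_congr rfl fun n _ => ?_
  rw [nexp_mul_nexp_sub_one hx hy, ← sum_expLists, Finset.smul_sum]
  refine Finset.sum_congr rfl fun l hl => ?_
  rw [prod_map_smul, smul_smul, wordEval_bchWord]
  congr 1
  rw [logCoeff, (mem_expLists.1 hl).1, mul_inv]
  ring

theorem Submodule_pow_le_pow_of_zero {S : Submodule k B} {N M : ℕ} (hS : S ^ N = ⊥)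
    (h : N ≤ M) : S ^ M = ⊥ := by
  rw [← Submodule.zero_eq_bot] at hS ⊢
  exact pow_eq_zero_of_le h hS

theorem pow_eq_zero_of_mem {S : Submodule k B} {N : ℕ} (hS : S ^ N = ⊥) {x : B} (hx : x ∈ S) :
    x ^ N = 0 := by
  have := Submodule.pow_mem_pow S hx N
  rwa [hS, Submodule.mem_bot] at this

theorem nexp_mul_nexp_sub_one_pow {S : Submodule k B} {N : ℕ} (hS : S ^ N = ⊥) {x y : B}
    (hx : x ∈ S) (hy : y ∈ S) : (nexp k x * nexp k y - 1) ^ N = 0 := by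
  set T : Submodule k B := ∑ i ∈ Finset.range (2 * N), S ^ i with hT
  have hST : Commute S T := Commute.sum_right _ _ _ fun i _ => (Commute.refl S).pow_right i
  have h0 : (S * T) ^ N = ⊥ := by rw [hST.mul_pow, hS, Submodule.bot_mul]
  refine pow_eq_zero_of_mem h0 ?_
  rw [nexp_mul_nexp_sub_one (pow_eq_zero_of_mem hS hx) (pow_eq_zero_of_mem hS hy)]
  refine Submodule.sum_mem _ fun p hp => Submodule.smul_mem _ _ ?_
  simp only [expPairs, Finset.mem_filter, Finset.mem_product, Finset.mem_range] at hp
  have h1 : x ^ p.1 * y ^ p.2 ∈ S ^ (p.1 + p.2) := by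
    rw [pow_add]
    exact Submodule.mul_mem_mul (Submodule.pow_mem_pow S hx _) (Submodule.pow_mem_pow S hy _)
  obtain ⟨j, hj⟩ : ∃ j, p.1 + p.2 = j + 1 := ⟨p.1 + p.2 - 1, by omega⟩
  rw [hj, pow_succ'] at h1
  refine mul_le_mul_right (a := S) ?_ h1
  exact Finset.single_le_sum_of_canonicallyOrdered (f := fun i => S ^ i)
    (Finset.mem_range.2 (by omega))

theorem nexp_logSum [CharZero k] {S : Submodule k B} {N : ℕ} (hS : S ^ N = ⊥) {x y : B}
    (hx : x ∈ S) (hy : y ∈ S) :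
    IsNilpotent (logSum k N x y) ∧ nexp k (logSum k N x y) = nexp k x * nexp k y := by
  have h := nexp_mul_nexp_sub_one_pow hS hx hy
  rw [logSum_eq_nlog (pow_eq_zero_of_mem hS hx) (pow_eq_zero_of_mem hS hy)]
  exact ⟨isNilpotent_nlog ⟨N, h⟩ N, by rw [nexp_nlog h]; abel⟩

/-- The commutator bracket. -/
def commBr (a b : B) : B := a * b - b * a

variable (k) in
/-- The operator `[a, -]`. -/
def adOp (a : B) : Module.End k B := LinearMap.mulLeft k a - LinearMap.mulRight k a

theorem adOp_apply (a b : B) : adOp k a b = commBr a b := rfl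

theorem nexp_mulLeft {a : B} (ha : IsNilpotent a) :
    nexp k (LinearMap.mulLeft k a) = LinearMap.mulLeft k (nexp k a) :=
  (map_nexp (Algebra.lmul k B) ha).symm

theorem nexp_mulRight {a : B} (ha : IsNilpotent a) :
    nexp k (LinearMap.mulRight k a) = LinearMap.mulRight k (nexp k a) := by
  obtain ⟨N, hN⟩ := ha
  have : LinearMap.mulRight k a ^ N = 0 := by
    rw [LinearMap.pow_mulRight, hN]
    ext
    simp
  rw [nexp_eq_sum this, nexp_eq_sum hN]
  ext b
  simp [LinearMap.sum_apply, Finset.mul_sum, LinearMap.pow_mulRight]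

theorem isNilpotent_adOp {a : B} (ha : IsNilpotent a) : IsNilpotent (adOp k a) := by
  obtain ⟨N, hN⟩ := ha
  refine (LinearMap.commute_mulLeft_right (R := k) a a).isNilpotent_sub ⟨N, ?_⟩ ⟨N, ?_⟩
  · rw [LinearMap.pow_mulLeft, hN]
    ext
    simp
  · rw [LinearMap.pow_mulRight, hN]
    ext
    simp

variable [CharZero k]

theorem nexp_adOp {a : B} (ha : IsNilpotent a) :
    nexp k (adOp k a) = LinearMap.mulLeft k (nexp k a) * LinearMap.mulRight k (nexp k (-a)) := by
  have e : adOp k a = LinearMap.mulLeft k a + LinearMap.mulRight k (-a) := by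
    ext b
    simp [adOp, sub_eq_add_neg]
  have hl : IsNilpotent (LinearMap.mulLeft k a) := ha.map (Algebra.lmul k B)
  have hr : IsNilpotent (LinearMap.mulRight k (-a)) := by
    obtain ⟨N, hN⟩ := ha.neg
    refine ⟨N, ?_⟩
    rw [LinearMap.pow_mulRight, hN]
    ext
    simp
  rw [e, nexp_add_of_commute (LinearMap.commute_mulLeft_right (R := k) a (-a)) hl hr, nexp_mulLeft ha,
    nexp_mulRight ha.neg]

end Dynkin

end

end StarDef

namespace StarDef

noncomputable section

section Dynkin

variable {k : Type u} [Field k] {B : Type u} [Ring B] [Algebra k B]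

variable (k B) in
/-- Left multiplication by `b sⁿ` on the polynomial ring `B[s]`, as a function of `b`. -/
def mulMonomial (n : ℕ) : B →ₗ[k] Module.End k (Polynomial B) :=
  (Algebra.lmul k (Polynomial B)).toLinearMap ∘ₗ (Polynomial.monomial n).restrictScalars k

theorem mulMonomial_apply (n : ℕ) (b : B) (p : Polynomial B) :
    mulMonomial k B n b p = Polynomial.monomial n b * p := rfl

theorem mulMonomial_mul (n m : ℕ) (b c : B) :
    mulMonomial k B n b * mulMonomial k B m c = mulMonomial k B (n + m) (b * c) := by
  ext1 p
  rw [Module.End.mul_apply, mulMonomial_apply, mulMonomial_apply, mulMonomial_apply, ← mul_assoc,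
    Polynomial.monomial_mul_monomial]

variable (k B) in
/-- The Euler operator `s d/ds` on `B[s]`. -/
def eulerOp : Module.End k (Polynomial B) :=
  LinearMap.mulLeft k Polynomial.X ∘ₗ Polynomial.derivative.restrictScalars k

theorem commBr_mulMonomial_eulerOp (n : ℕ) (b : B) :
    commBr (mulMonomial k B n b) (-eulerOp k B) = (n : k) • mulMonomial k B n b := by
  ext1 p
  have h1 : Polynomial.X * Polynomial.derivative (Polynomial.monomial n b) =
      (n : k) • Polynomial.monomial n b := by
    rw [Polynomial.derivative_monomial, Polynomial.smul_monomial, Polynomial.X_mul_monomial]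
    rcases n with _ | n
    · simp
    · simp only [Nat.add_sub_cancel, Algebra.smul_def, map_natCast]
      congr 1
      exact_mod_cast ((Nat.cast_commute (n + 1) b).eq).symm
  simp only [commBr, LinearMap.sub_apply, Module.End.mul_apply, LinearMap.neg_apply, map_neg,
    LinearMap.smul_apply, mulMonomial_apply, eulerOp, LinearMap.comp_apply,
    LinearMap.mulLeft_apply, LinearMap.restrictScalars_apply, Polynomial.derivative_mul, mul_add]
  rw [← mul_assoc Polynomial.X, h1, ← mul_assoc, ← mul_assoc Polynomial.X, Polynomial.X_mul,
    smul_mul_assoc]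
  abel

theorem nested_mulMonomial (x y : B) (w : List Bool) :
    nested commBr (mulMonomial k B 1 x) (mulMonomial k B 1 y) w =
      mulMonomial k B w.length (nested commBr x y w) := by
  match w with
  | [] => simp [nested]
  | [b] => cases b <;> simp [nested]
  | b :: c :: w =>
    have ih := nested_mulMonomial x y (c :: w)
    simp only [nested, ih, commBr]
    have : (if b then mulMonomial k B 1 x else mulMonomial k B 1 y) =
      mulMonomial k B 1 (if b then x else y) := by split_ifs <;> rfl
    rw [this, mulMonomial_mul, mulMonomial_mul, map_sub]
    simp only [List.length_cons]
    congr 2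
    ring_nf

theorem wordEval_mulMonomial (x y : B) (w : List Bool) :
    wordEval (mulMonomial k B 1 x) (mulMonomial k B 1 y) w =
      mulMonomial k B w.length (wordEval x y w) := by
  induction w with
  | nil =>
    ext1 p
    simp [wordEval, mulMonomial_apply]
  | cons b w ih =>
    have : (if b then mulMonomial k B 1 x else mulMonomial k B 1 y) =
      mulMonomial k B 1 (if b then x else y) := by split_ifs <;> rfl
    rw [wordEval_cons, ih, this, mulMonomial_mul, wordEval_cons, List.length_cons, add_comm]

theorem wordEval_adOp (x y e : B) (hx : commBr x e = x) (hy : commBr y e = y) (w : List Bool)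
    (hw : w ≠ []) : wordEval (adOp k x) (adOp k y) w e = nested commBr x y w := by
  match w with
  | [] => exact absurd rfl hw
  | [b] => cases b <;> simp [wordEval, nested, adOp_apply, hx, hy]
  | b :: c :: w =>
    have ih := wordEval_adOp x y e hx hy (c :: w) (by simp)
    rw [wordEval_cons, Module.End.mul_apply, ih]
    cases b <;> simp [nested, adOp_apply]

theorem nested_mem {S : Submodule k B} {x y : B} (hx : x ∈ S) (hy : y ∈ S) (w : List Bool) :
    nested commBr x y w ∈ S ^ w.length := by
  match w with
  | [] => exact Submodule.zero_mem _
  | [b] => cases b <;> simpa [nested]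
  | b :: c :: w =>
    have ih := nested_mem hx hy (c :: w)
    have hb : (if b then x else y) ∈ S := by split_ifs <;> assumption
    rw [nested, commBr]
    refine Submodule.sub_mem _ ?_ ?_
    · rw [List.length_cons, pow_succ']
      exact Submodule.mul_mem_mul hb ih
    · rw [List.length_cons, pow_succ]
      exact Submodule.mul_mem_mul ih hb

theorem bch_eq_sum {E : Type u} [AddCommGroup E] [Module k E] {br : E → E → E} {x y : E} {N : ℕ}
    (h : ∀ w : List Bool, N ≤ w.length → nested br x y w = 0) :
    bch k br x y = ∑ l ∈ dynkinIndex N, bchCoeff k l • nested br x y (bchWord l) := by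
  classical
  rw [bch, finsum_eq_sum_of_support_subset (s := dynkinIndex N)]
  · refine Finset.sum_congr rfl fun l hl => ?_
    have hl' := mem_dynkinIndex.1 hl
    rw [if_pos ⟨hl'.1, fun p hp => (Finset.mem_filter.1 (hl'.2.2 p hp)).2⟩]
  · intro l hl
    rw [Function.mem_support] at hl
    have hv : l ≠ [] ∧ ∀ p ∈ l, 0 < p.1 + p.2 := by
      by_contra hc
      rw [if_neg hc] at hl
      exact hl rfl
    rw [if_pos hv] at hl
    have hlen : (bchWord l).length < N := by
      by_contra hc
      rw [h _ (not_lt.1 hc), smul_zero] at hl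
      exact hl rfl
    rw [Finset.mem_coe, mem_dynkinIndex]
    refine ⟨hv.1, (length_le_length_bchWord hv.2).trans hlen.le, fun p hp => ?_⟩
    have := le_length_bchWord hp
    simp only [expPairs, Finset.mem_filter, Finset.mem_product, Finset.mem_range]
    exact ⟨⟨by omega, by omega⟩, hv.2 p hp⟩

theorem map_pow_le {B' : Type u} [Ring B'] [Algebra k B'] (S : Submodule k B)
    (τ : ℕ → B →ₗ[k] B')
    (h : ∀ n a b, τ 1 a * τ n b = τ (n + 1) (a * b) ∨ τ 1 a * τ n b = τ (n + 1) (b * a))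
    {N : ℕ} (hN : S ^ N = ⊥) (hN0 : 0 < N) : (S.map (τ 1)) ^ N = ⊥ := by
  have key : ∀ n, (S.map (τ 1)) ^ (n + 1) ≤ (S ^ (n + 1)).map (τ (n + 1)) := by
    intro n
    induction n with
    | zero => simp
    | succ n ih =>
      rw [pow_succ']
      refine (mul_le_mul_right ih _).trans (Submodule.mul_le.2 ?_)
      rintro _ ⟨a, ha, rfl⟩ _ ⟨b, hb, rfl⟩
      rcases h (n + 1) a b with h | h <;> rw [h]
      · refine Submodule.mem_map_of_mem ?_
        rw [pow_succ']
        exact Submodule.mul_mem_mul ha hb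
      · refine Submodule.mem_map_of_mem ?_
        rw [pow_succ]
        exact Submodule.mul_mem_mul hb ha
  obtain ⟨n, rfl⟩ : ∃ n, N = n + 1 := ⟨N - 1, by omega⟩
  have := key n
  rw [hN, Submodule.map_bot] at this
  exact le_bot_iff.1 this

theorem exists_adOp_mem {T : Submodule k B} {N : ℕ} (hT : T ^ N = ⊥) :
    ∃ (K : ℕ) (P : Submodule k (Module.End k B)), P ^ K = ⊥ ∧ ∀ z ∈ T, adOp k z ∈ P := by
  let l : B →ₗ[k] Module.End k B := LinearMap.mul k B
  let r : B →ₗ[k] Module.End k B := (LinearMap.mul k B).flip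
  have hl : ∀ a b, l a * l b = l (a * b) := fun a b => by
    ext1 c
    exact (mul_assoc a b c).symm
  have hr : ∀ a b, r a * r b = r (b * a) := fun a b => by
    ext1 c
    exact mul_assoc c b a
  have hlr : ∀ a b, l a * r b = r b * l a := fun a b => by
    ext1 c
    exact (mul_assoc a c b).symm
  have hT' := Submodule_pow_le_pow_of_zero hT N.le_succ
  have hPN : (T.map l) ^ (N + 1) = ⊥ :=
    map_pow_le T (fun _ => l) (fun _ a b => Or.inl (hl a b)) hT' N.succ_pos
  have hQN : (T.map r) ^ (N + 1) = ⊥ :=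
    map_pow_le T (fun _ => r) (fun _ a b => Or.inr (hr a b)) hT' N.succ_pos
  have hPQ : Commute (T.map l) (T.map r) := by
    refine le_antisymm (Submodule.mul_le.2 ?_) (Submodule.mul_le.2 ?_)
    · rintro _ ⟨a, ha, rfl⟩ _ ⟨b, hb, rfl⟩
      rw [hlr]
      exact Submodule.mul_mem_mul ⟨b, hb, rfl⟩ ⟨a, ha, rfl⟩
    · rintro _ ⟨b, hb, rfl⟩ _ ⟨a, ha, rfl⟩
      rw [← hlr]
      exact Submodule.mul_mem_mul ⟨a, ha, rfl⟩ ⟨b, hb, rfl⟩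
  obtain ⟨K, hK⟩ := hPQ.isNilpotent_add ⟨_, hPN⟩ ⟨_, hQN⟩
  exact ⟨K, _, hK, fun z hz => Submodule.sub_mem _ (Submodule.mem_sup_left ⟨z, hz, rfl⟩)
    (Submodule.mem_sup_right ⟨z, hz, rfl⟩)⟩

theorem exists_logSum_adOp [CharZero k] {T : Submodule k B} {N : ℕ} (hT : T ^ N = ⊥) {x y : B}
    (hx : x ∈ T) (hy : y ∈ T) :
    ∃ M, N ≤ M ∧ logSum k M (adOp k x) (adOp k y) = adOp k (logSum k M x y) := by
  obtain ⟨K, P, hK, had⟩ := exists_adOp_mem hT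
  have hTM := Submodule_pow_le_pow_of_zero hT (le_max_left N K)
  have hKM := Submodule_pow_le_pow_of_zero hK (le_max_right N K)
  refine ⟨max N K, le_max_left _ _, ?_⟩
  obtain ⟨hZn, hZ⟩ := nexp_logSum hTM hx hy
  obtain ⟨hWn, hW⟩ := nexp_logSum hKM (had _ hx) (had _ hy)
  have hxn : IsNilpotent x := ⟨_, pow_eq_zero_of_mem hT hx⟩
  have hyn : IsNilpotent y := ⟨_, pow_eq_zero_of_mem hT hy⟩
  set Z := logSum k (max N K) x y
  have hZneg : nexp k (-Z) = nexp k (-y) * nexp k (-x) := by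
    have h1 : nexp k Z * (nexp k (-y) * nexp k (-x)) = 1 := by
      rw [hZ, mul_assoc, ← mul_assoc (nexp k y), nexp_mul_nexp_neg hyn, one_mul,
        nexp_mul_nexp_neg hxn]
    calc nexp k (-Z) = nexp k (-Z) * (nexp k Z * (nexp k (-y) * nexp k (-x))) := by
          rw [h1, mul_one]
      _ = _ := by rw [← mul_assoc, nexp_neg_mul_nexp hZn, one_mul]
  refine nexp_injective (k := k) hWn (isNilpotent_adOp hZn) ?_
  rw [hW, nexp_adOp hxn, nexp_adOp hyn, nexp_adOp hZn, hZ, hZneg]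
  ext1 c
  simp [mul_assoc]

/-- Dynkin's form of the Baker–Campbell–Hausdorff theorem. -/
theorem bch_commBr_eq_logSum [CharZero k] {S : Submodule k B} {N : ℕ} (hS : S ^ N = ⊥) {x y : B}
    (hx : x ∈ S) (hy : y ∈ S) :
    ∃ M, S ^ M = ⊥ ∧ bch k commBr x y = logSum k M x y := by
  set T := S.map (mulMonomial k B 1) with hT
  have hTN : T ^ (N + 1) = ⊥ :=
    map_pow_le S (mulMonomial k B)
      (fun n a b => Or.inl (by rw [mulMonomial_mul, add_comm 1 n]))
      (Submodule_pow_le_pow_of_zero hS N.le_succ) N.succ_pos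
  obtain ⟨M, hNM, hlog⟩ := exists_logSum_adOp hTN (Submodule.mem_map_of_mem hx)
    (Submodule.mem_map_of_mem hy)
  have hSM : S ^ M = ⊥ := Submodule_pow_le_pow_of_zero hS (N.le_succ.trans hNM)
  refine ⟨M, hSM, ?_⟩
  set x' := mulMonomial k B 1 x with hx'
  set y' := mulMonomial k B 1 y with hy'
  have hev := LinearMap.congr_fun (LinearMap.congr_fun hlog (-eulerOp k B)) (1 : Polynomial B)
  have hne : ∀ l ∈ dynkinIndex M, bchWord l ≠ [] := fun l hl => by
    have hl' := mem_dynkinIndex.1 hl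
    exact bchWord_ne_nil hl'.1 fun p hp => (Finset.mem_filter.1 (hl'.2.2 p hp)).2
  have hl : (logSum k M (adOp k x') (adOp k y')) (-eulerOp k B) (1 : Polynomial B) =
      ∑ l ∈ dynkinIndex M, logCoeff k l •
        Polynomial.monomial (bchWord l).length (nested commBr x y (bchWord l)) := by
    rw [logSum, LinearMap.sum_apply, LinearMap.sum_apply]
    refine Finset.sum_congr rfl fun l hl => ?_
    have e1 : commBr x' (-eulerOp k B) = x' := by
      rw [hx', commBr_mulMonomial_eulerOp, Nat.cast_one, one_smul]
    have e2 : commBr y' (-eulerOp k B) = y' := by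
      rw [hy', commBr_mulMonomial_eulerOp, Nat.cast_one, one_smul]
    rw [LinearMap.smul_apply, wordEval_adOp _ _ _ e1 e2 _ (hne l hl), hx', hy', nested_mulMonomial,
      LinearMap.smul_apply, mulMonomial_apply, mul_one]
  have hr : (adOp k (logSum k M x' y')) (-eulerOp k B) (1 : Polynomial B) =
      ∑ l ∈ dynkinIndex M, logCoeff k l • ((bchWord l).length : k) •
        Polynomial.monomial (bchWord l).length (wordEval x y (bchWord l)) := by
    have e : adOp k (logSum k M x' y') (-eulerOp k B) =
        ∑ l ∈ dynkinIndex M, logCoeff k l • commBr (wordEval x' y' (bchWord l))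
          (-eulerOp k B) := by
      rw [logSum, adOp_apply]
      simp only [commBr, Finset.sum_mul, Finset.mul_sum, ← Finset.sum_sub_distrib, smul_sub,
        smul_mul_assoc, mul_smul_comm]
    rw [e, LinearMap.sum_apply]
    refine Finset.sum_congr rfl fun l _ => ?_
    rw [hx', hy', wordEval_mulMonomial, commBr_mulMonomial_eulerOp, LinearMap.smul_apply,
      LinearMap.smul_apply, mulMonomial_apply, mul_one]
  rw [hl, hr] at hev
  let Λ : Polynomial B →ₗ[k] B := Polynomial.lsum fun n => (n : k)⁻¹ • LinearMap.id
  have hΛ : ∀ n b, Λ (Polynomial.monomial n b) = (n : k)⁻¹ • b := fun n b => by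
    show (Polynomial.monomial n b).sum _ = _
    rw [Polynomial.sum_monomial_index]
    · rfl
    · simp
  have hfin := congrArg Λ hev
  simp only [map_sum, map_smul, hΛ] at hfin
  rw [bch_eq_sum (N := M), logSum]
  · refine (Finset.sum_congr rfl fun l _ => ?_).trans
      (hfin.trans (Finset.sum_congr rfl fun l hl => ?_))
    · rw [bchCoeff_eq, smul_smul, mul_comm]
    · have : ((bchWord l).length : k) ≠ 0 :=
        Nat.cast_ne_zero.2 (List.length_pos_iff.2 (hne l hl)).ne'
      rw [smul_smul ((bchWord l).length : k), mul_inv_cancel₀ this, one_smul]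
  · intro w hw
    have := nested_mem hx hy w
    rwa [Submodule_pow_le_pow_of_zero hSM hw, Submodule.mem_bot] at this

theorem nexp_bch_commBr [CharZero k] {S : Submodule k B} {N : ℕ} (hS : S ^ N = ⊥) {x y : B}
    (hx : x ∈ S) (hy : y ∈ S) : nexp k (bch k commBr x y) = nexp k x * nexp k y := by
  obtain ⟨M, hM, h⟩ := bch_commBr_eq_logSum hS hx hy
  rw [h]
  exact (nexp_logSum hM hx hy).2

theorem map_nested {E F : Type u} [AddCommGroup E] [Module k E] [AddCommGroup F] [Module k F]
    (ι : E →ₗ[k] F) {br : E → E → E} {br' : F → F → F}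
    (h : ∀ a b, ι (br a b) = br' (ι a) (ι b)) (x y : E) (w : List Bool) :
    ι (nested br x y w) = nested br' (ι x) (ι y) w := by
  match w with
  | [] => simp [nested]
  | [b] => cases b <;> simp [nested]
  | b :: c :: w =>
    have ih := map_nested ι h x y (c :: w)
    rw [nested, nested, h, ih]
    cases b <;> rfl

theorem map_bch {E F : Type u} [AddCommGroup E] [Module k E] [AddCommGroup F] [Module k F]
    (ι : E →ₗ[k] F) (hι : Function.Injective ι) {br : E → E → E} {br' : F → F → F}
    (h : ∀ a b, ι (br a b) = br' (ι a) (ι b)) (x y : E) :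
    ι (bch k br x y) = bch k br' (ι x) (ι y) := by
  rw [bch, bch]
  refine (AddMonoidHom.map_finsum_of_injective ι.toAddMonoidHom hι _).trans ?_
  refine finsum_congr fun l => ?_
  show ι _ = _
  split_ifs
  · rw [map_smul, map_nested ι h]
  · exact map_zero ι

end Dynkin

end

end StarDef

namespace StarDef

noncomputable section

section NilpotentSubmodule

variable {k : Type u} [Field k] {B : Type u} [Ring B] [Algebra k B]

theorem pow_succ_mem_of_mul_le {S : Submodule k B} (hS : S * S ≤ S) {u : B} (hu : u ∈ S) (n : ℕ) :
    u ^ (n + 1) ∈ S := by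
  induction n with
  | zero => simpa
  | succ n ih =>
    rw [pow_succ]
    exact hS (Submodule.mul_mem_mul ih hu)

theorem nlog_mem {S : Submodule k B} (hS : S * S ≤ S) {u : B} (hu : u ∈ S) (N : ℕ) :
    nlog k N u ∈ S :=
  Submodule.sum_mem _ fun n _ => Submodule.smul_mem _ _ (pow_succ_mem_of_mul_le hS hu n)

theorem nexp_sub_one_mem {S : Submodule k B} (hS : S * S ≤ S) {u : B} (hu : u ∈ S)
    (hn : IsNilpotent u) : nexp k u - 1 ∈ S := by
  obtain ⟨N, hN⟩ := hn
  rw [nexp_sub_one_eq (k := k) (pow_eq_zero_of_le N.le_succ hN), add_sub_cancel_left,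
    Finset.mul_sum]
  refine Submodule.sum_mem _ fun n _ => ?_
  rw [mul_smul_comm, ← pow_succ']
  exact Submodule.smul_mem _ _ (pow_succ_mem_of_mul_le hS hu n)

theorem nexp_map_of_pow {B' : Type u} [Ring B'] [Algebra k B'] (f : B →ₗ[k] B') {a : B}
    (h : ∀ n, f a ^ n = f (a ^ n)) (ha : IsNilpotent a) :
    IsNilpotent (f a) ∧ nexp k (f a) = f (nexp k a) := by
  obtain ⟨N, hN⟩ := ha
  have h0 : f a ^ N = 0 := by rw [h, hN, map_zero]
  refine ⟨⟨N, h0⟩, ?_⟩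
  rw [nexp_eq_sum h0, nexp_eq_sum hN, map_sum]
  exact Finset.sum_congr rfl fun n _ => by rw [h, map_smul]

variable [CharZero k]

theorem isNilpotent_bch_commBr {S : Submodule k B} {N : ℕ} (hS : S ^ N = ⊥) {x y : B}
    (hx : x ∈ S) (hy : y ∈ S) : IsNilpotent (bch k commBr x y) := by
  obtain ⟨M, hM, h⟩ := bch_commBr_eq_logSum hS hx hy
  rw [h]
  exact (nexp_logSum hM hx hy).1

theorem nexp_neg_bch_commBr {S : Submodule k B} {N : ℕ} (hS : S ^ N = ⊥) {x y : B}
    (hx : x ∈ S) (hy : y ∈ S) :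
    nexp k (-bch k commBr x y) = nexp k (-y) * nexp k (-x) := by
  have h1 : nexp k (bch k commBr x y) * (nexp k (-y) * nexp k (-x)) = 1 := by
    rw [nexp_bch_commBr hS hx hy, mul_assoc, ← mul_assoc (nexp k y),
      nexp_mul_nexp_neg ⟨N, pow_eq_zero_of_mem hS hy⟩, one_mul,
      nexp_mul_nexp_neg ⟨N, pow_eq_zero_of_mem hS hx⟩]
  calc nexp k (-bch k commBr x y) = nexp k (-bch k commBr x y) *
        (nexp k (bch k commBr x y) * (nexp k (-y) * nexp k (-x))) := by rw [h1, mul_one]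
    _ = _ := by rw [← mul_assoc, nexp_neg_mul_nexp (isNilpotent_bch_commBr hS hx hy), one_mul]

end NilpotentSubmodule

section BilinearConjugation

variable {k : Type u} [Field k] {M : Type u} [AddCommGroup M] [Module k M]

/-- The action `μ ↦ x(μ(-, -)) - μ(x -, -) - μ(-, x -)` of endomorphisms on bilinear maps. -/
def bilinAd (x : Module.End k M) : Module.End k (M →ₗ[k] M →ₗ[k] M) where
  toFun μ := μ.compr₂ x - μ ∘ₗ x - μ.compl₂ x
  map_add' μ ν := by
    ext a b
    simp only [LinearMap.sub_apply, LinearMap.add_apply, LinearMap.compr₂_apply,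
      LinearMap.comp_apply, LinearMap.compl₂_apply, map_add]
    abel
  map_smul' c μ := by
    ext a b
    simp only [LinearMap.sub_apply, LinearMap.smul_apply, LinearMap.compr₂_apply,
      LinearMap.comp_apply, LinearMap.compl₂_apply, map_smul, smul_sub, RingHom.id_apply]

theorem bilinAd_apply (x : Module.End k M) (μ : M →ₗ[k] M →ₗ[k] M) (a b : M) :
    bilinAd x μ a b = x (μ a b) - μ (x a) b - μ a (x b) := rfl

theorem nexp_bilinAd [CharZero k] {x : Module.End k M} (hx : IsNilpotent x) :
    IsNilpotent (bilinAd x) ∧ ∀ (μ : M →ₗ[k] M →ₗ[k] M) (a b : M),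
      nexp k (bilinAd x) μ a b = nexp k x (μ (nexp k (-x) a) (nexp k (-x) b)) := by
  let p : Module.End k M →ₗ[k] Module.End k (M →ₗ[k] M →ₗ[k] M) := LinearMap.mk₂ k
    (fun x μ => μ.compr₂ x) (fun _ _ _ => rfl) (fun _ _ _ => rfl)
    (fun x μ ν => by ext a b; simp) (fun c x μ => by ext a b; simp)
  let q : Module.End k M →ₗ[k] Module.End k (M →ₗ[k] M →ₗ[k] M) := LinearMap.mk₂ k
    (fun x μ => μ ∘ₗ x) (fun x y μ => by ext a b; simp) (fun c x μ => by ext a b; simp)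
    (fun x μ ν => by ext a b; simp) (fun c x μ => by ext a b; simp)
  let r : Module.End k M →ₗ[k] Module.End k (M →ₗ[k] M →ₗ[k] M) := LinearMap.mk₂ k
    (fun x μ => μ.compl₂ x) (fun x y μ => by ext a b; simp) (fun c x μ => by ext a b; simp)
    (fun x μ ν => by ext a b; simp) (fun c x μ => by ext a b; simp)
  have hp : ∀ n, p x ^ n = p (x ^ n) := fun n => by
    induction n with
    | zero => rfl
    | succ n ih => rw [pow_succ', ih, pow_succ']; rfl
  have hq : ∀ y n, q y ^ n = q (y ^ n) := fun y n => by
    induction n with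
    | zero => rfl
    | succ n ih => rw [pow_succ', ih, pow_succ]; rfl
  have hr : ∀ y n, r y ^ n = r (y ^ n) := fun y n => by
    induction n with
    | zero => rfl
    | succ n ih => rw [pow_succ', ih, pow_succ]; rfl
  have e : bilinAd x = p x + (q (-x) + r (-x)) := by
    ext μ a b
    show x (μ a b) - μ (x a) b - μ a (x b) = x (μ a b) + (μ (-x a) b + μ a (-x b))
    simp only [map_neg, LinearMap.neg_apply]
    abel
  obtain ⟨np, ep⟩ := nexp_map_of_pow (B := Module.End k M)
    (B' := Module.End k (M →ₗ[k] M →ₗ[k] M)) p hp hx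
  obtain ⟨nq, eq⟩ := nexp_map_of_pow (B := Module.End k M)
    (B' := Module.End k (M →ₗ[k] M →ₗ[k] M)) q (hq (-x)) hx.neg
  obtain ⟨nr, er⟩ := nexp_map_of_pow (B := Module.End k M)
    (B' := Module.End k (M →ₗ[k] M →ₗ[k] M)) r (hr (-x)) hx.neg
  have cqr : Commute (q (-x)) (r (-x)) := rfl
  have cp : Commute (p x) (q (-x) + r (-x)) := by
    refine Commute.add_right ?_ ?_ <;> rfl
  have nqr := cqr.isNilpotent_add nq nr
  rw [e]
  refine ⟨cp.isNilpotent_add np nqr, fun μ a b => ?_⟩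
  rw [nexp_add_of_commute cp np nqr, nexp_add_of_commute cqr nq nr, ep, eq, er]
  rfl

end BilinearConjugation

/-! ### Models of differential graded Lie algebras -/

/-- A realization of the part of degree `≤ 1` of a nilpotent DGLA `g` by elements, endomorphisms
and bilinear operations on a vector space `M` with a product `m`, such that the bracket and the
differential `[m, -]` are given by the formulas for the Hochschild complex. -/
structure Model {k : Type u} [Field k] (g : DGLAData k) (M : Type u) [AddCommGroup M]
    [Module k M] where
  ι₀ : g.C 0 →ₗ[k] M
  ι₁ : g.C 1 →ₗ[k] Module.End k M
  ι₂ : g.C 2 →ₗ[k] M →ₗ[k] M →ₗ[k] M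
  inj₀ : Function.Injective ι₀
  inj₁ : Function.Injective ι₁
  inj₂ : Function.Injective ι₂
  m : M →ₗ[k] M →ₗ[k] M
  u : M
  unit_mul : ∀ a, m u a = a
  mul_unit : ∀ a, m a u = a
  comp_mem : ∀ x y, ∃ z, ι₁ z = ι₁ x * ι₁ y
  app_mem : ∀ x t, ∃ s, ι₀ s = ι₁ x (ι₀ t)
  app_one_mem : ∀ x, ∃ s, ι₀ s = ι₁ x u
  left_one_mem : ∀ γ, ∃ x, ∀ a, ι₁ x a = ι₂ γ u a
  right_one_mem : ∀ γ, ∃ x, ∀ a, ι₁ x a = ι₂ γ a u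
  left_mem : ∀ γ t, ∃ x, ∀ a, ι₁ x a = (m + ι₂ γ) (ι₀ t) a
  nil : ∃ N, LinearMap.range ι₁ ^ N = ⊥
  br₁₁ : ∀ x y, ι₁ (g.br 1 1 1 rfl x y) = ι₁ x * ι₁ y - ι₁ y * ι₁ x
  br₁₀ : ∀ x t, ι₀ (g.br 1 0 0 rfl x t) = ι₁ x (ι₀ t)
  br₀₁ : ∀ t x, ι₀ (g.br 0 1 0 rfl t x) = -ι₁ x (ι₀ t)
  br₁₂ : ∀ x γ, ι₂ (g.br 1 2 2 rfl x γ) = bilinAd (ι₁ x) (ι₂ γ)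
  d₁ : ∀ γ x, ι₂ (g.d 1 x + g.br 2 1 2 rfl γ x) = -bilinAd (ι₁ x) (m + ι₂ γ)
  d₀ : ∀ γ t a, ι₁ (g.d 0 t + g.br 2 0 1 rfl γ t) a =
    (m + ι₂ γ) (ι₀ t) a - (m + ι₂ γ) a (ι₀ t)
  mc_iff : ∀ γ, g.IsMC γ ↔ ∀ a b c,
    (m + ι₂ γ) ((m + ι₂ γ) a b) c = (m + ι₂ γ) a ((m + ι₂ γ) b c)

namespace Model

variable {k : Type u} [Field k] {g : DGLAData k} {M : Type u} [AddCommGroup M] [Module k M]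
variable (P : Model g M)

/-- The product `m + γ`. -/
def mul (γ : g.C 2) : M →ₗ[k] M →ₗ[k] M := P.m + P.ι₂ γ

/-- The endomorphism `exp x`. -/
def phi (x : g.C 1) : Module.End k M := nexp k (P.ι₁ x)

theorem mem_range₁ (x : g.C 1) : P.ι₁ x ∈ LinearMap.range P.ι₁ := ⟨x, rfl⟩

theorem isNilpotent₁ (x : g.C 1) : IsNilpotent (P.ι₁ x) := by
  obtain ⟨N, hN⟩ := P.nil
  exact ⟨N, pow_eq_zero_of_mem hN (P.mem_range₁ x)⟩

theorem range₁_mul_le : LinearMap.range P.ι₁ * LinearMap.range P.ι₁ ≤ LinearMap.range P.ι₁ := by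
  refine Submodule.mul_le.2 ?_
  rintro _ ⟨x, rfl⟩ _ ⟨y, rfl⟩
  exact P.comp_mem x y

theorem exists_phi_eq_add (x : g.C 1) : ∃ n, P.phi x = 1 + P.ι₁ n := by
  obtain ⟨n, hn⟩ := nexp_sub_one_mem P.range₁_mul_le (P.mem_range₁ x) (P.isNilpotent₁ x)
  exact ⟨n, by rw [hn, phi]; abel⟩

theorem phi_zero : P.phi 0 = 1 := by rw [phi, map_zero, nexp_zero]

theorem exists_one_mul (γ : g.C 2) : ∃ x, ∀ a, P.mul γ P.u a = a + P.ι₁ x a := by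
  obtain ⟨x, hx⟩ := P.left_one_mem γ
  exact ⟨x, fun a => by rw [hx, mul, LinearMap.add_apply, LinearMap.add_apply, P.unit_mul]⟩

theorem exists_mul_one (γ : g.C 2) : ∃ x, ∀ a, P.mul γ a P.u = a + P.ι₁ x a := by
  obtain ⟨x, hx⟩ := P.right_one_mem γ
  exact ⟨x, fun a => by rw [hx, mul, LinearMap.add_apply, LinearMap.add_apply, P.mul_unit]⟩

variable [CharZero k]

theorem phi_injective : Function.Injective P.phi := fun x y h =>
  P.inj₁ (nexp_injective (P.isNilpotent₁ x) (P.isNilpotent₁ y) h)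

theorem phi_neg_phi (x : g.C 1) (a : M) : P.phi (-x) (P.phi x a) = a := by
  rw [← Module.End.mul_apply, phi, phi, map_neg, nexp_neg_mul_nexp (P.isNilpotent₁ x)]
  rfl

theorem phi_phi_neg (x : g.C 1) (a : M) : P.phi x (P.phi (-x) a) = a := by
  simpa using P.phi_neg_phi (-x) a

theorem exists_phi (n : g.C 1) : ∃ x, P.phi x = 1 + P.ι₁ n := by
  obtain ⟨N, hN⟩ := P.nil
  obtain ⟨x, hx⟩ := nlog_mem (k := k) P.range₁_mul_le (P.mem_range₁ n) N
  exact ⟨x, by rw [phi, hx, nexp_nlog (pow_eq_zero_of_mem hN (P.mem_range₁ n))]⟩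

theorem phi_bch (x y : g.C 1) : P.phi (bch k g.br₀ x y) = P.phi x * P.phi y := by
  obtain ⟨N, hN⟩ := P.nil
  rw [phi, map_bch P.ι₁ P.inj₁ (br := g.br₀) (br' := commBr) (fun a b => P.br₁₁ a b),
    nexp_bch_commBr hN (P.mem_range₁ x) (P.mem_range₁ y)]
  rfl

theorem eq_bch_iff (x y z : g.C 1) : z = bch k g.br₀ x y ↔ ∀ a, P.phi z a = P.phi x (P.phi y a) := by
  rw [← P.phi_injective.eq_iff, phi_bch, LinearMap.ext_iff]
  rfl

theorem eq_zero_iff₁ (x : g.C 1) : x = 0 ↔ ∀ a, P.phi x a = a := by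
  rw [← P.phi_injective.eq_iff, phi_zero, LinearMap.ext_iff]
  rfl

theorem mul_gauge (x : g.C 1) (γ : g.C 2) (a b : M) :
    P.mul (g.gauge x γ) a b = P.phi x (P.mul γ (P.phi (-x) a) (P.phi (-x) b)) := by
  obtain ⟨⟨N, hN⟩, h⟩ := nexp_bilinAd (P.isNilpotent₁ x)
  have hiter : ∀ (i : ℕ) (ν : g.C 2), P.ι₂ ((g.br 1 2 2 rfl x)^[i] ν) =
      (bilinAd (P.ι₁ x) ^ i) (P.ι₂ ν) := by
    intro i
    induction i with
    | zero => intro ν; rfl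
    | succ i ih =>
      intro ν
      rw [Function.iterate_succ_apply, ih, P.br₁₂, pow_succ]
      rfl
  have hsum : P.ι₂ (∑ᶠ i : ℕ, (((i + 1).factorial : k)⁻¹) •
      (g.br 1 2 2 rfl x)^[i] (g.d 1 x + g.br 2 1 2 rfl γ x)) =
      -∑ i ∈ Finset.range N, (((i + 1).factorial : k)⁻¹) •
        (bilinAd (P.ι₁ x) ^ (i + 1)) (P.mul γ) := by
    refine (AddMonoidHom.map_finsum_of_injective P.ι₂.toAddMonoidHom P.inj₂ _).trans ?_
    have e : ∀ i : ℕ, P.ι₂.toAddMonoidHom ((((i + 1).factorial : k)⁻¹) •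
        (g.br 1 2 2 rfl x)^[i] (g.d 1 x + g.br 2 1 2 rfl γ x)) =
        -((((i + 1).factorial : k)⁻¹) • (bilinAd (P.ι₁ x) ^ (i + 1)) (P.mul γ)) := by
      intro i
      show P.ι₂ _ = _
      rw [map_smul, hiter, P.d₁, map_neg, smul_neg, pow_succ]
      rfl
    rw [finsum_congr e, finsum_eq_sum_of_support_subset (s := Finset.range N),
      Finset.sum_neg_distrib]
    intro i hi
    by_contra hc
    simp only [Finset.coe_range, Set.mem_Iio, not_lt] at hc
    exact hi (by simp [pow_eq_zero_of_le (hc.trans i.le_succ) hN])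
  have key : P.mul (g.gauge x γ) = nexp k (bilinAd (P.ι₁ x)) (P.mul γ) := by
    rw [nexp_eq_sum (pow_eq_zero_of_le N.le_succ hN), Finset.sum_range_succ', mul,
      DGLAData.gauge, map_sub, hsum, LinearMap.add_apply, LinearMap.sum_apply]
    simp only [LinearMap.smul_apply, pow_zero, Nat.factorial_zero, Nat.cast_one, inv_one, one_smul,
      Module.End.one_apply, sub_neg_eq_add, mul]
    abel
  rw [key, h, phi, phi, map_neg]

theorem gauge_eq_iff (x : g.C 1) (γ₁ γ₂ : g.C 2) : g.gauge x γ₁ = γ₂ ↔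
    ∀ a b, P.phi x (P.mul γ₁ a b) = P.mul γ₂ (P.phi x a) (P.phi x b) := by
  constructor
  · rintro rfl a b
    rw [mul_gauge, phi_neg_phi, phi_neg_phi]
  · intro h
    apply P.inj₂
    ext a b
    have h1 := P.mul_gauge x γ₁ a b
    rw [h, phi_phi_neg, phi_phi_neg] at h1
    simpa [mul] using h1

theorem exists_unit (γ : {γ : g.C 2 // g.IsMC γ}) : ∃ e : M,
    (∀ a, P.mul γ.1 e a = a) ∧ (∀ a, P.mul γ.1 a e = a) ∧ ∃ s, e = P.u + P.ι₀ s := by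
  have hassoc := (P.mc_iff γ.1).1 γ.2
  obtain ⟨n, hn⟩ := P.exists_one_mul γ.1
  obtain ⟨n', hn'⟩ := P.exists_mul_one γ.1
  obtain ⟨x, hx⟩ := P.exists_phi n
  obtain ⟨y, hy⟩ := P.exists_phi n'
  have hl : ∀ a, P.mul γ.1 P.u a = P.phi x a := fun a => by rw [hn, hx]; rfl
  have hr : ∀ a, P.mul γ.1 a P.u = P.phi y a := fun a => by rw [hn', hy]; rfl
  have he : P.mul γ.1 P.u (P.phi (-x) P.u) = P.u := by rw [hl, phi_phi_neg]
  have hright : ∀ a, P.mul γ.1 a (P.phi (-x) P.u) = a := by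
    intro a
    obtain ⟨b, rfl⟩ : ∃ b, P.mul γ.1 b P.u = a := ⟨P.phi (-y) a, by rw [hr, phi_phi_neg]⟩
    exact (hassoc _ _ _).trans (congrArg (P.mul γ.1 b) he)
  have he' : P.mul γ.1 (P.phi (-y) P.u) P.u = P.u := by rw [hr, phi_phi_neg]
  have hleft : ∀ a, P.mul γ.1 (P.phi (-y) P.u) a = a := by
    intro a
    obtain ⟨b, rfl⟩ : ∃ b, P.mul γ.1 P.u b = a := ⟨P.phi (-x) a, by rw [hl, phi_phi_neg]⟩
    exact (hassoc _ _ _).symm.trans (congrArg (fun c => P.mul γ.1 c b) he')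
  have hee : P.phi (-y) P.u = P.phi (-x) P.u := by rw [← hright (P.phi (-y) P.u), hleft]
  rw [hee] at hleft
  obtain ⟨z, hz⟩ := P.exists_phi_eq_add (-x)
  obtain ⟨s, hs⟩ := P.app_one_mem z
  exact ⟨_, hleft, hright, s, by rw [hz, hs]; rfl⟩

/-- The vector space `M` with the product `m + γ` of a Maurer–Cartan element `γ`. -/
def Alg (_ : Model g M) (_ : {γ : g.C 2 // g.IsMC γ}) : Type u := M

variable (γ : {γ : g.C 2 // g.IsMC γ})

instance : AddCommGroup (P.Alg γ) := inferInstanceAs (AddCommGroup M)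

instance : Module k (P.Alg γ) := inferInstanceAs (Module k M)

instance : Ring (P.Alg γ) :=
  { (inferInstance : AddCommGroup (P.Alg γ)) with
    mul := fun a b => P.mul γ.1 a b
    one := (P.exists_unit γ).choose
    left_distrib := fun a b c => map_add (P.mul γ.1 a) b c
    right_distrib := fun a b c => congrArg (fun f => f c) (map_add (P.mul γ.1) a b)
    zero_mul := fun a => congrArg (fun f => f a) (map_zero (P.mul γ.1))
    mul_zero := fun a => map_zero (P.mul γ.1 a)
    mul_assoc := (P.mc_iff γ.1).1 γ.2
    one_mul := (P.exists_unit γ).choose_spec.1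
    mul_one := (P.exists_unit γ).choose_spec.2.1 }

instance : Algebra k (P.Alg γ) :=
  Algebra.ofModule (fun c a b => congrArg (fun f => f b) (map_smul (P.mul γ.1) c a))
    (fun c a b => map_smul (P.mul γ.1 a) c b)

/-- `ι₀` with values in `Alg γ`. -/
def elt : g.C 0 →ₗ[k] P.Alg γ := P.ι₀

theorem elt_injective : Function.Injective (P.elt γ) := P.inj₀

theorem exists_one_eq : ∃ s, (1 : P.Alg γ) = P.u + P.ι₀ s := (P.exists_unit γ).choose_spec.2.2

end Model

end

end StarDef

namespace StarDef

noncomputable section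

/-- A faithful representation of the 2-morphisms of `G` by elements of monoids, and of the
1-morphisms by homomorphisms between these monoids. -/
structure TwoRep (G : TwoCatData.{u}) where
  Mon : G.Obj → Type u
  [mon : ∀ a, Monoid (Mon a)]
  act : ∀ {a b : G.Obj}, G.Hom a b → Mon a →* Mon b
  beta : ∀ {a b : G.Obj} {f f' : G.Hom a b}, G.Hom2 f f' → Mon b
  act_injective : ∀ {a b : G.Obj} (f f' : G.Hom a b), (∀ c, act f c = act f' c) → f = f'
  beta_injective : ∀ {a b : G.Obj} {f f' : G.Hom a b} (s s' : G.Hom2 f f'),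
    beta s = beta s' → s = s'
  comm : ∀ {a b : G.Obj} {f f' : G.Hom a b} (s : G.Hom2 f f') (c : Mon a),
    act f c * beta s = beta s * act f' c
  isId_iff : ∀ {a : G.Obj} (e : G.Hom a a), G.IsId e ↔ ∀ c, act e c = c
  isComp_iff : ∀ {a b c : G.Obj} (f : G.Hom a b) (g : G.Hom b c) (h : G.Hom a c),
    G.IsComp f g h ↔ ∀ x, act h x = act g (act f x)
  isId2_iff : ∀ {a b : G.Obj} {f : G.Hom a b} (i : G.Hom2 f f), G.IsId2 i ↔ beta i = 1
  isVComp_iff : ∀ {a b : G.Obj} {f g h : G.Hom a b} (s : G.Hom2 f g) (t : G.Hom2 g h)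
    (w : G.Hom2 f h), G.IsVComp s t w ↔ beta w = beta s * beta t
  isHComp_iff : ∀ {a b c : G.Obj} {f f' : G.Hom a b} {g g' : G.Hom b c} {p p' : G.Hom a c}
    (s : G.Hom2 f f') (t : G.Hom2 g g') (w : G.Hom2 p p'),
    G.IsHComp s t w ↔ beta w = act g (beta s) * beta t
  exists_id : ∀ a : G.Obj, ∃ e : G.Hom a a, ∀ c, act e c = c
  exists_comp : ∀ {a b c : G.Obj} (f : G.Hom a b) (g : G.Hom b c),
    ∃ h : G.Hom a c, ∀ x, act h x = act g (act f x)
  exists_inv : ∀ {a b : G.Obj} (f : G.Hom a b), ∃ g : G.Hom b a,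
    (∀ x, act g (act f x) = x) ∧ ∀ x, act f (act g x) = x
  exists_id2 : ∀ {a b : G.Obj} (f : G.Hom a b), ∃ i : G.Hom2 f f, beta i = 1
  exists_vcomp : ∀ {a b : G.Obj} {f g h : G.Hom a b} (s : G.Hom2 f g) (t : G.Hom2 g h),
    ∃ w : G.Hom2 f h, beta w = beta s * beta t
  exists_inv2 : ∀ {a b : G.Obj} {f g : G.Hom a b} (s : G.Hom2 f g), ∃ t : G.Hom2 g f,
    beta s * beta t = 1 ∧ beta t * beta s = 1
  exists_hcomp : ∀ {a b c : G.Obj} {f f' : G.Hom a b} {g g' : G.Hom b c} {p p' : G.Hom a c}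
    (s : G.Hom2 f f') (t : G.Hom2 g g'), G.IsComp f g p → G.IsComp f' g' p' →
    ∃ w : G.Hom2 p p', beta w = act g (beta s) * beta t

attribute [instance] TwoRep.mon

theorem TwoRep.isTwoGroupoid {G : TwoCatData.{u}} (P : TwoRep G) : G.IsTwoGroupoid where
  id_exists a := by
    obtain ⟨e, he⟩ := P.exists_id a
    refine ⟨e, (P.isId_iff e).2 he, fun e' he' => P.act_injective _ _ fun c => ?_⟩
    rw [he, (P.isId_iff e').1 he']
  comp_exists f g := by
    obtain ⟨h, hh⟩ := P.exists_comp f g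
    refine ⟨h, (P.isComp_iff f g h).2 hh, fun h' hh' => P.act_injective _ _ fun c => ?_⟩
    rw [hh, (P.isComp_iff f g h').1 hh']
  id_comp e f he := by
    rw [P.isId_iff] at he
    simp [P.isComp_iff, he]
  comp_id f e he := by
    rw [P.isId_iff] at he
    simp [P.isComp_iff, he]
  assoc f g h fg gh p h1 h2 := by
    rw [P.isComp_iff] at h1 h2
    simp [P.isComp_iff, h1, h2]
  inv_exists {a b} f := by
    obtain ⟨e, he⟩ := P.exists_id a
    obtain ⟨e', he'⟩ := P.exists_id b
    obtain ⟨g, hg, hg'⟩ := P.exists_inv f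
    refine ⟨g, e, e', (P.isId_iff e).2 he, (P.isId_iff e').2 he', ?_, ?_⟩
    · simp [P.isComp_iff, he, hg]
    · simp [P.isComp_iff, he', hg']
  id2_exists f := by
    obtain ⟨i, hi⟩ := P.exists_id2 f
    refine ⟨i, (P.isId2_iff i).2 hi, fun j hj => P.beta_injective _ _ ?_⟩
    rw [hi, (P.isId2_iff j).1 hj]
  vcomp_exists s t := by
    obtain ⟨w, hw⟩ := P.exists_vcomp s t
    refine ⟨w, (P.isVComp_iff s t w).2 hw, fun w' hw' => P.beta_injective _ _ ?_⟩
    rw [hw, (P.isVComp_iff s t w').1 hw']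
  id2_vcomp i s hi := by
    rw [P.isId2_iff] at hi
    rw [P.isVComp_iff, hi, one_mul]
  vcomp_id2 s i hi := by
    rw [P.isId2_iff] at hi
    rw [P.isVComp_iff, hi, mul_one]
  vcomp_assoc s t r st tr w h1 h2 := by
    rw [P.isVComp_iff] at h1 h2 ⊢
    rw [P.isVComp_iff, h1, h2, mul_assoc]
  inv2_exists {a b f g} s := by
    obtain ⟨i, hi⟩ := P.exists_id2 f
    obtain ⟨j, hj⟩ := P.exists_id2 g
    obtain ⟨t, ht, ht'⟩ := P.exists_inv2 s
    refine ⟨t, i, j, (P.isId2_iff i).2 hi, (P.isId2_iff j).2 hj, ?_, ?_⟩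
    · rw [P.isVComp_iff, hi, ht]
    · rw [P.isVComp_iff, hj, ht']
  hcomp_exists s t hp hp' := by
    obtain ⟨w, hw⟩ := P.exists_hcomp s t hp hp'
    refine ⟨w, (P.isHComp_iff s t w).2 hw, fun w' hw' => P.beta_injective _ _ ?_⟩
    rw [hw, (P.isHComp_iff s t w').1 hw']
  hcomp_id2 i j w _ hi hj hw := by
    rw [P.isId2_iff] at hi hj ⊢
    rw [P.isHComp_iff, hi, hj, map_one, one_mul] at hw
    exact hw
  id_hcomp i s _ hi := by
    rw [P.isId2_iff] at hi
    rw [P.isHComp_iff, hi, map_one, one_mul]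
  hcomp_id s i he hi := by
    rw [P.isId2_iff] at hi
    rw [P.isId_iff] at he
    rw [P.isHComp_iff, hi, he, mul_one]
  hcomp_assoc s t r st tr w _ _ h3 _ _ _ h7 h8 := by
    rw [P.isComp_iff] at h3
    rw [P.isHComp_iff] at h7 h8 ⊢
    rw [P.isHComp_iff, h7, h8, h3, map_mul, mul_assoc]
  interchange s s' t t' ss tt w w' x _ _ _ h4 h5 h6 h7 := by
    rw [P.isVComp_iff] at h4 h5 ⊢
    rw [P.isHComp_iff] at h6 h7 ⊢
    rw [h4, h5, h6, h7, map_mul, mul_assoc, mul_assoc, ← mul_assoc (P.beta t), ← P.comm t,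
      mul_assoc]

namespace Model

variable {k : Type u} [Field k] [CharZero k] {g : DGLAData k} {M : Type u} [AddCommGroup M]
  [Module k M] (P : Model g M) (γ : {γ : g.C 2 // g.IsMC γ})

theorem mem_range₀ (t : g.C 0) : P.elt γ t ∈ LinearMap.range (P.elt γ) := ⟨t, rfl⟩

theorem exists_left (t : g.C 0) : ∃ x, ∀ a : P.Alg γ, P.ι₁ x a = P.elt γ t * a :=
  P.left_mem γ.1 t

theorem range₀_mul_le :
    LinearMap.range (P.elt γ) * LinearMap.range (P.elt γ) ≤ LinearMap.range (P.elt γ) := by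
  refine Submodule.mul_le.2 ?_
  rintro _ ⟨s, rfl⟩ _ ⟨t, rfl⟩
  obtain ⟨x, hx⟩ := P.exists_left γ s
  obtain ⟨r, hr⟩ := P.app_mem x t
  exact ⟨r, hr.trans (hx (P.elt γ t))⟩

theorem nil₀ : ∃ N, LinearMap.range (P.elt γ) ^ N = ⊥ := by
  obtain ⟨N, hN⟩ := P.nil
  have key : ∀ n, ∀ a ∈ LinearMap.range (P.elt γ) ^ n,
      ∃ f ∈ LinearMap.range P.ι₁ ^ n, ∀ b : P.Alg γ, f b = a * b := by
    intro n
    induction n with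
    | zero =>
      intro a ha
      rw [pow_zero, Submodule.mem_one] at ha
      obtain ⟨c, rfl⟩ := ha
      refine ⟨algebraMap k _ c, ?_, fun b => ?_⟩
      · rw [pow_zero]
        exact Submodule.mem_one.2 ⟨c, rfl⟩
      · rw [← Algebra.smul_def]
        rfl
    | succ n ih =>
      intro a ha
      rw [pow_succ'] at ha
      refine Submodule.mul_induction_on ha ?_ ?_
      · rintro _ ⟨t, rfl⟩ b hb
        obtain ⟨f, hf, hf'⟩ := ih b hb
        obtain ⟨x, hx⟩ := P.exists_left γ t
        refine ⟨P.ι₁ x * f, ?_, fun c => ?_⟩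
        · rw [pow_succ']
          exact Submodule.mul_mem_mul (P.mem_range₁ x) hf
        · rw [mul_assoc, ← hf']
          exact hx (f c)
      · rintro a b ⟨f, hf, hf'⟩ ⟨f', hf₁, hf₁'⟩
        exact ⟨f + f', Submodule.add_mem _ hf hf₁, fun c => by
          rw [add_mul, ← hf', ← hf₁']
          rfl⟩
  refine ⟨N, (Submodule.eq_bot_iff _).2 fun a ha => ?_⟩
  obtain ⟨f, hf, hf'⟩ := key N a ha
  rw [hN, Submodule.mem_bot] at hf
  rw [← mul_one a, ← hf', hf]
  rfl

theorem isNilpotent_elt (t : g.C 0) : IsNilpotent (P.elt γ t) := by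
  obtain ⟨N, hN⟩ := P.nil₀ γ
  exact ⟨N, pow_eq_zero_of_mem hN (P.mem_range₀ γ t)⟩

/-- The element `exp (-t)` of the algebra `Alg γ`. -/
def beta (t : g.C 0) : P.Alg γ := nexp k (-P.elt γ t)

theorem beta_zero : P.beta γ 0 = 1 := by rw [beta, map_zero, neg_zero, nexp_zero]

theorem beta_mul_beta_neg (t : g.C 0) : P.beta γ t * P.beta γ (-t) = 1 := by
  rw [beta, beta, map_neg]
  exact nexp_mul_nexp_neg (P.isNilpotent_elt γ t).neg

theorem beta_neg_mul_beta (t : g.C 0) : P.beta γ (-t) * P.beta γ t = 1 := by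
  simpa using P.beta_mul_beta_neg γ (-t)

theorem beta_injective : Function.Injective (P.beta γ) := fun s t h =>
  P.elt_injective γ (neg_injective
    (nexp_injective (P.isNilpotent_elt γ s).neg (P.isNilpotent_elt γ t).neg h))

theorem exists_beta_eq_add (t : g.C 0) : ∃ s, P.beta γ t = P.u + P.ι₀ s := by
  obtain ⟨s, hs⟩ := nexp_sub_one_mem (P.range₀_mul_le γ)
    (Submodule.neg_mem _ (P.mem_range₀ γ t)) (P.isNilpotent_elt γ t).neg
  obtain ⟨r, hr⟩ := P.exists_one_eq γ
  refine ⟨r + s, ?_⟩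
  have h1 : P.beta γ t = 1 + P.elt γ s := by
    rw [hs, beta]
    abel
  rw [h1, hr, map_add, ← add_assoc]
  rfl

theorem exists_beta (s : g.C 0) : ∃ t, P.beta γ t = P.u + P.ι₀ s := by
  obtain ⟨N, hN⟩ := P.nil₀ γ
  obtain ⟨r, hr⟩ := P.exists_one_eq γ
  have hmem := P.mem_range₀ γ (s - r)
  obtain ⟨t, ht⟩ := nlog_mem (k := k) (P.range₀_mul_le γ) hmem N
  refine ⟨-t, ?_⟩
  rw [beta, map_neg, neg_neg, ht, nexp_nlog (pow_eq_zero_of_mem hN hmem), hr, map_sub]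
  show P.u + P.ι₀ r + (P.ι₀ s - P.ι₀ r) = P.u + P.ι₀ s
  abel

theorem elt_brTwist (s t : g.C 0) :
    P.elt γ (g.brTwist γ.1 s t) = commBr (P.elt γ s) (P.elt γ t) := by
  refine (P.br₀₁ s (g.dTwist γ.1 t)).trans ?_
  rw [DGLAData.dTwist, P.d₀, neg_sub]
  rfl

theorem beta_bch (s t : g.C 0) :
    P.beta γ (bch k (g.brTwist γ.1) s t) = P.beta γ t * P.beta γ s := by
  obtain ⟨N, hN⟩ := P.nil₀ γ
  rw [beta, map_bch (P.elt γ) (P.elt_injective γ) (P.elt_brTwist γ),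
    nexp_neg_bch_commBr hN (P.mem_range₀ γ s) (P.mem_range₀ γ t)]
  rfl

theorem eq_bch_iff₀ (s t w : g.C 0) : w = bch k (g.brTwist γ.1) t s ↔
    P.beta γ w = P.beta γ s * P.beta γ t := by
  rw [← (P.beta_injective γ).eq_iff, beta_bch]

theorem eq_zero_iff₀ (t : g.C 0) : t = 0 ↔ P.beta γ t = 1 := by
  rw [← (P.beta_injective γ).eq_iff, beta_zero]

/-- The endomorphism `exp x` of `M` as a map between algebras. -/
def act (x : g.C 1) (γ₁ γ₂ : {γ : g.C 2 // g.IsMC γ}) (a : P.Alg γ₁) : P.Alg γ₂ := P.phi x a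

theorem phi_dTwist (t : g.C 0) (a : P.Alg γ) :
    P.act (g.dTwist γ.1 t) γ γ a = P.beta γ (-t) * a * P.beta γ t := by
  have e : ∀ n : ℕ, ∀ a : P.Alg γ,
      (P.ι₁ (g.dTwist γ.1 t) ^ n) a = (adOp k (P.elt γ t) ^ n) a := by
    intro n
    induction n with
    | zero => exact fun _ => rfl
    | succ n ih =>
      intro a
      rw [pow_succ, pow_succ]
      refine Eq.trans ?_ (ih (adOp k (P.elt γ t) a))
      exact congrArg _ (P.d₀ γ.1 t a)
  have hn := P.isNilpotent₁ (g.dTwist γ.1 t)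
  have hn' := isNilpotent_adOp (k := k) (P.isNilpotent_elt γ t)
  have h1 : P.act (g.dTwist γ.1 t) γ γ a = nexp k (adOp k (P.elt γ t)) a := by
    obtain ⟨N, hN⟩ := hn
    obtain ⟨N', hN'⟩ := hn'
    have hm := pow_eq_zero_of_le (le_max_left N N') hN
    have hm' := pow_eq_zero_of_le (le_max_right N N') hN'
    rw [act, phi, nexp_eq_sum hm, nexp_eq_sum hm', LinearMap.sum_apply]
    refine Eq.trans (LinearMap.sum_apply (M := M) (M₂ := M) _ _ (a : M))
      (Finset.sum_congr rfl fun n _ => ?_)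
    exact congrArg (fun z => ((n.factorial : k)⁻¹) • z) (e n a)
  rw [h1, nexp_adOp (P.isNilpotent_elt γ t), Module.End.mul_apply, LinearMap.mulLeft_apply,
    LinearMap.mulRight_apply, ← mul_assoc, beta, beta, map_neg, neg_neg]

theorem hom2_iff (γ₁ : {γ : g.C 2 // g.IsMC γ}) (x y : g.C 1) (t : g.C 0) :
    bch k g.br₀ (g.dTwist γ.1 t) x = y ↔
      ∀ a, P.act x γ₁ γ a * P.beta γ t = P.beta γ t * P.act y γ₁ γ a := by
  rw [eq_comm, P.eq_bch_iff]
  constructor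
  · intro h a
    have h1 : P.act y γ₁ γ a = P.beta γ (-t) * P.act x γ₁ γ a * P.beta γ t :=
      (h a).trans (P.phi_dTwist γ t (P.phi x a))
    rw [h1, ← mul_assoc, ← mul_assoc, beta_mul_beta_neg, one_mul]
  · intro h a
    have h1 : ∀ a, P.act y γ₁ γ a = P.beta γ (-t) * P.act x γ₁ γ a * P.beta γ t := fun a => by
      rw [mul_assoc, h, ← mul_assoc, beta_neg_mul_beta, one_mul]
    exact (h1 a).trans (P.phi_dTwist γ t (P.phi x a)).symm

theorem elt_expNil (x : g.C 1) (γ₁ γ₂ : {γ : g.C 2 // g.IsMC γ}) (t : g.C 0) :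
    P.elt γ₂ (expNil k (g.br 1 0 0 rfl x) t) = P.act x γ₁ γ₂ (P.elt γ₁ t) := by
  have hiter : ∀ (i : ℕ) (t : g.C 0), P.ι₀ ((g.br 1 0 0 rfl x)^[i] t) =
      (P.ι₁ x)^[i] (P.ι₀ t) := by
    intro i
    induction i with
    | zero => exact fun _ => rfl
    | succ i ih =>
      intro t
      rw [Function.iterate_succ_apply, ih, P.br₁₀, Function.iterate_succ_apply]
  refine Eq.trans ?_ (expNil_eq_nexp (P.isNilpotent₁ x) (P.ι₀ t))
  refine (AddMonoidHom.map_finsum_of_injective P.ι₀.toAddMonoidHom P.inj₀ _).trans ?_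
  refine finsum_congr fun i => ?_
  show P.ι₀ _ = _
  rw [map_smul, hiter]

variable {γ₁ γ₂ γ₃ : {γ : g.C 2 // g.IsMC γ}}

theorem act_mul {x : g.C 1} (hx : g.gauge x γ₁.1 = γ₂.1) (a b : P.Alg γ₁) :
    P.act x γ₁ γ₂ (a * b) = P.act x γ₁ γ₂ a * P.act x γ₁ γ₂ b :=
  (P.gauge_eq_iff x γ₁.1 γ₂.1).1 hx a b

theorem act_one {x : g.C 1} (hx : g.gauge x γ₁.1 = γ₂.1) : P.act x γ₁ γ₂ 1 = 1 := by
  have h : ∀ a, P.act x γ₁ γ₂ 1 * a = a := by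
    intro a
    obtain ⟨b, rfl⟩ : ∃ b, P.act x γ₁ γ₂ b = a := ⟨P.phi (-x) a, P.phi_phi_neg x a⟩
    rw [← P.act_mul hx, one_mul]
  simpa using h 1

/-- The homomorphism of algebras given by a 1-morphism. -/
def hom {x : g.C 1} (hx : g.gauge x γ₁.1 = γ₂.1) : P.Alg γ₁ →ₐ[k] P.Alg γ₂ :=
  AlgHom.ofLinearMap (P.phi x) (P.act_one hx) (P.act_mul hx)

theorem beta_expNil {x : g.C 1} (hx : g.gauge x γ₁.1 = γ₂.1) (t : g.C 0) :
    P.beta γ₂ (expNil k (g.br 1 0 0 rfl x) t) = P.act x γ₁ γ₂ (P.beta γ₁ t) := by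
  rw [beta, P.elt_expNil x γ₁ γ₂]
  have := map_nexp (P.hom hx) (P.isNilpotent_elt γ₁ t).neg
  rw [map_neg] at this
  exact this.symm

theorem eq_hcomp_iff {x : g.C 1} (hx : g.gauge x γ₁.1 = γ₂.1) (s t w : g.C 0) :
    w = bch k (g.brTwist γ₂.1) t (expNil k (g.br 1 0 0 rfl x) s) ↔
      P.beta γ₂ w = P.act x γ₁ γ₂ (P.beta γ₁ s) * P.beta γ₂ t := by
  rw [P.eq_bch_iff₀, P.beta_expNil hx]

/-- The homomorphism of monoids given by a 1-morphism. -/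
def actHom {x : g.C 1} (hx : g.gauge x γ₁.1 = γ₂.1) : P.Alg γ₁ →* P.Alg γ₂ where
  toFun := P.act x γ₁ γ₂
  map_one' := P.act_one hx
  map_mul' := P.act_mul hx

theorem hom2_zero (P : Model g M) (γ : {γ : g.C 2 // g.IsMC γ}) (x : g.C 1) :
    bch k g.br₀ (g.dTwist γ.1 0) x = x :=
  (P.hom2_iff γ γ x x 0).2 fun a => by rw [P.beta_zero, one_mul, mul_one]

theorem hom2_bch (P : Model g M) (γ : {γ : g.C 2 // g.IsMC γ}) {x y z : g.C 1} {s t : g.C 0}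
    (hs : bch k g.br₀ (g.dTwist γ.1 s) x = y)
    (ht : bch k g.br₀ (g.dTwist γ.1 t) y = z) :
    bch k g.br₀ (g.dTwist γ.1 (bch k (g.brTwist γ.1) t s)) x = z := by
  rw [P.hom2_iff γ γ] at hs ht ⊢
  intro a
  rw [P.beta_bch γ, ← mul_assoc, hs, mul_assoc, ht, mul_assoc]

theorem hom2_neg (P : Model g M) (γ : {γ : g.C 2 // g.IsMC γ}) {x y : g.C 1} {s : g.C 0}
    (hs : bch k g.br₀ (g.dTwist γ.1 s) x = y) :
    bch k g.br₀ (g.dTwist γ.1 (-s)) y = x := by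
  rw [P.hom2_iff γ γ] at hs ⊢
  intro a
  have h1 : P.act x γ γ a = P.beta γ s * P.act y γ γ a * P.beta γ (-s) := by
    rw [← hs, mul_assoc, P.beta_mul_beta_neg γ s, mul_one]
  rw [h1, ← mul_assoc, ← mul_assoc, P.beta_neg_mul_beta γ s, one_mul]

theorem hom2_hcomp (P : Model g M) {x x' y y' z z' : g.C 1} {s t : g.C 0}
    (hy : g.gauge y γ₁.1 = γ₂.1)
    (hs : bch k g.br₀ (g.dTwist γ₁.1 s) x = x') (ht : bch k g.br₀ (g.dTwist γ₂.1 t) y = y')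
    (hz : z = bch k g.br₀ y x) (hz' : z' = bch k g.br₀ y' x') :
    bch k g.br₀ (g.dTwist γ₂.1
      (bch k (g.brTwist γ₂.1) t (expNil k (g.br 1 0 0 rfl y) s))) z = z' := by
  rw [P.eq_bch_iff] at hz hz'
  rw [P.hom2_iff γ₁ γ₁] at hs
  rw [P.hom2_iff γ₂ γ₁] at ht ⊢
  intro a
  have h1 : P.act z γ₁ γ₂ a = P.act y γ₁ γ₂ (P.act x γ₁ γ₁ a) := hz a
  have h2 : P.act z' γ₁ γ₂ a = P.act y' γ₁ γ₂ (P.act x' γ₁ γ₁ a) := hz' a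
  rw [(P.eq_hcomp_iff hy s t _).1 rfl, h1, h2, ← mul_assoc, ← P.act_mul hy, hs,
    P.act_mul hy, mul_assoc, ht, mul_assoc]

theorem gauge_zero (P : Model g M) (γ : {γ : g.C 2 // g.IsMC γ}) : g.gauge 0 γ.1 = γ.1 :=
  (P.gauge_eq_iff 0 γ.1 γ.1).2 fun a b => by simp [P.phi_zero]

theorem gauge_bch (P : Model g M) {x y : g.C 1} (hx : g.gauge x γ₁.1 = γ₂.1)
    (hy : g.gauge y γ₂.1 = γ₃.1) :
    g.gauge (bch k g.br₀ y x) γ₁.1 = γ₃.1 := by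
  rw [P.gauge_eq_iff] at hx hy ⊢
  intro a b
  rw [P.phi_bch, Module.End.mul_apply, hx, hy]
  rfl

theorem gauge_neg (P : Model g M) {x : g.C 1} (hx : g.gauge x γ₁.1 = γ₂.1) :
    g.gauge (-x) γ₂.1 = γ₁.1 := by
  rw [P.gauge_eq_iff] at hx ⊢
  intro a b
  have := hx (P.phi (-x) a) (P.phi (-x) b)
  rw [P.phi_phi_neg, P.phi_phi_neg] at this
  rw [← this, P.phi_neg_phi]

/-- The Deligne 2-groupoid of a DGLA with a model acts on the algebras `Alg γ`. -/
def mc2Rep : TwoRep g.MC2 where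
  Mon := P.Alg
  mon := fun γ : {γ : g.C 2 // g.IsMC γ} => inferInstanceAs (Monoid (P.Alg γ))
  act x := P.actHom x.2
  beta := fun {_ γ₂ _ _} t => P.beta γ₂ t.1
  act_injective _ _ h := Subtype.ext (P.phi_injective (LinearMap.ext fun a => h a))
  beta_injective := fun {_ γ₂ _ _} _ _ h => Subtype.ext (P.beta_injective γ₂ h)
  comm := fun {γ₁ γ₂ x y} t => (P.hom2_iff γ₂ γ₁ x.1 y.1 t.1).1 t.2
  isId_iff x := P.eq_zero_iff₁ x.1
  isComp_iff x y z := P.eq_bch_iff y.1 x.1 z.1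
  isId2_iff := fun {_ γ₂ _} t => P.eq_zero_iff₀ γ₂ t.1
  isVComp_iff := fun {_ γ₂ _ _ _} s t w => P.eq_bch_iff₀ γ₂ s.1 t.1 w.1
  isHComp_iff := fun {_ _ _ _ _ y _ _ _} s t w => P.eq_hcomp_iff y.2 s.1 t.1 w.1
  exists_id γ := ⟨⟨0, P.gauge_zero γ⟩, (P.eq_zero_iff₁ 0).1 rfl⟩
  exists_comp x y := ⟨⟨_, P.gauge_bch x.2 y.2⟩, (P.eq_bch_iff y.1 x.1 _).1 rfl⟩
  exists_inv x := ⟨⟨-x.1, P.gauge_neg x.2⟩, P.phi_neg_phi x.1, P.phi_phi_neg x.1⟩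
  exists_id2 := fun {_ γ₂} x => ⟨⟨0, P.hom2_zero γ₂ x.1⟩, P.beta_zero γ₂⟩
  exists_vcomp := fun {_ γ₂ _ _ _} s t => ⟨⟨_, P.hom2_bch γ₂ s.2 t.2⟩, P.beta_bch γ₂ t.1 s.1⟩
  exists_inv2 := fun {_ γ₂ _ _} s =>
    ⟨⟨-s.1, P.hom2_neg γ₂ s.2⟩, P.beta_mul_beta_neg γ₂ s.1, P.beta_neg_mul_beta γ₂ s.1⟩
  exists_hcomp := fun {_ _ _ _ _ y _ _ _} s t hz hz' =>
    ⟨⟨_, P.hom2_hcomp y.2 s.2 t.2 hz hz'⟩, (P.eq_hcomp_iff y.2 s.1 t.1 _).1 rfl⟩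

end Model

end

end StarDef

namespace StarDef

noncomputable section

set_option linter.unusedSectionVars false

section Transport

/-- The pullback of a representation along an isomorphism. -/
def TwoRep.comap {G H : TwoCatData.{u}} (P : TwoRep H) (F : TwoFunctor G H)
    (map_bijective : ∀ a b : G.Obj, Function.Bijective (F.map : G.Hom a b → _))
    (map₂_bijective : ∀ {a b : G.Obj} (f g : G.Hom a b),
      Function.Bijective (F.map₂ : G.Hom2 f g → _))
    (isId_iff : ∀ {a : G.Obj} (e : G.Hom a a), G.IsId e ↔ H.IsId (F.map e))
    (isComp_iff : ∀ {a b c : G.Obj} (f : G.Hom a b) (g : G.Hom b c) (h : G.Hom a c),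
      G.IsComp f g h ↔ H.IsComp (F.map f) (F.map g) (F.map h))
    (isId2_iff : ∀ {a b : G.Obj} {f : G.Hom a b} (i : G.Hom2 f f),
      G.IsId2 i ↔ H.IsId2 (F.map₂ i))
    (isVComp_iff : ∀ {a b : G.Obj} {f g h : G.Hom a b} (s : G.Hom2 f g) (t : G.Hom2 g h)
      (w : G.Hom2 f h), G.IsVComp s t w ↔ H.IsVComp (F.map₂ s) (F.map₂ t) (F.map₂ w))
    (isHComp_iff : ∀ {a b c : G.Obj} {f f' : G.Hom a b} {g g' : G.Hom b c} {p p' : G.Hom a c}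
      (s : G.Hom2 f f') (t : G.Hom2 g g') (w : G.Hom2 p p'),
      G.IsHComp s t w ↔ H.IsHComp (F.map₂ s) (F.map₂ t) (F.map₂ w)) : TwoRep G where
  Mon a := P.Mon (F.obj a)
  mon a := P.mon (F.obj a)
  act f := P.act (F.map f)
  beta s := P.beta (F.map₂ s)
  act_injective f f' h := (map_bijective _ _).1 (P.act_injective _ _ h)
  beta_injective s s' h := (map₂_bijective _ _).1 (P.beta_injective _ _ h)
  comm s := P.comm (F.map₂ s)
  isId_iff e := (isId_iff e).trans (P.isId_iff _)
  isComp_iff f g h := (isComp_iff f g h).trans (P.isComp_iff _ _ _)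
  isId2_iff i := (isId2_iff i).trans (P.isId2_iff _)
  isVComp_iff s t w := (isVComp_iff s t w).trans (P.isVComp_iff _ _ _)
  isHComp_iff s t w := (isHComp_iff s t w).trans (P.isHComp_iff _ _ _)
  exists_id a := by
    obtain ⟨e, he⟩ := P.exists_id (F.obj a)
    obtain ⟨e, rfl⟩ := (map_bijective a a).2 e
    exact ⟨e, he⟩
  exists_comp {a b c} f g := by
    obtain ⟨e, he⟩ := P.exists_comp (F.map f) (F.map g)
    obtain ⟨e, rfl⟩ := (map_bijective a c).2 e
    exact ⟨e, he⟩
  exists_inv {a b} f := by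
    obtain ⟨e, he⟩ := P.exists_inv (F.map f)
    obtain ⟨e, rfl⟩ := (map_bijective b a).2 e
    exact ⟨e, he⟩
  exists_id2 f := by
    obtain ⟨e, he⟩ := P.exists_id2 (F.map f)
    obtain ⟨e, rfl⟩ := (map₂_bijective f f).2 e
    exact ⟨e, he⟩
  exists_vcomp {a b f g h} s t := by
    obtain ⟨e, he⟩ := P.exists_vcomp (F.map₂ s) (F.map₂ t)
    obtain ⟨e, rfl⟩ := (map₂_bijective f h).2 e
    exact ⟨e, he⟩
  exists_inv2 {a b f g} s := by
    obtain ⟨e, he⟩ := P.exists_inv2 (F.map₂ s)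
    obtain ⟨e, rfl⟩ := (map₂_bijective g f).2 e
    exact ⟨e, he⟩
  exists_hcomp {a b c f f' g g' p p'} s t hp hp' := by
    obtain ⟨e, he⟩ := P.exists_hcomp (F.map₂ s) (F.map₂ t) ((isComp_iff _ _ _).1 hp)
      ((isComp_iff _ _ _).1 hp')
    obtain ⟨e, rfl⟩ := (map₂_bijective p p').2 e
    exact ⟨e, he⟩

end Transport

section Operations

variable {k : Type u} [Field k] {X : TopCat.{u}} (Ψ : PseudoTensorCat.{u, v} k X)

/-- Renaming the arguments of an operation along a bijection. -/
def MultiOp.rename {I J : Type} {S T : Sh k X} (e : I ≃ J)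
    (f : MultiOp (fun _ : I => S) T ⊤) : MultiOp (fun _ : J => S) T ⊤ :=
  ⟨fun V => (f.1 V).domDomCongr e, fun V W h a => f.2 V W h (fun i => a (e i))⟩

theorem PseudoTensorCat.rename_mem {I J : Type} [Finite I] [Finite J] {S T : Ψ.Obj} (e : I ≃ J)
    {f : MultiOp (fun _ : I => Ψ.sh S) (Ψ.sh T) ⊤} (hf : f ∈ Ψ.ops (fun _ : I => S) T ⊤) :
    f.rename e ∈ Ψ.ops (fun _ : J => S) T ⊤ := by
  let un : ∀ i, Unique {j : J // e.symm j = i} := fun i =>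
    { default := ⟨e i, by simp⟩
      uniq := fun l => Subtype.ext (e.symm_apply_eq.1 l.2) }
  exact Ψ.comp_mem e.symm (fun _ => S) (fun _ => S) T ⊤ f
    (fun i => letI := un i; MultiOp.unary _ (𝟙 (Ψ.sh S)) ⊤) hf
    (fun i => letI := un i; Ψ.id_mem S ⊤)

theorem PseudoTensorCat.postcomp_mem {J : Type} [Finite J] {S T N : Ψ.Obj}
    {f : MultiOp (fun _ : J => Ψ.sh S) (Ψ.sh T) ⊤} (hf : f ∈ Ψ.ops (fun _ : J => S) T ⊤)
    {φ : Ψ.sh T ⟶ Ψ.sh N}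
    (hφ : MultiOp.unary (Fin 1) φ ⊤ ∈ Ψ.ops (fun _ : Fin 1 => T) N ⊤) :
    MultiOp.postcomp φ f ∈ Ψ.ops (fun _ : J => S) N ⊤ := by
  let e : ∀ i : Fin 1, J ≃ {_j : J // (0 : Fin 1) = i} := fun i =>
    (Equiv.subtypeUnivEquiv fun _ => Subsingleton.elim _ _).symm
  exact Ψ.comp_mem (fun _ : J => (0 : Fin 1)) (fun _ => S) (fun _ => T) N ⊤
    (MultiOp.unary (Fin 1) φ ⊤) (fun i => f.rename (e i)) hφ (fun i => Ψ.rename_mem (e i) hf)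

theorem PseudoTensorCat.unary_comp_mem {S T N : Ψ.Obj} {φ : Ψ.sh S ⟶ Ψ.sh T}
    {ψ : Ψ.sh T ⟶ Ψ.sh N} (hφ : MultiOp.unary (Fin 1) φ ⊤ ∈ Ψ.ops (fun _ : Fin 1 => S) T ⊤)
    (hψ : MultiOp.unary (Fin 1) ψ ⊤ ∈ Ψ.ops (fun _ : Fin 1 => T) N ⊤) :
    MultiOp.unary (Fin 1) (φ ≫ ψ) ⊤ ∈ Ψ.ops (fun _ : Fin 1 => S) N ⊤ :=
  Ψ.postcomp_mem hφ hψ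

theorem PseudoTensorCat.tensorSheafMk_mem (L : Ψ.Obj) {V : Type u} [AddCommGroup V] [Module k V]
    [Module.Finite k V] (v : V) :
    MultiOp.unary (Fin 1) (tensorSheafMk v (Ψ.sh L) ≫ (Ψ.tensIso L V).inv) ⊤ ∈
      Ψ.ops (fun _ : Fin 1 => L) (Ψ.tens L V) ⊤ := by
  have h := Ψ.unary_comp_mem (Ψ.tensUnitInv_mem L)
    (Ψ.tensMap_mem L k V (LinearMap.toSpanSingleton k V v))
  have e : tensorSheafMk (1 : k) (Ψ.sh L) ≫
      tensorSheafMap (LinearMap.toSpanSingleton k V v) (Ψ.sh L) = tensorSheafMk v (Ψ.sh L) := by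
    apply ObjectProperty.hom_ext
    ext U x
    show (LinearMap.toSpanSingleton k V v 1) ⊗ₜ x = v ⊗ₜ x
    simp
  rw [Category.assoc, Iso.inv_hom_id_assoc, ← Category.assoc, e] at h
  exact h

theorem PseudoTensorCat.coord_mem (L : Ψ.Obj) {V : Type u} [AddCommGroup V] [Module k V]
    [Module.Finite k V] (l : V →ₗ[k] k) {J : Type} [Finite J] {S : Ψ.Obj}
    {f : MultiOp (fun _ : J => Ψ.sh S) (tensorSheaf V (Ψ.sh L)) ⊤}
    (hf : f ∈ Ψ.tensorOps (fun _ : J => S) L V) :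
    MultiOp.postcomp (tensorSheafMap l (Ψ.sh L) ≫ tensorSheafUnit (Ψ.sh L)) f ∈
      Ψ.ops (fun _ : J => S) L ⊤ := by
  have h := Ψ.postcomp_mem hf (Ψ.unary_comp_mem (Ψ.tensMap_mem L V k l) (Ψ.tensUnit_mem L))
  have e : MultiOp.postcomp (((Ψ.tensIso L V).hom ≫ tensorSheafMap l (Ψ.sh L) ≫
      (Ψ.tensIso L k).inv) ≫ (Ψ.tensIso L k).hom ≫ tensorSheafUnit (Ψ.sh L))
      (MultiOp.postcomp (Ψ.tensIso L V).inv f) =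
      MultiOp.postcomp ((Ψ.tensIso L V).inv ≫ ((Ψ.tensIso L V).hom ≫
        tensorSheafMap l (Ψ.sh L) ≫ (Ψ.tensIso L k).inv) ≫ (Ψ.tensIso L k).hom ≫
          tensorSheafUnit (Ψ.sh L)) f := rfl
  rw [e] at h
  simpa using h

theorem PseudoTensorCat.mk_mem (L : Ψ.Obj) {V : Type u} [AddCommGroup V] [Module k V]
    [Module.Finite k V] (v : V) {J : Type} [Finite J] {S : Ψ.Obj}
    {f : MultiOp (fun _ : J => Ψ.sh S) (Ψ.sh L) ⊤} (hf : f ∈ Ψ.ops (fun _ : J => S) L ⊤) :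
    MultiOp.postcomp (tensorSheafMk v (Ψ.sh L)) f ∈ Ψ.tensorOps (fun _ : J => S) L V :=
  Ψ.postcomp_mem hf (Ψ.tensorSheafMk_mem L v)

end Operations

section Reduction

variable {k : Type u} [Field k] {R : Type u} [CommRing R] [Algebra k R] [IsLocalRing R]

variable (k R) in
theorem exists_retraction : ∃ p : R →ₗ[k] IsLocalRing.maximalIdeal R,
    ∀ r : IsLocalRing.maximalIdeal R, p r = r := by
  obtain ⟨p, hp⟩ := LinearMap.exists_leftInverse_of_injective
    ((IsLocalRing.maximalIdeal R).subtype.restrictScalars k)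
    (LinearMap.ker_eq_bot.2 Subtype.val_injective)
  exact ⟨p, fun r => LinearMap.congr_fun hp r⟩

theorem reduce_eq_zero_iff {E : Type u} [AddCommGroup E] [Module k E] {x : R ⊗[k] E} :
    reduce k R E x = 0 ↔ x ∈ LinearMap.range (LinearMap.rTensor E
      ((IsLocalRing.maximalIdeal R).subtype.restrictScalars k)) := by
  have h := rTensor_exact E (f := (IsLocalRing.maximalIdeal R).subtype.restrictScalars k)
    (g := (Ideal.Quotient.mkₐ k (IsLocalRing.maximalIdeal R)).toLinearMap)
    (fun r => ⟨fun hr => ⟨⟨r, Ideal.Quotient.eq_zero_iff_mem.1 hr⟩, rfl⟩, by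
      rintro ⟨r, rfl⟩
      exact Ideal.Quotient.eq_zero_iff_mem.2 r.2⟩)
    (Ideal.Quotient.mk_surjective)
  exact h x

theorem sum_basis_coord {E : Type u} [AddCommGroup E] [Module k E] {ι : Type} [Fintype ι]
    (b : Module.Basis ι k (IsLocalRing.maximalIdeal R)) {p : R →ₗ[k] IsLocalRing.maximalIdeal R}
    (hp : ∀ r : IsLocalRing.maximalIdeal R, p r = r) (y : IsLocalRing.maximalIdeal R ⊗[k] E) :
    ∑ i, (b i : R) ⊗ₜ[k] TensorProduct.lid k E (LinearMap.rTensor E (b.coord i ∘ₗ p)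
      (LinearMap.rTensor E ((IsLocalRing.maximalIdeal R).subtype.restrictScalars k) y)) =
      LinearMap.rTensor E ((IsLocalRing.maximalIdeal R).subtype.restrictScalars k) y := by
  induction y using TensorProduct.induction_on with
  | zero => simp
  | add y z hy hz =>
    simp only [map_add, TensorProduct.tmul_add, Finset.sum_add_distrib]
    rw [hy, hz]
  | tmul r e =>
    have h1 : ∑ i, b.coord i r • (b i : R) = r := by
      have h2 := congrArg ((IsLocalRing.maximalIdeal R).subtype.restrictScalars k) (b.sum_repr r)
      rw [map_sum] at h2
      exact h2
    simp only [LinearMap.rTensor_tmul, LinearMap.comp_apply, LinearMap.restrictScalars_apply,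
      Submodule.subtype_apply, hp, TensorProduct.lid_tmul, TensorProduct.tmul_smul]
    simp only [TensorProduct.smul_tmul', ← TensorProduct.sum_tmul]
    rw [h1]

end Reduction

section ToOp

variable {k : Type u} [Field k] {X : TopCat.{u}} {Ψ : PseudoTensorCat.{u, v} k X}
variable (A : AlgebraIn Ψ) (R : Type u) [CommRing R] [Algebra k R] [IsLocalRing R]
  [Module.Finite k R]

/-- Cochains with coefficients in the maximal ideal. -/
abbrev CochainR (n : ℕ) : Type u := A.Cochain n ⊗[k] (IsLocalRing.maximalIdeal R)

/-- The canonical map from cochains with coefficients in the maximal ideal to operations. -/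
def toOpR (n : ℕ) : CochainR A R n →ₗ[k]
    MultiOp (fun _ : Fin n => A.sheaf) (tensorSheaf R A.sheaf) ⊤ :=
  TensorProduct.lift (cochainTmul A R n)

/-- The values on sections over `V` of the operation given by a cochain. -/
def cval {n : ℕ} (z : CochainR A R n) (V : Opens X) :
    MultilinearMap k (fun _ : Fin n => sec A.sheaf V) (R ⊗[k] sec A.sheaf V) :=
  evalR A R (toOpR A R n z) V

theorem cval_tmul {n : ℕ} (c : A.Cochain n) (r : IsLocalRing.maximalIdeal R) (V : Opens X)
    (a : Fin n → sec A.sheaf V) : cval A R (c ⊗ₜ r) V a = (r : R) ⊗ₜ c.1.at V a := rfl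

theorem cval_zero {n : ℕ} (V : Opens X) : cval A R (0 : CochainR A R n) V = 0 := by
  rw [cval, map_zero]
  rfl

theorem cval_add {n : ℕ} (z w : CochainR A R n) (V : Opens X) :
    cval A R (z + w) V = cval A R z V + cval A R w V := by
  rw [cval, map_add]
  rfl

theorem cval_smul {n : ℕ} (c : k) (z : CochainR A R n) (V : Opens X) :
    cval A R (c • z) V = c • cval A R z V := by
  rw [cval, map_smul]
  rfl

theorem cval_sum {n : ℕ} {ι : Type} (s : Finset ι) (z : ι → CochainR A R n) (V : Opens X)
    (a : Fin n → sec A.sheaf V) :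
    cval A R (∑ i ∈ s, z i) V a = ∑ i ∈ s, cval A R (z i) V a := by
  classical
  induction s using Finset.induction_on with
  | empty => rw [Finset.sum_empty, Finset.sum_empty, cval_zero, zero_apply]
  | insert j s hj ih =>
    rw [Finset.sum_insert hj, Finset.sum_insert hj, cval_add, add_apply, ih]

variable {A R}

theorem multiOp_ext {n : ℕ} {f g : MultiOp (fun _ : Fin n => A.sheaf) (tensorSheaf R A.sheaf) ⊤}
    (h : ∀ V a, evalR A R f V a = evalR A R g V a) : f = g := by
  apply Subtype.ext
  funext V
  exact MultilinearMap.ext (h V.1)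

instance : Module.Finite k (IsLocalRing.maximalIdeal R) :=
  Module.Finite.of_injective ((IsLocalRing.maximalIdeal R).subtype.restrictScalars k)
    Subtype.val_injective

theorem cval_injective {n : ℕ} {z : CochainR A R n} (h : ∀ V a, cval A R z V a = 0) : z = 0 := by
  obtain ⟨p, hp⟩ := exists_retraction k R
  let b := Module.finBasis k (IsLocalRing.maximalIdeal R)
  obtain ⟨c, rfl⟩ := TensorProduct.eq_repr_basis_right b z
  have hc : c = 0 := by
    ext1 i
    refine AlgebraIn.Cochain.ext fun V a => ?_
    have h1 := h V a
    rw [Finsupp.sum, cval_sum] at h1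
    have h2 := congrArg (fun t => TensorProduct.lid k _
      (LinearMap.rTensor (sec A.sheaf V) (b.coord i ∘ₗ p) t)) h1
    simp only [cval_tmul, map_sum, LinearMap.rTensor_tmul, TensorProduct.lid_tmul,
      LinearMap.comp_apply, hp, Module.Basis.coord_apply, Module.Basis.repr_self, map_zero] at h2
    rw [Finset.sum_eq_single i] at h2
    · rw [Finsupp.single_eq_same, one_smul] at h2
      exact h2
    · intro j _ hj
      simp [hj]
    · intro hi
      rw [Finsupp.notMem_support_iff.1 hi]
      simp
      rfl
  simp [hc]

theorem reduce_cval {n : ℕ} (z : CochainR A R n) (V : Opens X) (a : Fin n → sec A.sheaf V) :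
    reduce k R _ (cval A R z V a) = 0 := by
  induction z using TensorProduct.induction_on with
  | zero => simp [cval_zero]
  | add z w hz hw => rw [cval_add, add_apply, map_add, hz, hw, add_zero]
  | tmul c r =>
    rw [cval_tmul]
    exact reduce_eq_zero_iff.2 ⟨r ⊗ₜ c.1.at V a, rfl⟩

theorem toOpR_mem {n : ℕ} (z : CochainR A R n) :
    toOpR A R n z ∈ Ψ.tensorOps (fun _ : Fin n => A.obj) A.obj R := by
  induction z using TensorProduct.induction_on with
  | zero => rw [map_zero]; exact Submodule.zero_mem _
  | add z w hz hw => rw [map_add]; exact Submodule.add_mem _ hz hw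
  | tmul c r => exact Ψ.mk_mem A.obj (r : R) c.2

theorem exists_toOpR {n : ℕ} {f : MultiOp (fun _ : Fin n => A.sheaf) (tensorSheaf R A.sheaf) ⊤}
    (hf : f ∈ Ψ.tensorOps (fun _ : Fin n => A.obj) A.obj R)
    (h : ∀ V a, reduce k R _ (evalR A R f V a) = 0) : ∃ z, toOpR A R n z = f := by
  obtain ⟨p, hp⟩ := exists_retraction k R
  let b := Module.finBasis k (IsLocalRing.maximalIdeal R)
  let l : Fin _ → R →ₗ[k] k := fun i => b.coord i ∘ₗ p
  refine ⟨∑ i, (⟨_, Ψ.coord_mem A.obj (l i) hf⟩ : A.Cochain n) ⊗ₜ b i, multiOp_ext fun V a => ?_⟩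
  have h1 : evalR A R (toOpR A R n (∑ i,
      (⟨_, Ψ.coord_mem A.obj (l i) hf⟩ : A.Cochain n) ⊗ₜ b i)) V a =
      ∑ i, (b i : R) ⊗ₜ[k] TensorProduct.lid k _ (LinearMap.rTensor _ (l i) (evalR A R f V a)) := by
    show cval A R _ V a = _
    rw [cval_sum]
    rfl
  rw [h1]
  obtain ⟨y, hy⟩ := reduce_eq_zero_iff.1 (h V a)
  rw [← hy]
  exact sum_basis_coord b hp y

end ToOp

end

end StarDef

namespace StarDef

noncomputable section

namespace AlgebraIn

variable {k : Type u} [Field k] {X : TopCat.{u}} {Ψ : PseudoTensorCat.{u, v} k X}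
variable {A : AlgebraIn Ψ} {V : Opens X}

theorem at_sum {n : ℕ} {ι : Type} (s : Finset ι) (f : ι → A.Cochain n)
    (a : Fin n → sec A.sheaf V) : (∑ i ∈ s, f i).1.at V a = ∑ i ∈ s, (f i).1.at V a := by
  classical
  induction s using Finset.induction_on with
  | empty => rfl
  | insert j s hj ih => rw [Finset.sum_insert hj, Finset.sum_insert hj, at_add, ih]

theorem preLie_apply {p q n : ℕ} (h : p + q = n + 1) (f : A.Cochain p) (g : A.Cochain q)
    (a : Fin n → sec A.sheaf V) : (preLie p q n h f g).1.at V a =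
      ∑ i : Fin p, (-1 : k) ^ (i.1 * (q + 1)) • (insert h i f g).1.at V a := by
  have : preLie p q n h f g = ∑ i : Fin p, (-1 : k) ^ (i.1 * (q + 1)) • insert h i f g := by
    simp only [preLie, LinearMap.sum_apply, LinearMap.smul_apply]
    rfl
  rw [this, at_sum]
  rfl

theorem gerst_apply {p q n : ℕ} (h : p + q = n + 1) (f : A.Cochain p) (g : A.Cochain q)
    (a : Fin n → sec A.sheaf V) : (gerst p q n h f g).1.at V a =
      (preLie p q n h f g).1.at V a -
        (-1 : k) ^ ((p + 1) * (q + 1)) • (preLie q p n (by omega) g f).1.at V a := rfl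

theorem insert_one (c : A.Cochain 1) {q n : ℕ} (h : 1 + q = n + 1) (d : A.Cochain q)
    (a : Fin n → sec A.sheaf V) :
    (insert h 0 c d).1.at V a = c.1.at V ![d.1.at V fun i => a ⟨i.1, by omega⟩] := by
  rw [insert_apply]
  congr 1
  funext j
  fin_cases j
  simp

theorem insert_two_zero (c : A.Cochain 2) {q n : ℕ} (h : 2 + q = n + 1) (d : A.Cochain q)
    (a : Fin n → sec A.sheaf V) : (insert h 0 c d).1.at V a =
      c.1.at V ![d.1.at V fun i => a ⟨i.1, by omega⟩, a ⟨q, by omega⟩] := by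
  rw [insert_apply]
  congr 1
  funext j
  fin_cases j <;> simp

theorem insert_two_one (c : A.Cochain 2) {q n : ℕ} (h : 2 + q = n + 1) (d : A.Cochain q)
    (a : Fin n → sec A.sheaf V) : (insert h 1 c d).1.at V a =
      c.1.at V ![a ⟨0, by omega⟩, d.1.at V fun i => a ⟨1 + i.1, by omega⟩] := by
  rw [insert_apply]
  congr 1
  funext j
  fin_cases j <;> simp

theorem const_vec {E : Type u} (a : E) : (fun _ : Fin 1 => a) = ![a] := by
  funext i
  simp

theorem vec_init {E : Type u} (a b c : E) :
    (fun i : Fin 2 => ![a, b, c] ⟨i.1, by omega⟩) = ![a, b] := by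
  funext i
  fin_cases i <;> rfl

theorem vec_tail {E : Type u} (a b c : E) :
    (fun i : Fin 2 => ![a, b, c] ⟨1 + i.1, by omega⟩) = ![b, c] := by
  funext i
  fin_cases i <;> rfl

variable (a b c : sec A.sheaf V)

theorem gerst_one_one (x y : A.Cochain 1) : (gerst 1 1 1 rfl x y).1.at V ![a] =
    x.1.at V ![y.1.at V ![a]] - y.1.at V ![x.1.at V ![a]] := by
  rw [gerst_apply, preLie_apply, preLie_apply]
  simp [insert_one]
  rw [const_vec a, show (-1 : k) ^ 4 = 1 by norm_num, one_smul]

theorem gerst_one_zero (x : A.Cochain 1) (t : A.Cochain 0) (e : Fin 0 → sec A.sheaf V) :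
    (gerst 1 0 0 rfl x t).1.at V e = x.1.at V ![t.1.at V e] := by
  rw [gerst_apply, preLie_apply, preLie_apply]
  simp [insert_one]

theorem gerst_zero_one (x : A.Cochain 1) (t : A.Cochain 0) (e : Fin 0 → sec A.sheaf V) :
    (gerst 0 1 0 rfl t x).1.at V e = -x.1.at V ![t.1.at V e] := by
  rw [gerst_apply, preLie_apply, preLie_apply]
  simp [insert_one]

theorem gerst_one_two (x : A.Cochain 1) (g : A.Cochain 2) :
    (gerst 1 2 2 rfl x g).1.at V ![a, b] = x.1.at V ![g.1.at V ![a, b]] -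
      g.1.at V ![x.1.at V ![a], b] - g.1.at V ![a, x.1.at V ![b]] := by
  rw [gerst_apply, preLie_apply, preLie_apply]
  simp [insert_one, insert_two_zero, insert_two_one]
  rw [const_vec a, const_vec b, show (-1 : k) ^ 6 = 1 by norm_num, one_smul, one_smul, sub_sub]

theorem gerst_two_one (x : A.Cochain 1) (g : A.Cochain 2) :
    (gerst 2 1 2 rfl g x).1.at V ![a, b] = g.1.at V ![x.1.at V ![a], b] +
      g.1.at V ![a, x.1.at V ![b]] - x.1.at V ![g.1.at V ![a, b]] := by
  rw [gerst_apply, preLie_apply, preLie_apply]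
  simp [insert_one, insert_two_zero, insert_two_one]
  rw [const_vec a, const_vec b, show (-1 : k) ^ 6 = 1 by norm_num, one_smul]

theorem gerst_two_zero (g : A.Cochain 2) (t : A.Cochain 0) :
    (gerst 2 0 1 rfl g t).1.at V ![a] = g.1.at V ![t.1.at V ![], a] -
      g.1.at V ![a, t.1.at V ![]] := by
  rw [gerst_apply, preLie_apply, preLie_apply]
  simp [insert_two_zero, insert_two_one]
  rw [← sub_eq_add_neg]
  congr 5 <;> exact Subsingleton.elim _ _

theorem gerst_two_two (f g : A.Cochain 2) :
    (gerst 2 2 3 rfl f g).1.at V ![a, b, c] =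
      f.1.at V ![g.1.at V ![a, b], c] - f.1.at V ![a, g.1.at V ![b, c]] +
      (g.1.at V ![f.1.at V ![a, b], c] - g.1.at V ![a, f.1.at V ![b, c]]) := by
  rw [gerst_apply, preLie_apply, preLie_apply]
  simp [insert_two_zero, insert_two_one]
  rw [vec_init, vec_tail, show (-1 : k) ^ 3 = -1 by norm_num, show (-1 : k) ^ 9 = -1 by norm_num]
  simp only [neg_smul, one_smul]
  abel

end AlgebraIn

end

end StarDef

namespace StarDef

noncomputable section

set_option linter.unusedSectionVars false
set_option linter.unusedSimpArgs false

section Extension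

variable {k : Type u} [Field k] (R : Type u) [CommRing R] [Algebra k R]
variable {E : Type u} [AddCommGroup E] [Module k E]

theorem extLin_tmul (f : MultilinearMap k (fun _ : Fin 1 => E) (R ⊗[k] E)) (r : R) (a : E) :
    extLin R f (r ⊗ₜ a) = r • f ![a] := by
  rw [extLin, LinearMap.liftBaseChange_tmul]
  congr 1
  show f (fun _ => a) = f ![a]
  rw [AlgebraIn.const_vec a]

theorem extBilin_tmul (f : MultilinearMap k (fun _ : Fin 2 => E) (R ⊗[k] E)) (r s : R) (a b : E) :
    extBilin R f (r ⊗ₜ a) (s ⊗ₜ b) = (r * s) • f ![a, b] := by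
  rw [extBilin, LinearMap.liftBaseChange_tmul, LinearMap.smul_apply, mul_smul]
  congr 1

/-- The `R`-linear extension, as a linear map. -/
def extLinₗ : MultilinearMap k (fun _ : Fin 1 => E) (R ⊗[k] E) →ₗ[k] Module.End k (R ⊗[k] E) where
  toFun f := (extLin R f).restrictScalars k
  map_add' f g := by
    apply TensorProduct.ext'
    intro r a
    simp [extLin_tmul]
  map_smul' c f := by
    apply TensorProduct.ext'
    intro r a
    simp [extLin_tmul, smul_comm r c]

/-- The `R`-bilinear extension, as a linear map. -/
def extBilinₗ : MultilinearMap k (fun _ : Fin 2 => E) (R ⊗[k] E) →ₗ[k]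
    R ⊗[k] E →ₗ[k] R ⊗[k] E →ₗ[k] R ⊗[k] E where
  toFun f := (LinearMap.restrictScalarsₗ k R _ _ k ∘ₗ (extBilin R f).restrictScalars k)
  map_add' f g := by
    apply TensorProduct.ext'
    intro r a
    apply TensorProduct.ext'
    intro s b
    simp [extBilin_tmul]
  map_smul' c f := by
    apply TensorProduct.ext'
    intro r a
    apply TensorProduct.ext'
    intro s b
    simp [extBilin_tmul, smul_comm (r * s) c]

theorem extLinₗ_tmul (f : MultilinearMap k (fun _ : Fin 1 => E) (R ⊗[k] E)) (r : R) (a : E) :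
    extLinₗ R f (r ⊗ₜ a) = r • f ![a] := extLin_tmul R f r a

theorem extBilinₗ_tmul (f : MultilinearMap k (fun _ : Fin 2 => E) (R ⊗[k] E)) (r s : R)
    (a b : E) : extBilinₗ R f (r ⊗ₜ a) (s ⊗ₜ b) = (r * s) • f ![a, b] :=
  extBilin_tmul R f r s a b

end Extension

section Pointwise

variable {k : Type u} [Field k] {X : TopCat.{u}} {Ψ : PseudoTensorCat.{u, v} k X}
variable (A : AlgebraIn Ψ) (R : Type u) [CommRing R] [Algebra k R] [IsLocalRing R]
  [Module.Finite k R] (V : Opens X)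

/-- `Γ(V; A ⊗_k R)`. -/
abbrev secR : Type u := R ⊗[k] sec A.sheaf V

/-- `cval` as a linear map. -/
def cvalₗ (n : ℕ) : CochainR A R n →ₗ[k]
    MultilinearMap k (fun _ : Fin n => sec A.sheaf V) (secR A R V) where
  toFun z := cval A R z V
  map_add' z w := cval_add A R z w V
  map_smul' c z := cval_smul A R c z V

/-- Nullary cochains as sections. -/
def val₀ : CochainR A R 0 →ₗ[k] secR A R V where
  toFun z := cval A R z V ![]
  map_add' z w := by rw [cval_add]; rfl
  map_smul' c z := by rw [cval_smul]; rfl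

/-- The endomorphism given by a unary cochain. -/
def lin₁ : CochainR A R 1 →ₗ[k] Module.End k (secR A R V) := extLinₗ R ∘ₗ cvalₗ A R V 1

/-- The bilinear map given by a binary cochain. -/
def bil₂ : CochainR A R 2 →ₗ[k] secR A R V →ₗ[k] secR A R V →ₗ[k] secR A R V :=
  extBilinₗ R ∘ₗ cvalₗ A R V 2

/-- The product of `A` as an operation with values in `A ⊗_k R`. -/
def mulOp : MultiOp (fun _ : Fin 2 => A.sheaf) (tensorSheaf R A.sheaf) ⊤ :=
  MultiOp.postcomp (tensorSheafMk (1 : R) A.sheaf) A.mul.1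

/-- The `R`-bilinear extension of the product of `A`. -/
def bilMul : secR A R V →ₗ[k] secR A R V →ₗ[k] secR A R V := extBilinₗ R (evalR A R (mulOp A R) V)

/-- The unit section. -/
def oneR : secR A R V := 1 ⊗ₜ res A.sheaf le_top A.one

variable {A R V}

theorem val₀_tmul (c : A.Cochain 0) (r : IsLocalRing.maximalIdeal R) :
    val₀ A R V (c ⊗ₜ r) = (r : R) ⊗ₜ c.1.at V ![] := rfl

theorem lin₁_tmul (c : A.Cochain 1) (r : IsLocalRing.maximalIdeal R) (s : R) (a : sec A.sheaf V) :
    lin₁ A R V (c ⊗ₜ r) (s ⊗ₜ a) = (s * r) ⊗ₜ c.1.at V ![a] := extLinₗ_tmul R _ s a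

theorem bil₂_tmul (c : A.Cochain 2) (r : IsLocalRing.maximalIdeal R) (s t : R)
    (a b : sec A.sheaf V) :
    bil₂ A R V (c ⊗ₜ r) (s ⊗ₜ a) (t ⊗ₜ b) = (s * t * r) ⊗ₜ c.1.at V ![a, b] :=
  extBilinₗ_tmul R _ s t a b

theorem bilMul_tmul (s t : R) (a b : sec A.sheaf V) :
    bilMul A R V (s ⊗ₜ a) (t ⊗ₜ b) = (s * t) ⊗ₜ A.mul.1.at V ![a, b] :=
  (extBilinₗ_tmul R _ s t a b).trans (by
    show (s * t * 1) ⊗ₜ[k] A.mul.1.at V ![a, b] = _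
    rw [mul_one])

variable (A R) in
/-- The bracket of cochains with coefficients. -/
def brR (p q n : ℕ) (h : p + q = n + 1) :
    CochainR A R p →ₗ[k] CochainR A R q →ₗ[k] CochainR A R n :=
  (hochschildR A R).br p q n h

variable (A R) in
/-- The differential `g⁻¹ → g⁰`. -/
def d₀ : CochainR A R 0 →ₗ[k] CochainR A R 1 := (hochschildR A R).d 0

variable (A R) in
/-- The differential `g⁰ → g¹`. -/
def d₁ : CochainR A R 1 →ₗ[k] CochainR A R 2 := (hochschildR A R).d 1

variable (A R) in
/-- The differential `g¹ → g²`. -/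
def d₂ : CochainR A R 2 →ₗ[k] CochainR A R 3 := (hochschildR A R).d 2

theorem brR_tmul {p q n : ℕ} (h : p + q = n + 1) (c : A.Cochain p) (c' : A.Cochain q)
    (r r' : IsLocalRing.maximalIdeal R) : brR A R p q n h (c ⊗ₜ r) (c' ⊗ₜ r') =
      AlgebraIn.gerst p q n h c c' ⊗ₜ idealMul k _ r r' := rfl

theorem d₀_tmul (c : A.Cochain 0) (r : IsLocalRing.maximalIdeal R) :
    d₀ A R (c ⊗ₜ r) = AlgebraIn.gerst 2 0 1 rfl A.mul c ⊗ₜ r := rfl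

theorem d₁_tmul (c : A.Cochain 1) (r : IsLocalRing.maximalIdeal R) :
    d₁ A R (c ⊗ₜ r) = AlgebraIn.gerst 2 1 2 rfl A.mul c ⊗ₜ r := rfl

theorem d₂_tmul (c : A.Cochain 2) (r : IsLocalRing.maximalIdeal R) :
    d₂ A R (c ⊗ₜ r) = AlgebraIn.gerst 2 2 3 rfl A.mul c ⊗ₜ r := rfl

theorem coe_idealMul (r r' : IsLocalRing.maximalIdeal R) :
    (idealMul k (IsLocalRing.maximalIdeal R) r r' : R) = r * r' := rfl

theorem lin₁_brR (x y : CochainR A R 1) (a : secR A R V) :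
    lin₁ A R V (brR A R 1 1 1 rfl x y) a =
      lin₁ A R V x (lin₁ A R V y a) - lin₁ A R V y (lin₁ A R V x a) := by
  induction x using TensorProduct.induction_on with
  | zero => simp
  | add x x' hx hx' =>
    simp only [map_add, LinearMap.add_apply, hx, hx']
    abel
  | tmul c r =>
  induction y using TensorProduct.induction_on with
  | zero => simp
  | add x x' hx hx' =>
    simp only [map_add, LinearMap.add_apply, hx, hx']
    abel
  | tmul c' r' =>
  induction a using TensorProduct.induction_on with
  | zero => simp
  | add x x' hx hx' =>
    simp only [map_add, hx, hx']
    abel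
  | tmul s a =>
    simp only [brR_tmul, lin₁_tmul, coe_idealMul, AlgebraIn.gerst_one_one,
      TensorProduct.tmul_sub, mul_comm, mul_left_comm]

theorem val₀_brR_one_zero (x : CochainR A R 1) (t : CochainR A R 0) :
    val₀ A R V (brR A R 1 0 0 rfl x t) = lin₁ A R V x (val₀ A R V t) := by
  induction x using TensorProduct.induction_on with
  | zero => simp
  | add x x' hx hx' =>
    simp only [map_add, LinearMap.add_apply, hx, hx']
  | tmul c r =>
  induction t using TensorProduct.induction_on with
  | zero => simp
  | add x x' hx hx' =>
    simp only [map_add, LinearMap.add_apply, hx, hx']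
  | tmul c' r' =>
    simp only [brR_tmul, lin₁_tmul, val₀_tmul, coe_idealMul, AlgebraIn.gerst_one_zero,
      TensorProduct.tmul_sub, TensorProduct.tmul_add, TensorProduct.tmul_neg, mul_comm, mul_left_comm]

theorem val₀_brR_zero_one (t : CochainR A R 0) (x : CochainR A R 1) :
    val₀ A R V (brR A R 0 1 0 rfl t x) = -lin₁ A R V x (val₀ A R V t) := by
  induction x using TensorProduct.induction_on with
  | zero => simp
  | add x x' hx hx' =>
    simp only [map_add, LinearMap.add_apply, hx, hx']
    abel
  | tmul c r =>
  induction t using TensorProduct.induction_on with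
  | zero => simp
  | add x x' hx hx' =>
    simp only [map_add, LinearMap.add_apply, hx, hx']
    abel
  | tmul c' r' =>
    simp only [brR_tmul, lin₁_tmul, val₀_tmul, coe_idealMul, AlgebraIn.gerst_zero_one,
      TensorProduct.tmul_sub, TensorProduct.tmul_add, TensorProduct.tmul_neg, mul_comm, mul_left_comm]

theorem bil₂_brR_one_two (x : CochainR A R 1) (γ : CochainR A R 2) (a b : secR A R V) :
    bil₂ A R V (brR A R 1 2 2 rfl x γ) a b = bilinAd (lin₁ A R V x) (bil₂ A R V γ) a b := by
  rw [bilinAd_apply]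
  induction x using TensorProduct.induction_on with
  | zero => simp
  | add x x' hx hx' =>
    simp only [map_add, LinearMap.add_apply, hx, hx']
    abel
  | tmul c r =>
  induction γ using TensorProduct.induction_on with
  | zero => simp
  | add x x' hx hx' =>
    simp only [map_add, LinearMap.add_apply, hx, hx']
    abel
  | tmul c' r' =>
  induction a using TensorProduct.induction_on with
  | zero => simp
  | add x x' hx hx' =>
    simp only [map_add, LinearMap.add_apply, hx, hx']
    abel
  | tmul s a =>
  induction b using TensorProduct.induction_on with
  | zero => simp
  | add x x' hx hx' =>
    simp only [map_add, LinearMap.add_apply, hx, hx']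
    abel
  | tmul t b =>
    simp only [brR_tmul, lin₁_tmul, bil₂_tmul, coe_idealMul, AlgebraIn.gerst_one_two,
      TensorProduct.tmul_sub, TensorProduct.tmul_add, TensorProduct.tmul_neg, mul_comm, mul_left_comm]

theorem bil₂_brR_two_one (γ : CochainR A R 2) (x : CochainR A R 1) (a b : secR A R V) :
    bil₂ A R V (brR A R 2 1 2 rfl γ x) a b = -bilinAd (lin₁ A R V x) (bil₂ A R V γ) a b := by
  rw [bilinAd_apply]
  induction x using TensorProduct.induction_on with
  | zero => simp
  | add x x' hx hx' =>
    simp only [map_add, LinearMap.add_apply, hx, hx']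
    abel
  | tmul c r =>
  induction γ using TensorProduct.induction_on with
  | zero => simp
  | add x x' hx hx' =>
    simp only [map_add, LinearMap.add_apply, hx, hx']
    abel
  | tmul c' r' =>
  induction a using TensorProduct.induction_on with
  | zero => simp
  | add x x' hx hx' =>
    simp only [map_add, LinearMap.add_apply, hx, hx']
    abel
  | tmul s a =>
  induction b using TensorProduct.induction_on with
  | zero => simp
  | add x x' hx hx' =>
    simp only [map_add, LinearMap.add_apply, hx, hx']
    abel
  | tmul t b =>
    simp only [brR_tmul, lin₁_tmul, bil₂_tmul, coe_idealMul, AlgebraIn.gerst_two_one,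
      TensorProduct.tmul_sub, TensorProduct.tmul_add, TensorProduct.tmul_neg, mul_comm, mul_left_comm]
    abel

theorem bil₂_d₁ (x : CochainR A R 1) (a b : secR A R V) :
    bil₂ A R V (d₁ A R x) a b = -bilinAd (lin₁ A R V x) (bilMul A R V) a b := by
  rw [bilinAd_apply]
  induction x using TensorProduct.induction_on with
  | zero => simp
  | add x x' hx hx' =>
    simp only [map_add, LinearMap.add_apply, hx, hx']
    abel
  | tmul c r =>
  induction a using TensorProduct.induction_on with
  | zero => simp
  | add x x' hx hx' =>
    simp only [map_add, LinearMap.add_apply, hx, hx']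
    abel
  | tmul s a =>
  induction b using TensorProduct.induction_on with
  | zero => simp
  | add x x' hx hx' =>
    simp only [map_add, LinearMap.add_apply, hx, hx']
    abel
  | tmul t b =>
    simp only [d₁_tmul, lin₁_tmul, bil₂_tmul, bilMul_tmul, AlgebraIn.gerst_two_one,
      TensorProduct.tmul_sub, TensorProduct.tmul_add, TensorProduct.tmul_neg, mul_comm, mul_left_comm]
    abel

theorem lin₁_brR_two_zero (γ : CochainR A R 2) (t : CochainR A R 0) (a : secR A R V) :
    lin₁ A R V (brR A R 2 0 1 rfl γ t) a =
      bil₂ A R V γ (val₀ A R V t) a - bil₂ A R V γ a (val₀ A R V t) := by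
  induction γ using TensorProduct.induction_on with
  | zero => simp
  | add x x' hx hx' =>
    simp only [map_add, LinearMap.add_apply, hx, hx']
    abel
  | tmul c r =>
  induction t using TensorProduct.induction_on with
  | zero => simp
  | add x x' hx hx' =>
    simp only [map_add, LinearMap.add_apply, hx, hx']
    abel
  | tmul c' r' =>
  induction a using TensorProduct.induction_on with
  | zero => simp
  | add x x' hx hx' =>
    simp only [map_add, LinearMap.add_apply, hx, hx']
    abel
  | tmul s a =>
    simp only [brR_tmul, lin₁_tmul, bil₂_tmul, val₀_tmul, coe_idealMul, AlgebraIn.gerst_two_zero,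
      TensorProduct.tmul_sub, TensorProduct.tmul_add, TensorProduct.tmul_neg, mul_comm, mul_left_comm]

theorem lin₁_d₀ (t : CochainR A R 0) (a : secR A R V) :
    lin₁ A R V (d₀ A R t) a =
      bilMul A R V (val₀ A R V t) a - bilMul A R V a (val₀ A R V t) := by
  induction t using TensorProduct.induction_on with
  | zero => simp
  | add x x' hx hx' =>
    simp only [map_add, LinearMap.add_apply, hx, hx']
    abel
  | tmul c r =>
  induction a using TensorProduct.induction_on with
  | zero => simp
  | add x x' hx hx' =>
    simp only [map_add, LinearMap.add_apply, hx, hx']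
    abel
  | tmul s a =>
    simp only [d₀_tmul, lin₁_tmul, bilMul_tmul, val₀_tmul, AlgebraIn.gerst_two_zero,
      TensorProduct.tmul_sub, TensorProduct.tmul_add, TensorProduct.tmul_neg, mul_comm, mul_left_comm]

theorem cval_d₂ (γ : CochainR A R 2) (a b c : sec A.sheaf V) :
    cval A R (d₂ A R γ) V ![a, b, c] =
      bilMul A R V (bil₂ A R V γ (1 ⊗ₜ a) (1 ⊗ₜ b)) (1 ⊗ₜ c) -
      bilMul A R V (1 ⊗ₜ a) (bil₂ A R V γ (1 ⊗ₜ b) (1 ⊗ₜ c)) +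
      (bil₂ A R V γ (bilMul A R V (1 ⊗ₜ a) (1 ⊗ₜ b)) (1 ⊗ₜ c) -
      bil₂ A R V γ (1 ⊗ₜ a) (bilMul A R V (1 ⊗ₜ b) (1 ⊗ₜ c))) := by
  induction γ using TensorProduct.induction_on with
  | zero => simp [cval_zero]
  | add x x' hx hx' =>
    simp only [map_add, cval_add, add_apply, LinearMap.add_apply, hx, hx']
    abel
  | tmul g r =>
    simp only [d₂_tmul, bil₂_tmul, bilMul_tmul, cval_tmul, AlgebraIn.gerst_two_two, mul_one, one_mul,
      TensorProduct.tmul_sub, TensorProduct.tmul_add, TensorProduct.tmul_neg, mul_comm, mul_left_comm]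

theorem cval_brR (γ γ' : CochainR A R 2) (a b c : sec A.sheaf V) :
    cval A R (brR A R 2 2 3 rfl γ γ') V ![a, b, c] =
      bil₂ A R V γ (bil₂ A R V γ' (1 ⊗ₜ a) (1 ⊗ₜ b)) (1 ⊗ₜ c) -
      bil₂ A R V γ (1 ⊗ₜ a) (bil₂ A R V γ' (1 ⊗ₜ b) (1 ⊗ₜ c)) +
      (bil₂ A R V γ' (bil₂ A R V γ (1 ⊗ₜ a) (1 ⊗ₜ b)) (1 ⊗ₜ c) -
      bil₂ A R V γ' (1 ⊗ₜ a) (bil₂ A R V γ (1 ⊗ₜ b) (1 ⊗ₜ c))) := by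
  induction γ using TensorProduct.induction_on with
  | zero => simp [cval_zero]
  | add x x' hx hx' =>
    simp only [map_add, cval_add, add_apply, LinearMap.add_apply, hx, hx']
    abel
  | tmul g r =>
  induction γ' using TensorProduct.induction_on with
  | zero => simp [cval_zero]
  | add x x' hx hx' =>
    simp only [map_add, cval_add, add_apply, LinearMap.add_apply, hx, hx']
    abel
  | tmul g' r' =>
    simp only [brR_tmul, coe_idealMul, bil₂_tmul, cval_tmul, AlgebraIn.gerst_two_two, mul_one, one_mul,
      TensorProduct.tmul_sub, TensorProduct.tmul_add, TensorProduct.tmul_neg, mul_comm, mul_left_comm]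

end Pointwise

end

end StarDef

namespace StarDef

noncomputable section

set_option linter.unusedSectionVars false

section Associativity

variable {k : Type u} [Field k] {R : Type u} [CommRing R] [Algebra k R]
variable {E : Type u} [AddCommGroup E] [Module k E]

theorem tmul_eq_smul_one_tmul (s : R) (a : E) : s ⊗ₜ[k] a = s • ((1 : R) ⊗ₜ[k] a) := by
  rw [TensorProduct.smul_tmul', smul_eq_mul, mul_one]

theorem bilin_assoc_of_one_tmul (B : R ⊗[k] E →ₗ[R] R ⊗[k] E →ₗ[R] R ⊗[k] E)
    (h : ∀ a b c : E, B (B (1 ⊗ₜ a) (1 ⊗ₜ b)) (1 ⊗ₜ c) = B (1 ⊗ₜ a) (B (1 ⊗ₜ b) (1 ⊗ₜ c)))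
    (x y z : R ⊗[k] E) : B (B x y) z = B x (B y z) := by
  induction x using TensorProduct.induction_on with
  | zero => simp
  | add x x' hx hx' => simp only [map_add, LinearMap.add_apply, hx, hx']
  | tmul s a =>
  induction y using TensorProduct.induction_on with
  | zero => simp
  | add x x' hx hx' => simp only [map_add, LinearMap.add_apply, hx, hx']
  | tmul t b =>
  induction z using TensorProduct.induction_on with
  | zero => simp
  | add x x' hx hx' => simp only [map_add, hx, hx']
  | tmul w c =>
    rw [tmul_eq_smul_one_tmul s, tmul_eq_smul_one_tmul t, tmul_eq_smul_one_tmul w]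
    simp only [map_smul, LinearMap.smul_apply, h]

end Associativity

section Closure

variable {k : Type u} [Field k] {X : TopCat.{u}} {Ψ : PseudoTensorCat.{u, v} k X}
variable (A : AlgebraIn Ψ) (R : Type u) [CommRing R] [Algebra k R] [IsLocalRing R]
  [Module.Finite k R]

theorem res_res {L : Sh k X} {U V W : Opens X} (h : V ≤ U) (h' : W ≤ V) (s : sec L U) :
    res L h' (res L h s) = res L (h'.trans h) s := by
  have := L.presheaf.map_comp (homOfLE h).op (homOfLE h').op
  exact (congrArg (fun t => t.hom s) this).symm

theorem res_self {L : Sh k X} {U : Opens X} (h : U ≤ U) (s : sec L U) : res L h s = s :=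
  congrArg (fun t => t.hom s) (L.presheaf.map_id (op U))

/-- A global section as a nullary cochain. -/
def sectionCochain (s : sec A.sheaf ⊤) : A.Cochain 0 :=
  ⟨⟨fun _ => MultilinearMap.constOfIsEmpty k _ (res A.sheaf le_top s),
    fun _ _ h _ => res_res le_top h s⟩, Ψ.nullary_mem _ _ _ _⟩

/-- Insertion of cochains with coefficients. -/
def insR {p q n : ℕ} (h : p + q = n + 1) (i : Fin p) :
    CochainR A R p →ₗ[k] CochainR A R q →ₗ[k] CochainR A R n :=
  TensorProduct.map₂ (AlgebraIn.insertₗ h i) (idealMul k (IsLocalRing.maximalIdeal R))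

variable {A R}

theorem insR_tmul {p q n : ℕ} (h : p + q = n + 1) (i : Fin p) (c : A.Cochain p) (c' : A.Cochain q)
    (r r' : IsLocalRing.maximalIdeal R) : insR A R h i (c ⊗ₜ r) (c' ⊗ₜ r') =
      AlgebraIn.insert h i c c' ⊗ₜ idealMul k _ r r' := rfl

variable {V : Opens X}

theorem lin₁_insR_one (x y : CochainR A R 1) (a : secR A R V) :
    lin₁ A R V (insR A R rfl 0 x y) a = lin₁ A R V x (lin₁ A R V y a) := by
  induction x using TensorProduct.induction_on with
  | zero => simp
  | add x x' hx hx' => simp only [map_add, LinearMap.add_apply, hx, hx']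
  | tmul c r =>
  induction y using TensorProduct.induction_on with
  | zero => simp
  | add x x' hx hx' => simp only [map_add, LinearMap.add_apply, hx, hx']
  | tmul c' r' =>
  induction a using TensorProduct.induction_on with
  | zero => simp
  | add x x' hx hx' => simp only [map_add, hx, hx']
  | tmul s a =>
    have h : (AlgebraIn.insert rfl 0 c c' : A.Cochain 1).1.at V ![a] =
        c.1.at V ![c'.1.at V ![a]] := by
      rw [AlgebraIn.insert_one, ← AlgebraIn.const_vec a]
    rw [insR_tmul, lin₁_tmul, lin₁_tmul, lin₁_tmul, coe_idealMul, h, mul_assoc, mul_comm (r : R)]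

theorem insert_two_zero_zero (g : A.Cochain 2) (t : A.Cochain 0) (a : sec A.sheaf V) :
    (AlgebraIn.insert (p := 2) (q := 0) (n := 1) rfl 0 g t).1.at V ![a] =
      g.1.at V ![t.1.at V ![], a] := by
  rw [AlgebraIn.insert_two_zero]
  congr 3
  exact Subsingleton.elim (α := Fin 0 → sec A.sheaf V) _ _

theorem insert_two_one_zero (g : A.Cochain 2) (t : A.Cochain 0) (a : sec A.sheaf V) :
    (AlgebraIn.insert (p := 2) (q := 0) (n := 1) rfl 1 g t).1.at V ![a] =
      g.1.at V ![a, t.1.at V ![]] := by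
  rw [AlgebraIn.insert_two_one]
  congr 4
  exact Subsingleton.elim (α := Fin 0 → sec A.sheaf V) _ _

theorem lin₁_insR_two (γ : CochainR A R 2) (t : CochainR A R 0) (a : secR A R V) :
    lin₁ A R V (insR A R (p := 2) (q := 0) (n := 1) rfl 0 γ t) a = bil₂ A R V γ (val₀ A R V t) a := by
  induction γ using TensorProduct.induction_on with
  | zero => simp
  | add x x' hx hx' => simp only [map_add, LinearMap.add_apply, hx, hx']
  | tmul c r =>
  induction t using TensorProduct.induction_on with
  | zero => simp
  | add x x' hx hx' => simp only [map_add, LinearMap.add_apply, hx, hx']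
  | tmul c' r' =>
  induction a using TensorProduct.induction_on with
  | zero => simp
  | add x x' hx hx' => simp only [map_add, hx, hx']
  | tmul s a =>
    rw [insR_tmul, lin₁_tmul, val₀_tmul, bil₂_tmul, coe_idealMul, insert_two_zero_zero,
      mul_comm (r : R), ← mul_assoc, mul_comm s]

theorem lin₁_insert_mul (t : CochainR A R 0) (a : secR A R V) :
    lin₁ A R V (LinearMap.rTensor _ (AlgebraIn.insertₗ (p := 2) (q := 0) (n := 1) rfl 0 A.mul) t) a =
      bilMul A R V (val₀ A R V t) a := by
  induction t using TensorProduct.induction_on with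
  | zero => simp
  | add x x' hx hx' => simp only [map_add, LinearMap.add_apply, hx, hx']
  | tmul c r =>
  induction a using TensorProduct.induction_on with
  | zero => simp
  | add x x' hx hx' => simp only [map_add, hx, hx']
  | tmul s a =>
    rw [LinearMap.rTensor_tmul, lin₁_tmul, val₀_tmul, bilMul_tmul, mul_comm (r : R)]
    exact congrArg _ (insert_two_zero_zero _ _ _)

theorem val₀_insert_one (x : CochainR A R 1) :
    val₀ A R V (LinearMap.rTensor _ ((AlgebraIn.insertₗ (p := 1) (q := 0) (n := 0) rfl 0).flip
      (sectionCochain A A.one)) x) = lin₁ A R V x (oneR A R V) := by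
  induction x using TensorProduct.induction_on with
  | zero => simp
  | add x x' hx hx' => simp only [map_add, LinearMap.add_apply, hx, hx']
  | tmul c r =>
    rw [LinearMap.rTensor_tmul, val₀_tmul, oneR, lin₁_tmul, one_mul]
    exact congrArg _ (AlgebraIn.insert_one c (q := 0) (n := 0) rfl (sectionCochain A A.one) ![])

theorem lin₁_insert_left_one (γ : CochainR A R 2) (a : secR A R V) :
    lin₁ A R V (LinearMap.rTensor _ ((AlgebraIn.insertₗ (p := 2) (q := 0) (n := 1) rfl 0).flip
      (sectionCochain A A.one)) γ) a = bil₂ A R V γ (oneR A R V) a := by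
  induction γ using TensorProduct.induction_on with
  | zero => simp
  | add x x' hx hx' => simp only [map_add, LinearMap.add_apply, hx, hx']
  | tmul c r =>
  induction a using TensorProduct.induction_on with
  | zero => simp
  | add x x' hx hx' => simp only [map_add, hx, hx']
  | tmul s a =>
    rw [LinearMap.rTensor_tmul, lin₁_tmul, oneR, bil₂_tmul, one_mul]
    exact congrArg _ (insert_two_zero_zero _ _ _)

theorem lin₁_insert_right_one (γ : CochainR A R 2) (a : secR A R V) :
    lin₁ A R V (LinearMap.rTensor _ ((AlgebraIn.insertₗ (p := 2) (q := 0) (n := 1) rfl 1).flip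
      (sectionCochain A A.one)) γ) a = bil₂ A R V γ a (oneR A R V) := by
  induction γ using TensorProduct.induction_on with
  | zero => simp
  | add x x' hx hx' => simp only [map_add, LinearMap.add_apply, hx, hx']
  | tmul c r =>
  induction a using TensorProduct.induction_on with
  | zero => simp
  | add x x' hx hx' => simp only [map_add, LinearMap.add_apply, hx, hx']
  | tmul s a =>
    rw [LinearMap.rTensor_tmul, lin₁_tmul, oneR, bil₂_tmul, mul_one]
    exact congrArg _ (insert_two_one_zero _ _ _)

theorem bilMul_oneR_left (a : secR A R V) : bilMul A R V (oneR A R V) a = a := by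
  induction a using TensorProduct.induction_on with
  | zero => simp
  | add x x' hx hx' => simp only [map_add, hx, hx']
  | tmul s a => rw [oneR, bilMul_tmul, one_mul, A.one_mul]

theorem bilMul_oneR_right (a : secR A R V) : bilMul A R V a (oneR A R V) = a := by
  induction a using TensorProduct.induction_on with
  | zero => simp
  | add x x' hx hx' => simp only [map_add, LinearMap.add_apply, hx, hx']
  | tmul s a => rw [oneR, bilMul_tmul, mul_one, A.mul_one]

theorem bilMul_assoc_one_tmul (a b c : sec A.sheaf V) :
    bilMul A R V (bilMul A R V (1 ⊗ₜ a) (1 ⊗ₜ b)) (1 ⊗ₜ c) =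
      bilMul A R V (1 ⊗ₜ a) (bilMul A R V (1 ⊗ₜ b) (1 ⊗ₜ c)) := by
  simp only [bilMul_tmul, A.mul_assoc, mul_one]

theorem extBilin_mulOp_add (γ : CochainR A R 2) (a b : secR A R V) :
    extBilin R (evalR A R (mulOp A R + toOpR A R 2 γ) V) a b =
      (bilMul A R V + bil₂ A R V γ) a b := by
  have h : bilMul A R V + bil₂ A R V γ =
      extBilinₗ R (evalR A R (mulOp A R + toOpR A R 2 γ) V) := (map_add (extBilinₗ R) _ _).symm
  rw [h]
  rfl

theorem mc_iff_assoc [CharZero k] (γ : CochainR A R 2) :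
    d₂ A R γ + (2⁻¹ : k) • brR A R 2 2 3 rfl γ γ = 0 ↔
      ∀ (V : Opens X) (a b c : secR A R V), (bilMul A R V + bil₂ A R V γ)
        ((bilMul A R V + bil₂ A R V γ) a b) c =
          (bilMul A R V + bil₂ A R V γ) a ((bilMul A R V + bil₂ A R V γ) b c) := by
  have key : ∀ (V : Opens X) (a b c : sec A.sheaf V),
      cval A R (d₂ A R γ + (2⁻¹ : k) • brR A R 2 2 3 rfl γ γ) V ![a, b, c] =
      (bilMul A R V + bil₂ A R V γ)
        ((bilMul A R V + bil₂ A R V γ) (1 ⊗ₜ a) (1 ⊗ₜ b)) (1 ⊗ₜ c) -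
      (bilMul A R V + bil₂ A R V γ) (1 ⊗ₜ a)
        ((bilMul A R V + bil₂ A R V γ) (1 ⊗ₜ b) (1 ⊗ₜ c)) := by
    intro V a b c
    have h2 : ∀ x : secR A R V, (2⁻¹ : k) • (x + x) = x := fun x => by
      rw [← two_smul k x, smul_smul, inv_mul_cancel₀ two_ne_zero, one_smul]
    rw [cval_add, cval_smul, add_apply, smul_apply, cval_d₂, cval_brR, h2]
    simp only [map_add, LinearMap.add_apply, bilMul_assoc_one_tmul]
    abel
  constructor
  · intro h V a b c
    simp only [← extBilin_mulOp_add]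
    refine bilin_assoc_of_one_tmul _ (fun a b c => ?_) a b c
    simp only [extBilin_mulOp_add]
    refine sub_eq_zero.1 ((key V a b c).symm.trans ?_)
    rw [h, cval_zero]
    rfl
  · intro h
    refine cval_injective fun V a => ?_
    have ha : a = ![a 0, a 1, a 2] := by
      funext i
      fin_cases i <;> rfl
    rw [ha, key, h, sub_self]

end Closure

end

end StarDef

namespace StarDef

noncomputable section

set_option linter.unusedSectionVars false

section Family

variable {k : Type u} [Field k] {X : TopCat.{u}} {Ψ : PseudoTensorCat.{u, v} k X}
variable (A : AlgebraIn Ψ) (R : Type u) [CommRing R] [Algebra k R] [IsLocalRing R]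
  [Module.Finite k R]

/-- Families of sections of `A ⊗_k R`. -/
abbrev Fam : Type u := ∀ V : Opens X, secR A R V

/-- The families of sections given by nullary cochains. -/
def fam₀ : CochainR A R 0 →ₗ[k] Fam A R := LinearMap.pi fun V => val₀ A R V

/-- The endomorphisms of families given by unary cochains. -/
def fam₁ : CochainR A R 1 →ₗ[k] Module.End k (Fam A R) where
  toFun z := LinearMap.pi fun V => lin₁ A R V z ∘ₗ LinearMap.proj V
  map_add' z w := by
    refine LinearMap.ext fun a => funext fun V => ?_
    simp
  map_smul' c z := by
    refine LinearMap.ext fun a => funext fun V => ?_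
    simp

/-- The bilinear map on families given by bilinear maps on sections. -/
def famBilin (B : ∀ V : Opens X, secR A R V →ₗ[k] secR A R V →ₗ[k] secR A R V) :
    Fam A R →ₗ[k] Fam A R →ₗ[k] Fam A R :=
  LinearMap.mk₂ k (fun a b V => B V (a V) (b V))
    (fun a a' b => funext fun V => by simp)
    (fun c a b => funext fun V => by simp)
    (fun a b b' => funext fun V => by simp)
    (fun c a b => funext fun V => by simp)

/-- The bilinear maps on families given by binary cochains. -/
def fam₂ : CochainR A R 2 →ₗ[k] Fam A R →ₗ[k] Fam A R →ₗ[k] Fam A R where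
  toFun z := famBilin A R fun V => bil₂ A R V z
  map_add' z w := LinearMap.ext fun a => LinearMap.ext fun b => funext fun V => by
    simp [famBilin]
  map_smul' c z := LinearMap.ext fun a => LinearMap.ext fun b => funext fun V => by
    simp [famBilin]

variable {A R}

theorem fam₀_injective : Function.Injective (fam₀ A R) := by
  refine (injective_iff_map_eq_zero _).2 fun z hz => cval_injective fun V a => ?_
  rw [Subsingleton.elim a ![]]
  exact congrFun hz V

theorem eq_lin₁ {z : CochainR A R 1} {V : Opens X} (a : Fin 1 → sec A.sheaf V) :
    lin₁ A R V z (1 ⊗ₜ a 0) = cval A R z V a := by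
  refine (extLinₗ_tmul R (cval A R z V) 1 (a 0)).trans ?_
  rw [one_smul]
  congr 1
  funext i
  fin_cases i
  rfl

theorem eq_bil₂ {z : CochainR A R 2} {V : Opens X} (a : Fin 2 → sec A.sheaf V) :
    bil₂ A R V z (1 ⊗ₜ a 0) (1 ⊗ₜ a 1) = cval A R z V a := by
  refine (extBilinₗ_tmul R (cval A R z V) 1 1 (a 0) (a 1)).trans ?_
  rw [mul_one, one_smul]
  congr 1
  funext i
  fin_cases i <;> rfl

/-- The family which is concentrated at `V`. -/
def famSingle (V : Opens X) (a : secR A R V) : Fam A R := by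
  classical exact Function.update 0 V a

theorem famSingle_self (V : Opens X) (a : secR A R V) : famSingle V a V = a := by
  classical exact Function.update_self ..

theorem fam₁_injective : Function.Injective (fam₁ A R) := by
  refine (injective_iff_map_eq_zero _).2 fun z hz => cval_injective fun V a => ?_
  have h : lin₁ A R V z (famSingle V (1 ⊗ₜ a 0) V) = 0 :=
    congrFun (LinearMap.congr_fun hz (famSingle V (1 ⊗ₜ a 0))) V
  rwa [famSingle_self, eq_lin₁] at h

theorem fam₂_injective : Function.Injective (fam₂ A R) := by
  refine (injective_iff_map_eq_zero _).2 fun z hz => cval_injective fun V a => ?_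
  have h : bil₂ A R V z (famSingle V (1 ⊗ₜ a 0) V) (famSingle V (1 ⊗ₜ a 1) V) = 0 :=
    congrFun (LinearMap.congr_fun (LinearMap.congr_fun hz (famSingle V (1 ⊗ₜ a 0)))
      (famSingle V (1 ⊗ₜ a 1))) V
  rwa [famSingle_self, famSingle_self, eq_bil₂] at h

theorem bil₂_twist (γ : CochainR A R 2) (x : CochainR A R 1) {V : Opens X} (a b : secR A R V) :
    bil₂ A R V (d₁ A R x + brR A R 2 1 2 rfl γ x) a b =
      -bilinAd (lin₁ A R V x) (bilMul A R V + bil₂ A R V γ) a b := by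
  rw [map_add, LinearMap.add_apply, LinearMap.add_apply, bil₂_d₁, bil₂_brR_two_one]
  simp only [bilinAd_apply, LinearMap.add_apply, map_add]
  abel

theorem lin₁_twist (γ : CochainR A R 2) (t : CochainR A R 0) {V : Opens X} (a : secR A R V) :
    lin₁ A R V (d₀ A R t + brR A R 2 0 1 rfl γ t) a =
      (bilMul A R V + bil₂ A R V γ) (val₀ A R V t) a -
        (bilMul A R V + bil₂ A R V γ) a (val₀ A R V t) := by
  rw [map_add, LinearMap.add_apply, lin₁_d₀, lin₁_brR_two_zero]
  simp only [LinearMap.add_apply]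
  abel

theorem lin₁_mem (z : CochainR A R 1) (V : Opens X) (a : secR A R V) :
    lin₁ A R V z a ∈ IsLocalRing.maximalIdeal R • (⊤ : Submodule R (secR A R V)) := by
  induction z using TensorProduct.induction_on with
  | zero => simp
  | add x x' hx hx' =>
    rw [map_add]
    exact Submodule.add_mem _ hx hx'
  | tmul c r =>
  induction a using TensorProduct.induction_on with
  | zero => simp
  | add x x' hx hx' =>
    rw [map_add]
    exact Submodule.add_mem _ hx hx'
  | tmul s a =>
    rw [lin₁_tmul, mul_comm, ← smul_eq_mul, ← TensorProduct.smul_tmul']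
    exact Submodule.smul_mem_smul r.2 trivial

theorem lin₁_mem_pow (z : CochainR A R 1) (V : Opens X) (a : secR A R V) {n : ℕ}
    (ha : a ∈ IsLocalRing.maximalIdeal R ^ n • (⊤ : Submodule R (secR A R V))) :
    lin₁ A R V z a ∈ IsLocalRing.maximalIdeal R ^ (n + 1) • (⊤ : Submodule R (secR A R V)) := by
  have h : lin₁ A R V z a ∈ Submodule.map (extLin R (cval A R z V))
      (IsLocalRing.maximalIdeal R ^ n • (⊤ : Submodule R (secR A R V))) :=
    Submodule.mem_map_of_mem (f := extLin R (cval A R z V)) ha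
  rw [Submodule.map_smul''] at h
  rw [pow_succ, ← smul_eq_mul, Submodule.smul_assoc]
  refine Submodule.smul_mono le_rfl ?_ h
  rintro _ ⟨b, -, rfl⟩
  exact lin₁_mem z V b

theorem exists_maximalIdeal_pow_eq_bot (k R : Type u) [Field k] [CommRing R] [Algebra k R]
    [IsLocalRing R] [Module.Finite k R] : ∃ N, IsLocalRing.maximalIdeal R ^ N = ⊥ := by
  have : IsArtinianRing R := IsArtinianRing.of_finite k R
  have h := IsArtinianRing.isNilpotent_jacobson_bot (R := R)
  rw [IsLocalRing.jacobson_eq_maximalIdeal ⊥ bot_ne_top] at h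
  exact h

theorem fam₁_nilpotent : ∃ N, LinearMap.range (fam₁ A R) ^ N = ⊥ := by
  obtain ⟨N, hN⟩ := exists_maximalIdeal_pow_eq_bot k R
  have key : ∀ n, ∀ f ∈ LinearMap.range (fam₁ A R) ^ n, ∀ a V,
      f a V ∈ IsLocalRing.maximalIdeal R ^ n • (⊤ : Submodule R (secR A R V)) := by
    intro n
    induction n with
    | zero => simp
    | succ n ih =>
      intro f hf a V
      rw [pow_succ'] at hf
      refine Submodule.mul_induction_on hf ?_ ?_
      · rintro _ ⟨z, rfl⟩ g hg
        exact lin₁_mem_pow z V _ (ih g hg a V)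
      · intro f g hf hg
        exact Submodule.add_mem _ hf hg
  refine ⟨N, (Submodule.eq_bot_iff _).2 fun f hf => LinearMap.ext fun a => funext fun V => ?_⟩
  have h := key N f hf a V
  rw [hN, Submodule.bot_smul] at h
  exact h

variable (A R)

/-- The action of the cochains of `A` with coefficients in the maximal ideal on families of
sections of `A ⊗_k R`. -/
def famModel [CharZero k] : Model (hochschildR A R) (Fam A R) where
  ι₀ := fam₀ A R
  ι₁ := fam₁ A R
  ι₂ := fam₂ A R
  inj₀ := fam₀_injective
  inj₁ := fam₁_injective
  inj₂ := fam₂_injective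
  m := famBilin A R fun V => bilMul A R V
  u := fun V => oneR A R V
  unit_mul a := funext fun V => bilMul_oneR_left (a V)
  mul_unit a := funext fun V => bilMul_oneR_right (a V)
  comp_mem x y := ⟨insR A R (p := 1) (q := 1) (n := 1) rfl 0 x y,
    LinearMap.ext fun a => funext fun V => lin₁_insR_one x y (a V)⟩
  app_mem x t := ⟨brR A R 1 0 0 rfl x t, funext fun V => val₀_brR_one_zero x t⟩
  app_one_mem x := ⟨_, funext fun V => val₀_insert_one x⟩
  left_one_mem γ := ⟨_, fun a => funext fun V => lin₁_insert_left_one γ (a V)⟩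
  right_one_mem γ := ⟨_, fun a => funext fun V => lin₁_insert_right_one γ (a V)⟩
  left_mem γ t := ⟨LinearMap.rTensor _ (AlgebraIn.insertₗ (p := 2) (q := 0) (n := 1) rfl 0 A.mul) t +
      insR A R (p := 2) (q := 0) (n := 1) rfl 0 γ t, fun a => funext fun V => by
    refine (congrFun (LinearMap.congr_fun (map_add (fam₁ A R) _ _) a) V).trans ?_
    exact congrArg₂ (· + ·) (lin₁_insert_mul t (a V)) (lin₁_insR_two γ t (a V))⟩
  nil := fam₁_nilpotent
  br₁₁ x y := LinearMap.ext fun a => funext fun V => lin₁_brR x y (a V)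
  br₁₀ x t := funext fun V => val₀_brR_one_zero x t
  br₀₁ t x := funext fun V => val₀_brR_zero_one t x
  br₁₂ x γ := LinearMap.ext fun a => LinearMap.ext fun b => funext fun V =>
    bil₂_brR_one_two x γ (a V) (b V)
  d₁ γ x := LinearMap.ext fun a => LinearMap.ext fun b => funext fun V =>
    bil₂_twist γ x (a V) (b V)
  d₀ γ t a := funext fun V => lin₁_twist γ t (a V)
  mc_iff γ := by
    refine (mc_iff_assoc γ).trans ⟨fun h a b c => funext fun V => h V (a V) (b V) (c V),
      fun h V a b c => ?_⟩
    rw [← famSingle_self V a, ← famSingle_self V b, ← famSingle_self V c]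
    exact congrFun (h (famSingle V a) (famSingle V b) (famSingle V c)) V

end Family

end

end StarDef

namespace StarDef

noncomputable section

set_option linter.unusedSectionVars false

section Functor

variable {k : Type u} [Field k] {X : TopCat.{u}} {Ψ : PseudoTensorCat.{u, v} k X}
variable (A : AlgebraIn Ψ) (R : Type u) [CommRing R] [Algebra k R] [IsLocalRing R]
  [Module.Finite k R]

theorem expNil_apply {D : Module.End k (Fam A R)} (hD : IsNilpotent D) {V : Opens X}
    {D' : secR A R V → secR A R V} (h : ∀ a, D a V = D' (a V)) (a : Fam A R) :
    expNil k D a V = expNil k D' (a V) := by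
  have hiter : ∀ n, (D^[n] a) V = D'^[n] (a V) := by
    intro n
    induction n with
    | zero => rfl
    | succ n ih => rw [Function.iterate_succ_apply', Function.iterate_succ_apply', h, ih]
  obtain ⟨N, hN⟩ := hD
  have h0 : ∀ n, N ≤ n → D^[n] a = 0 := fun n hn => by
    rw [← Module.End.pow_apply, pow_eq_zero_of_le hn hN]
    rfl
  rw [expNil_eq_sum h0, expNil_eq_sum (N := N) fun n hn => by rw [← hiter, h0 n hn]; rfl,
    Finset.sum_apply]
  exact Finset.sum_congr rfl fun n _ => by rw [Pi.smul_apply, hiter]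

/-- The family of restrictions of a global section. -/
def famOf (e : secR A R ⊤) : Fam A R := fun _ => LinearMap.lTensor R (res A.sheaf le_top) e

variable {A R}

theorem famOf_top (e : secR A R ⊤) : famOf A R e ⊤ = e := by
  have h : res A.sheaf (le_top : (⊤ : Opens X) ≤ ⊤) = LinearMap.id :=
    LinearMap.ext fun s => res_self _ s
  rw [famOf, h, LinearMap.lTensor_id]
  rfl

theorem famOf_injective : Function.Injective (famOf A R) := fun e e' h => by
  rw [← famOf_top e, h, famOf_top]

theorem lTensor_res_smul {V W : Opens X} (h : W ≤ V) (r : R) (x : secR A R V) :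
    LinearMap.lTensor R (res A.sheaf h) (r • x) = r • LinearMap.lTensor R (res A.sheaf h) x :=
  map_smul ((res A.sheaf h).baseChange R) r x

theorem res_evalR {n : ℕ} (f : MultiOp (fun _ : Fin n => A.sheaf) (tensorSheaf R A.sheaf) ⊤)
    {V W : Opens X} (h : W ≤ V) (a : Fin n → sec A.sheaf V) :
    LinearMap.lTensor R (res A.sheaf h) (evalR A R f V a) =
      evalR A R f W fun i => res A.sheaf h (a i) :=
  f.2 ⟨V, le_top⟩ ⟨W, le_top⟩ h a

theorem res_extLin (f : MultiOp (fun _ : Fin 1 => A.sheaf) (tensorSheaf R A.sheaf) ⊤)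
    {V W : Opens X} (h : W ≤ V) (x : secR A R V) :
    LinearMap.lTensor R (res A.sheaf h) (extLin R (evalR A R f V) x) =
      extLin R (evalR A R f W) (LinearMap.lTensor R (res A.sheaf h) x) := by
  induction x using TensorProduct.induction_on with
  | zero => simp
  | add x x' hx hx' => simp only [map_add, hx, hx']
  | tmul s a =>
    rw [LinearMap.lTensor_tmul, extLin_tmul, extLin_tmul, lTensor_res_smul, res_evalR]
    congr 2
    funext i
    fin_cases i
    rfl

theorem res_extBilin (f : MultiOp (fun _ : Fin 2 => A.sheaf) (tensorSheaf R A.sheaf) ⊤)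
    {V W : Opens X} (h : W ≤ V) (x y : secR A R V) :
    LinearMap.lTensor R (res A.sheaf h) (extBilin R (evalR A R f V) x y) =
      extBilin R (evalR A R f W) (LinearMap.lTensor R (res A.sheaf h) x)
        (LinearMap.lTensor R (res A.sheaf h) y) := by
  induction x using TensorProduct.induction_on with
  | zero => simp
  | add x x' hx hx' => simp only [map_add, LinearMap.add_apply, hx, hx']
  | tmul s a =>
  induction y using TensorProduct.induction_on with
  | zero => simp
  | add x x' hx hx' => simp only [map_add, hx, hx']
  | tmul t b =>
    rw [LinearMap.lTensor_tmul, LinearMap.lTensor_tmul, extBilin_tmul, extBilin_tmul,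
      lTensor_res_smul, res_evalR]
    congr 2
    funext i
    fin_cases i <;> rfl

theorem famOf_prod (m : StarProduct A R) (a b : secR A R ⊤) (V : Opens X) :
    famOf A R (m.prod ⊤ a b) V = m.prod V (famOf A R a V) (famOf A R b V) :=
  res_extBilin m.op le_top a b

theorem famOf_lin {m₁ m₂ : StarProduct A R} (φ : StarHom m₁ m₂) (a : secR A R ⊤) (V : Opens X) :
    famOf A R (φ.lin ⊤ a) V = φ.lin V (famOf A R a V) :=
  res_extLin φ.op le_top a

theorem famOf_one_add (s : CochainR A R 0) :
    famOf A R (1 ⊗ₜ A.one + val₀ A R ⊤ s) = (fun V => oneR A R V) + fam₀ A R s := by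
  funext V
  refine (map_add (LinearMap.lTensor R (res A.sheaf le_top)) _ _).trans ?_
  refine congrArg₂ (· + ·) rfl ((res_evalR (toOpR A R 0 s) le_top ![]).trans ?_)
  exact congrArg (cval A R s V) (Subsingleton.elim _ _)

theorem val₀_mem (s : CochainR A R 0) : val₀ A R ⊤ s ∈
    LinearMap.range (LinearMap.rTensor (sec A.sheaf ⊤)
      ((IsLocalRing.maximalIdeal R).subtype.restrictScalars k)) :=
  reduce_eq_zero_iff.1 (reduce_cval s ⊤ ![])

theorem exists_val₀ {e : secR A R ⊤} (he : e ∈ LinearMap.range (LinearMap.rTensor (sec A.sheaf ⊤)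
    ((IsLocalRing.maximalIdeal R).subtype.restrictScalars k))) : ∃ s, val₀ A R ⊤ s = e := by
  obtain ⟨y, rfl⟩ := he
  induction y using TensorProduct.induction_on with
  | zero => exact ⟨0, by simp⟩
  | add y z hy hz =>
    obtain ⟨s, hs⟩ := hy
    obtain ⟨t, ht⟩ := hz
    exact ⟨s + t, by rw [map_add, map_add, hs, ht]⟩
  | tmul r a => exact ⟨sectionCochain A a ⊗ₜ r, congrArg (fun b => (r : R) ⊗ₜ[k] b) (res_self _ a)⟩

variable (A R) in
/-- The identity as an operation with values in `A ⊗_k R`. -/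
def idOp : MultiOp (fun _ : Fin 1 => A.sheaf) (tensorSheaf R A.sheaf) ⊤ :=
  MultiOp.postcomp (tensorSheafMk (1 : R) A.sheaf) (MultiOp.unary (Fin 1) (𝟙 A.sheaf) ⊤)

theorem evalR_idOp (V : Opens X) (a : sec A.sheaf V) : evalR A R (idOp A R) V ![a] = 1 ⊗ₜ a := rfl

theorem idOp_mem : idOp A R ∈ Ψ.tensorOps (fun _ : Fin 1 => A.obj) A.obj R :=
  Ψ.mk_mem A.obj (1 : R) (Ψ.id_mem (I := Fin 1) A.obj ⊤)

theorem mulOp_mem : mulOp A R ∈ Ψ.tensorOps (fun _ : Fin 2 => A.obj) A.obj R :=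
  Ψ.mk_mem A.obj (1 : R) A.mul.2

theorem extLin_idOp_add (n : CochainR A R 1) (V : Opens X) (a : secR A R V) :
    extLin R (evalR A R (idOp A R + toOpR A R 1 n) V) a = a + lin₁ A R V n a := by
  have h : extLinₗ R (evalR A R (idOp A R) V) = 1 := by
    apply TensorProduct.ext'
    intro r a
    rw [extLinₗ_tmul, evalR_idOp, ← tmul_eq_smul_one_tmul]
    rfl
  have h' : extLinₗ R (evalR A R (idOp A R + toOpR A R 1 n) V) = 1 + lin₁ A R V n := by
    rw [← h]
    exact map_add (extLinₗ R) _ _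
  exact LinearMap.congr_fun h' a

theorem vec_two {E : Type u} (a : Fin 2 → E) : a = ![a 0, a 1] := by
  funext i
  fin_cases i <;> rfl

theorem vec_one {E : Type u} (a : Fin 1 → E) : a = ![a 0] := by
  funext i
  fin_cases i
  rfl

theorem exists_toOpR_starProduct (m : StarProduct A R) :
    ∃ γ, toOpR A R 2 γ = m.op - mulOp A R := by
  refine exists_toOpR (Submodule.sub_mem _ m.mem mulOp_mem) fun V a => ?_
  rw [vec_two a]
  refine (map_sub (reduce k R _) (evalR A R m.op V ![a 0, a 1])
    (evalR A R (mulOp A R) V ![a 0, a 1])).trans ?_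
  rw [m.reduces]
  exact sub_self _

theorem exists_toOpR_starHom {m₁ m₂ : StarProduct A R} (φ : StarHom m₁ m₂) :
    ∃ n, idOp A R + toOpR A R 1 n = φ.op := by
  obtain ⟨n, hn⟩ := exists_toOpR (Submodule.sub_mem _ φ.mem idOp_mem) fun V a => by
    rw [vec_one a]
    refine (map_sub (reduce k R _) (evalR A R φ.op V ![a 0])
      (evalR A R (idOp A R) V ![a 0])).trans ?_
    rw [φ.reduces]
    exact sub_self _
  exact ⟨n, by rw [hn]; abel⟩

variable [CharZero k]

theorem famModel_mul (m : StarProduct A R) {γ : CochainR A R 2}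
    (h : toOpR A R 2 γ = m.op - mulOp A R) (a b : Fam A R) (V : Opens X) :
    (famModel A R).mul γ a b V = m.prod V (a V) (b V) := by
  have h' : mulOp A R + toOpR A R 2 γ = m.op := by
    rw [h]
    abel
  have e := extBilin_mulOp_add γ (a V) (b V)
  rw [h'] at e
  exact e.symm

theorem exists_objMC (m : StarProduct A R) : ∃ γ : {γ // (hochschildR A R).IsMC γ},
    toOp A R 2 γ.1 = m.op - mulOp A R := by
  obtain ⟨γ, hγ⟩ := exists_toOpR_starProduct m
  refine ⟨⟨γ, ((famModel A R).mc_iff γ).2 fun a b c => funext fun V => ?_⟩, hγ⟩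
  have e := famModel_mul m (γ := γ) hγ
  refine (e _ c V).trans (Eq.trans ?_ (e a _ V).symm)
  refine Eq.trans (congrArg (fun z => m.prod V z (c V)) (e a b V)) ?_
  exact (m.assoc V (a V) (b V) (c V)).trans
    (congrArg (fun z => m.prod V (a V) z) (e b c V).symm)

/-- The Maurer–Cartan element `m' - m` of a star product. -/
def objMC (m : StarProduct A R) : {γ // (hochschildR A R).IsMC γ} := (exists_objMC m).choose

theorem toOp_objMC (m : StarProduct A R) : toOp A R 2 (objMC m).1 = m.op - mulOp A R :=
  (exists_objMC m).choose_spec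

theorem mul_objMC (m : StarProduct A R) (a b : Fam A R) (V : Opens X) :
    (famModel A R).mul (objMC m).1 a b V = m.prod V (a V) (b V) :=
  famModel_mul m (toOp_objMC m) a b V

theorem objMC_injective : Function.Injective (objMC (A := A) (R := R)) := fun m m' h => by
  have h1 := toOp_objMC m
  rw [h, toOp_objMC] at h1
  exact StarProduct.ext (sub_left_injective h1).symm

/-- The star product `m + γ`. -/
def starProductOf (γ : CochainR A R 2)
    (h : d₂ A R γ + (2⁻¹ : k) • brR A R 2 2 3 rfl γ γ = 0) : StarProduct A R where
  op := mulOp A R + toOpR A R 2 γ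
  mem := Submodule.add_mem _ mulOp_mem (toOpR_mem γ)
  reduces V a b := by
    refine (map_add (reduce k R _) (evalR A R (mulOp A R) V ![a, b])
      (cval A R γ V ![a, b])).trans ?_
    rw [reduce_cval, add_zero]
    rfl
  assoc V x y z := by
    simp only [extBilin_mulOp_add]
    exact (mc_iff_assoc γ).1 h V x y z

theorem objMC_surjective : Function.Surjective (objMC (A := A) (R := R)) := by
  rintro ⟨γ, hγ⟩
  refine ⟨starProductOf γ hγ, Subtype.ext ((famModel A R).inj₂ ?_)⟩
  refine LinearMap.ext fun a => LinearMap.ext fun b => funext fun V => ?_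
  have h : (famModel A R).mul (objMC (starProductOf γ hγ)).1 a b V = (famModel A R).mul γ a b V :=
    (mul_objMC _ a b V).trans (extBilin_mulOp_add γ (a V) (b V))
  exact add_left_cancel h

section Hom

variable {m₁ m₂ m₃ : StarProduct A R}

theorem exists_mapMC (φ : StarHom m₁ m₂) : ∃ x : (hochschildR A R).C 1,
    ∀ a V, (famModel A R).phi x a V = φ.lin V (a V) := by
  obtain ⟨n, hn⟩ := exists_toOpR_starHom φ
  obtain ⟨x, hx⟩ := (famModel A R).exists_phi n
  refine ⟨x, fun a V => ?_⟩
  rw [hx, StarHom.lin, ← hn, extLin_idOp_add]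
  rfl

/-- The logarithm of a 1-morphism. -/
def mapMC (φ : StarHom m₁ m₂) : (hochschildR A R).C 1 := (exists_mapMC φ).choose

theorem phi_mapMC (φ : StarHom m₁ m₂) (a : Fam A R) (V : Opens X) :
    (famModel A R).phi (mapMC φ) a V = φ.lin V (a V) := (exists_mapMC φ).choose_spec a V

theorem gauge_mapMC (φ : StarHom m₁ m₂) :
    (hochschildR A R).gauge (mapMC φ) (objMC m₁).1 = (objMC m₂).1 :=
  ((famModel A R).gauge_eq_iff _ _ _).2 fun a b => funext fun V => by
    rw [phi_mapMC, mul_objMC, mul_objMC, phi_mapMC, phi_mapMC]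
    exact φ.map_mul V (a V) (b V)

theorem mapMC_injective : Function.Injective (mapMC (m₁ := m₁) (m₂ := m₂)) := fun φ ψ h => by
  refine StarHom.ext (multiOp_ext fun V a => ?_)
  have e : φ.lin V (1 ⊗ₜ a 0) = ψ.lin V (1 ⊗ₜ a 0) := by
    rw [← famSingle_self V ((1 : R) ⊗ₜ[k] a 0), ← phi_mapMC, ← phi_mapMC, h]
  rw [StarHom.lin, StarHom.lin, extLin_tmul, extLin_tmul, one_smul, one_smul, ← vec_one] at e
  exact e

theorem exists_phi_apply (x : (hochschildR A R).C 1) : ∃ n : CochainR A R 1,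
    ∀ a V, (famModel A R).phi x a V = extLin R (evalR A R (idOp A R + toOpR A R 1 n) V) (a V) := by
  obtain ⟨n, hn⟩ := (famModel A R).exists_phi_eq_add x
  refine ⟨n, fun a V => ?_⟩
  rw [hn]
  exact (extLin_idOp_add n V (a V)).symm

/-- The 1-morphism given by `1 + n`. -/
def starHomOf (n : CochainR A R 1)
    (h : ∀ (V : Opens X) (x y : secR A R V),
      extLin R (evalR A R (idOp A R + toOpR A R 1 n) V) (m₁.prod V x y) =
        m₂.prod V (extLin R (evalR A R (idOp A R + toOpR A R 1 n) V) x)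
          (extLin R (evalR A R (idOp A R + toOpR A R 1 n) V) y)) : StarHom m₁ m₂ where
  op := idOp A R + toOpR A R 1 n
  mem := Submodule.add_mem _ idOp_mem (toOpR_mem n)
  reduces V a := by
    refine (map_add (reduce k R _) (evalR A R (idOp A R) V ![a]) (cval A R n V ![a])).trans ?_
    rw [reduce_cval, add_zero]
    rfl
  map_mul := h

theorem mapMC_surjective {x : (hochschildR A R).C 1}
    (hx : (hochschildR A R).gauge x (objMC m₁).1 = (objMC m₂).1) :
    ∃ φ : StarHom m₁ m₂, mapMC φ = x := by
  obtain ⟨n, hn⟩ := exists_phi_apply x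
  refine ⟨starHomOf n fun V a b => ?_, (famModel A R).phi_injective
    (LinearMap.ext fun a => funext fun V => ?_)⟩
  · have h := congrFun (((famModel A R).gauge_eq_iff x _ _).1 hx (famSingle V a)
      (famSingle V b)) V
    rw [hn, mul_objMC, mul_objMC, hn, hn] at h
    simpa only [famSingle_self] using h
  · rw [phi_mapMC, hn]
    rfl

end Hom

end Functor

end

end StarDef

namespace StarDef

noncomputable section

set_option linter.unusedSectionVars false

section Functor

variable {k : Type u} [Field k] [CharZero k] {X : TopCat.{u}} {Ψ : PseudoTensorCat.{u, v} k X}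
variable {A : AlgebraIn Ψ} {R : Type u} [CommRing R] [Algebra k R] [IsLocalRing R]
  [Module.Finite k R] {m₁ m₂ m₃ : StarProduct A R}

/-- The element `exp (-t)` of the algebra of a star product. -/
def expNeg (m : StarProduct A R) (t : (hochschildR A R).C 0) : Fam A R :=
  (famModel A R).beta (objMC m) t

theorem expNeg_injective (m : StarProduct A R) : Function.Injective (expNeg m) :=
  (famModel A R).beta_injective (objMC m)

theorem mul_objMC_famOf (m : StarProduct A R) (a b : secR A R ⊤) :
    (famModel A R).mul (objMC m).1 (famOf A R a) (famOf A R b) = famOf A R (m.prod ⊤ a b) :=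
  funext fun V => (mul_objMC m _ _ V).trans (famOf_prod m a b V).symm

theorem phi_famOf (φ : StarHom m₁ m₂) (a : secR A R ⊤) :
    (famModel A R).phi (mapMC φ) (famOf A R a) = famOf A R (φ.lin ⊤ a) :=
  funext fun V => (phi_mapMC φ _ V).trans (famOf_lin φ a V).symm

theorem hom2_mapMC_iff (φ ψ : StarHom m₁ m₂) {t : (hochschildR A R).C 0} {e : secR A R ⊤}
    (h : expNeg m₂ t = famOf A R e) :
    bch k (hochschildR A R).br₀ ((hochschildR A R).dTwist (objMC m₂).1 t) (mapMC φ) = mapMC ψ ↔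
      ∀ (V : Opens X) (x : secR A R V), m₂.prod V (φ.lin V x) (famOf A R e V) =
        m₂.prod V (famOf A R e V) (ψ.lin V x) := by
  refine ((famModel A R).hom2_iff (objMC m₂) (objMC m₁) _ _ t).trans ?_
  have h1 : (∀ a : Fam A R, (famModel A R).mul (objMC m₂).1 ((famModel A R).phi (mapMC φ) a)
      (expNeg m₂ t) = (famModel A R).mul (objMC m₂).1 (expNeg m₂ t)
        ((famModel A R).phi (mapMC ψ) a)) ↔ _ := Iff.rfl
  refine h1.trans ?_
  rw [h]
  constructor
  · intro h V x
    have h2 := congrFun (h (famSingle V x)) V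
    rw [mul_objMC, mul_objMC, phi_mapMC, phi_mapMC] at h2
    simpa only [famSingle_self] using h2
  · intro h a
    funext V
    rw [mul_objMC, mul_objMC, phi_mapMC, phi_mapMC, h]

theorem exists_map₂MC {φ ψ : StarHom m₁ m₂} (b : StarHom2 φ ψ) :
    ∃ t, expNeg m₂ t = famOf A R b.elt := by
  obtain ⟨s, hs⟩ := exists_val₀ b.mem
  obtain ⟨t, ht⟩ := (famModel A R).exists_beta (objMC m₂) s
  refine ⟨t, ht.trans ?_⟩
  have h := famOf_one_add s
  rw [hs, add_sub_cancel] at h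
  exact h.symm

/-- The logarithm of a 2-morphism. -/
def map₂MC {φ ψ : StarHom m₁ m₂} (b : StarHom2 φ ψ) : (hochschildR A R).C 0 :=
  (exists_map₂MC b).choose

theorem expNeg_map₂MC {φ ψ : StarHom m₁ m₂} (b : StarHom2 φ ψ) :
    expNeg m₂ (map₂MC b) = famOf A R b.elt := (exists_map₂MC b).choose_spec

theorem hom2_map₂MC {φ ψ : StarHom m₁ m₂} (b : StarHom2 φ ψ) :
    bch k (hochschildR A R).br₀ ((hochschildR A R).dTwist (objMC m₂).1 (map₂MC b)) (mapMC φ) =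
      mapMC ψ :=
  (hom2_mapMC_iff φ ψ (expNeg_map₂MC b)).2 b.comm

theorem map₂MC_injective (φ ψ : StarHom m₁ m₂) :
    Function.Injective (map₂MC (φ := φ) (ψ := ψ)) := fun b b' h => by
  refine StarHom2.ext (famOf_injective ?_)
  rw [← expNeg_map₂MC, ← expNeg_map₂MC, h]

theorem exists_expNeg_eq_famOf (m : StarProduct A R) (t : (hochschildR A R).C 0) :
    ∃ e : secR A R ⊤, expNeg m t = famOf A R e ∧ e - 1 ⊗ₜ A.one ∈
      LinearMap.range (LinearMap.rTensor (sec A.sheaf ⊤)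
        ((IsLocalRing.maximalIdeal R).subtype.restrictScalars k)) := by
  obtain ⟨s, hs⟩ := (famModel A R).exists_beta_eq_add (objMC m) t
  refine ⟨1 ⊗ₜ A.one + val₀ A R ⊤ s, hs.trans (famOf_one_add s).symm, ?_⟩
  rw [add_sub_cancel_left]
  exact val₀_mem s

theorem map₂MC_surjective (φ ψ : StarHom m₁ m₂) {t : (hochschildR A R).C 0}
    (ht : bch k (hochschildR A R).br₀ ((hochschildR A R).dTwist (objMC m₂).1 t) (mapMC φ) =
      mapMC ψ) : ∃ b : StarHom2 φ ψ, map₂MC b = t := by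
  obtain ⟨e, he, hmem⟩ := exists_expNeg_eq_famOf m₂ t
  exact ⟨⟨e, hmem, (hom2_mapMC_iff φ ψ he).1 ht⟩,
    expNeg_injective m₂ ((expNeg_map₂MC _).trans he.symm)⟩

theorem expNeg_eq_one_iff {m : StarProduct A R} {t : (hochschildR A R).C 0} {e : secR A R ⊤}
    (h : expNeg m t = famOf A R e) :
    t = 0 ↔ ∀ x, m.prod ⊤ e x = x ∧ m.prod ⊤ x e = x := by
  have h0 : ∀ {t : (hochschildR A R).C 0} {e : secR A R ⊤}, expNeg m t = famOf A R e → t = 0 →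
      ∀ x, m.prod ⊤ e x = x ∧ m.prod ⊤ x e = x := by
    intro t e h ht x
    have h1 := ((famModel A R).eq_zero_iff₀ (objMC m) t).1 ht
    have hl : ∀ y : (famModel A R).Alg (objMC m), (famModel A R).beta (objMC m) t * y = y :=
      fun y => by rw [h1, one_mul]
    have hr : ∀ y : (famModel A R).Alg (objMC m), y * (famModel A R).beta (objMC m) t = y :=
      fun y => by rw [h1, mul_one]
    have h2 : (famModel A R).mul (objMC m).1 (expNeg m t) (famOf A R x) = famOf A R x :=
      hl (famOf A R x)
    have h3 : (famModel A R).mul (objMC m).1 (famOf A R x) (expNeg m t) = famOf A R x :=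
      hr (famOf A R x)
    rw [h, mul_objMC_famOf] at h2 h3
    exact ⟨famOf_injective h2, famOf_injective h3⟩
  refine ⟨h0 h, fun hx => expNeg_injective m ?_⟩
  obtain ⟨e', he', -⟩ := exists_expNeg_eq_famOf m 0
  rw [h, he', ← (hx e').1, (h0 he' rfl e).2]

theorem isId_iff (φ : StarHom m₁ m₁) : (∀ V x, φ.lin V x = x) ↔ mapMC φ = 0 := by
  rw [(famModel A R).eq_zero_iff₁]
  constructor
  · intro h a
    funext V
    rw [phi_mapMC, h]
  · intro h V x
    have h1 := congrFun (h (famSingle V x)) V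
    rwa [phi_mapMC, famSingle_self] at h1

theorem isComp_iff (φ : StarHom m₁ m₂) (ψ : StarHom m₂ m₃) (χ : StarHom m₁ m₃) :
    (∀ V x, χ.lin V x = ψ.lin V (φ.lin V x)) ↔
      mapMC χ = bch k (hochschildR A R).br₀ (mapMC ψ) (mapMC φ) := by
  rw [(famModel A R).eq_bch_iff]
  constructor
  · intro h a
    funext V
    rw [phi_mapMC, phi_mapMC, phi_mapMC, h]
  · intro h V x
    have h1 := congrFun (h (famSingle V x)) V
    rwa [phi_mapMC, phi_mapMC, phi_mapMC, famSingle_self] at h1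

theorem isVComp_iff {φ ψ χ : StarHom m₁ m₂} (b : StarHom2 φ ψ) (b' : StarHom2 ψ χ)
    (c : StarHom2 φ χ) : c.elt = m₂.prod ⊤ b.elt b'.elt ↔
      map₂MC c = bch k ((hochschildR A R).brTwist (objMC m₂).1) (map₂MC b') (map₂MC b) := by
  refine Iff.trans ?_ ((famModel A R).eq_bch_iff₀ (objMC m₂) _ _ _).symm
  have h : expNeg m₂ (map₂MC c) = (famModel A R).mul (objMC m₂).1 (expNeg m₂ (map₂MC b))
      (expNeg m₂ (map₂MC b')) ↔ _ := Iff.rfl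
  refine Iff.trans ?_ h
  rw [expNeg_map₂MC, expNeg_map₂MC, expNeg_map₂MC, mul_objMC_famOf, famOf_injective.eq_iff]

theorem isHComp_iff {φ φ' : StarHom m₁ m₂} {ψ ψ' : StarHom m₂ m₃} {χ χ' : StarHom m₁ m₃}
    (b : StarHom2 φ φ') (b' : StarHom2 ψ ψ') (c : StarHom2 χ χ') :
    c.elt = m₃.prod ⊤ (ψ.lin ⊤ b.elt) b'.elt ↔
      map₂MC c = bch k ((hochschildR A R).brTwist (objMC m₃).1) (map₂MC b')
        (expNil k ((hochschildR A R).br 1 0 0 rfl (mapMC ψ)) (map₂MC b)) := by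
  refine Iff.trans ?_ ((famModel A R).eq_hcomp_iff (gauge_mapMC ψ) _ _ _).symm
  have h : expNeg m₃ (map₂MC c) = (famModel A R).mul (objMC m₃).1
      ((famModel A R).phi (mapMC ψ) (expNeg m₂ (map₂MC b))) (expNeg m₃ (map₂MC b')) ↔ _ := Iff.rfl
  refine Iff.trans ?_ h
  rw [expNeg_map₂MC, expNeg_map₂MC, expNeg_map₂MC, phi_famOf, mul_objMC_famOf,
    famOf_injective.eq_iff]

variable (A R)

/-- The isomorphism `Def(A)(R) → MC²(g)`. -/
def toMC2 : TwoFunctor (Def A R) (hochschildR A R).MC2 where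
  obj m := objMC m
  map φ := ⟨mapMC φ, gauge_mapMC φ⟩
  map₂ b := ⟨map₂MC b, hom2_map₂MC b⟩
  map_id e := (isId_iff e).1
  map_comp f g h := (isComp_iff f g h).1
  map₂_id i := (expNeg_eq_one_iff (expNeg_map₂MC i)).2
  map₂_vcomp s t w := (isVComp_iff s t w).1
  map₂_hcomp s t w _ _ := (isHComp_iff s t w).1

theorem toMC2_isIso : (toMC2 A R).IsIso where
  obj_bijective := ⟨objMC_injective, objMC_surjective⟩
  map_bijective _ _ := ⟨fun _ _ h => mapMC_injective (congrArg Subtype.val h), fun x => by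
    obtain ⟨φ, hφ⟩ := mapMC_surjective x.2
    exact ⟨φ, Subtype.ext hφ⟩⟩
  map₂_bijective f g := ⟨fun _ _ h => map₂MC_injective f g (congrArg Subtype.val h), fun t => by
    obtain ⟨b, hb⟩ := map₂MC_surjective f g t.2
    exact ⟨b, Subtype.ext hb⟩⟩

theorem def_isTwoGroupoid : (Def A R).IsTwoGroupoid :=
  ((famModel A R).mc2Rep.comap (toMC2 A R) (toMC2_isIso A R).map_bijective
    (fun f g => (toMC2_isIso A R).map₂_bijective f g)
    (fun e => isId_iff e) (fun f g h => isComp_iff f g h)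
    (fun i => (expNeg_eq_one_iff (expNeg_map₂MC i)).symm) (fun s t w => isVComp_iff s t w)
    (fun s t w => isHComp_iff s t w)).isTwoGroupoid

variable {A R}

theorem phi_apply_eq_expNil (x : (hochschildR A R).C 1) (V : Opens X) (a : Fam A R) :
    (famModel A R).phi x a V = expNil k (extLin R (evalR A R (toOp A R 1 x) V)) (a V) := by
  rw [Model.phi, ← expNil_eq_nexp ((famModel A R).isNilpotent₁ x)]
  exact expNil_apply A R ((famModel A R).isNilpotent₁ x) (fun _ => rfl) a

theorem expNeg_mul_eq_expNil (m : StarProduct A R) (t : (hochschildR A R).C 0) (a : Fam A R)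
    (V : Opens X) : m.prod V (expNeg m t V) (a V) =
      expNil k (m.prod V (-(evalR A R (toOp A R 0 t) V ![]))) (a V) := by
  have hn := ((famModel A R).isNilpotent_elt (objMC m) t).neg
  have hL : IsNilpotent (LinearMap.mulLeft k (-(famModel A R).elt (objMC m) t)) :=
    hn.map (Algebra.lmul k _)
  have h1 : ∀ a : (famModel A R).Alg (objMC m),
      expNil k (LinearMap.mulLeft k (-(famModel A R).elt (objMC m) t)) a =
        (famModel A R).beta (objMC m) t * a := fun a => by
    rw [expNil_eq_nexp hL, nexp_mulLeft hn]
    rfl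
  rw [← mul_objMC]
  refine (congrFun (h1 a) V).symm.trans ?_
  refine expNil_apply A R (D := LinearMap.mulLeft k (-(famModel A R).elt (objMC m) t)) hL
    (fun b => ?_) a
  exact mul_objMC m _ b V

theorem toMC2_extendsMu : ExtendsMu A R (toMC2 A R) where
  obj m := toOp_objMC m
  map φ V x := by
    have h := phi_apply_eq_expNil (mapMC φ) V (famSingle V x)
    rw [phi_mapMC, famSingle_self] at h
    exact h
  map₂ {_ m₂ _ _} b x := by
    have h := expNeg_mul_eq_expNil m₂ (map₂MC b) (famOf A R x) ⊤
    rw [expNeg_map₂MC, famOf_top, famOf_top] at h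
    exact h

end Functor

end

end StarDef

theorem star_products_isomorphic_to_MC {k : Type u} [Field k] [CharZero k] {X : TopCat.{u}}
    (Ψ : StarDef.PseudoTensorCat.{u, v} k X) (A : StarDef.AlgebraIn Ψ)
    (R : Type u) [CommRing R] [Algebra k R] [IsLocalRing R] [Module.Finite k R] :
    (StarDef.Def A R).IsTwoGroupoid ∧
    (A.hochschild.tensor (IsLocalRing.maximalIdeal R)).MC2.IsTwoGroupoid ∧
    ∃ F : StarDef.TwoFunctor (StarDef.Def A R)
        (A.hochschild.tensor (IsLocalRing.maximalIdeal R)).MC2,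
      StarDef.ExtendsMu A R F ∧ F.IsIso :=
  ⟨StarDef.def_isTwoGroupoid A R, (StarDef.famModel A R).mc2Rep.isTwoGroupoid,
    StarDef.toMC2 A R, StarDef.toMC2_extendsMu, StarDef.toMC2_isIso A R⟩
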